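/- Let X be a quasi-compact quasi-separated scheme and S a perfect generator of D_qc(X). Then there is an integer A = A(S) such that for every complex E ∈ D_qc(X) and every integer j with H^j(E) ≠ 0, one has Hom(S[n], E) ≠ 0 for some integer n ≤ A − j. -/

import Mathlib

/-!
Setup for statements about a (quasi-compact, quasi-separated) scheme `X`:

* `X.Modules` is the abelian category of sheaves of `O_X`-modules;
* for `U : X.Opens`, `ModOver X U` is the category of `O_U`-modules (sheaves of modules
  over the restriction of the structure sheaf to the localized site at `U`), and
  `restrictComplex X U` restricts complexes of `O_X`-modules to `U`;
* `D(X)` is `DerivedCategory X.Modules`, and `D_qc(X)` consists of the objects all of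
  whose homology sheaves are quasi-coherent;
* `StrictlyPerfect` means a bounded complex of finite-rank free modules;
* `IsNIsoD n ξ` says that `ξ` is an `n`-isomorphism: `H^j(ξ)` is invertible for `j > n`
  and surjective (epi) for `j = n`;
* `IsPseudoCoherent X n E` says that, locally on some open cover, `E` admits an
  `n`-isomorphism from a strictly perfect complex, and `IsPerfect X E` says that `E` is
  locally `D`-isomorphic to a strictly perfect complex.
-/

open CategoryTheory CategoryTheory.Limits AlgebraicGeometry TopologicalSpace

universe u

noncomputable section

namespace LN

variable (X : Scheme.{u})

/-- The category of `O_U`-modules, for an open `U` of the scheme `X`. -/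
abbrev ModOver (U : X.Opens) : Type (u + 1) :=
  SheafOfModules.{u} (X.ringCatSheaf.over U)

/-- Restriction of sheaves of `O_X`-modules to an open `U`. -/
abbrev restrictionFunctor (U : X.Opens) : X.Modules ⥤ ModOver X U :=
  SheafOfModules.pushforward (𝟙 _)

instance (U : X.Opens) : (restrictionFunctor X U).Additive := by
  constructor; intro A B f g; ext1; ext1; rfl

/-- Restriction of complexes of `O_X`-modules to an open `U`. -/
abbrev restrictComplex (U : X.Opens) :
    CochainComplex X.Modules ℤ ⥤ CochainComplex (ModOver X U) ℤ :=
  (restrictionFunctor X U).mapHomologicalComplex _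

/-- A strictly perfect complex on `U`: a bounded complex of finite-rank free modules. -/
def StrictlyPerfect (U : X.Opens) (P : CochainComplex (ModOver X U) ℤ) : Prop :=
  (∃ a b : ℤ, ∀ i : ℤ, (i < a ∨ b < i) → IsZero (P.X i)) ∧
    ∀ i : ℤ, ∃ k : ℕ, Nonempty (P.X i ≅ SheafOfModules.free (ULift.{u} (Fin k)))

/-- `ξ` is an `n`-isomorphism: `H^j(ξ)` is bijective for `j > n` and surjective
for `j = n`. -/
def IsNIsoD {C : Type u₁} [Category.{v₁} C] [Abelian C] [HasDerivedCategory.{w₁} C]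
    (n : ℤ) {P E : DerivedCategory C} (ξ : P ⟶ E) : Prop :=
  (∀ j : ℤ, n < j → IsIso ((DerivedCategory.homologyFunctor C j).map ξ)) ∧
    Epi ((DerivedCategory.homologyFunctor C n).map ξ)

/-- `E` is an `n`-pseudo-coherent complex of `O_X`-modules: on each member `U α` of some
open cover of `X` there is an `n`-isomorphism `P ⟶ E|_{U α}` in `D(U α)` with `P`
strictly perfect. -/
def IsPseudoCoherent [∀ U : X.Opens, HasDerivedCategory.{u + 1} (ModOver X U)]
    (n : ℤ) (E : CochainComplex X.Modules ℤ) : Prop :=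
  ∃ (ι : Type u) (U : ι → X.Opens),
    iSup U = ⊤ ∧
    ∀ α : ι, ∃ P : CochainComplex (ModOver X (U α)) ℤ,
      StrictlyPerfect X (U α) P ∧
      ∃ ξ : DerivedCategory.Q.obj P ⟶ DerivedCategory.Q.obj ((restrictComplex X (U α)).obj E),
        IsNIsoD n ξ

/-- `E` is a perfect complex of `O_X`-modules: locally on some open cover of `X`, it is
`D`-isomorphic to a strictly perfect complex. -/
def IsPerfect [∀ U : X.Opens, HasDerivedCategory.{u + 1} (ModOver X U)]
    (E : CochainComplex X.Modules ℤ) : Prop :=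
  ∃ (ι : Type u) (U : ι → X.Opens),
    iSup U = ⊤ ∧
    ∀ α : ι, ∃ P : CochainComplex (ModOver X (U α)) ℤ,
      StrictlyPerfect X (U α) P ∧
      Nonempty
        (DerivedCategory.Q.obj ((restrictComplex X (U α)).obj E) ≅ DerivedCategory.Q.obj P)

/-- The complex `E` lies in `D_qc(X)`: all its homology sheaves are quasi-coherent. -/
def MemDqc (E : CochainComplex X.Modules ℤ) : Prop :=
  ∀ n : ℤ, (E.homology n).IsQuasicoherent

end LN

namespace LN

universe w v

section

variable {X : Scheme.{u}} {F G H : X.Modules}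

/-! ### Sections of sheaves of modules -/

/-- Restriction of sections of a sheaf of modules. -/
def rs (F : X.Modules) {W' W : X.Opens} (h : W' ≤ W) : Γ(F, W) →+ Γ(F, W') :=
  (F.presheaf.map (homOfLE h).op).hom

/-- Restriction of sections of the structure sheaf. -/
def ors {W' W : X.Opens} (h : W' ≤ W) : Γ(X, W) →+* Γ(X, W') :=
  (X.presheaf.map (homOfLE h).op).hom

/-- A morphism of sheaves of modules on sections. -/
def ap (φ : F ⟶ G) (W : X.Opens) : Γ(F, W) →+ Γ(G, W) := (φ.app W).hom

@[simp] lemma rs_self {W : X.Opens} (h : W ≤ W) (s : Γ(F, W)) : rs F h s = s := by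
  simp [rs]

lemma rs_rs {W₁ W₂ W₃ : X.Opens} (h : W₁ ≤ W₂) (h' : W₂ ≤ W₃) (s : Γ(F, W₃)) :
    rs F h (rs F h' s) = rs F (h.trans h') s := by
  have : (homOfLE (h.trans h')).op = (homOfLE h').op ≫ (homOfLE h).op := rfl
  simp [rs, this]

lemma ors_ors {W₁ W₂ W₃ : X.Opens} (h : W₁ ≤ W₂) (h' : W₂ ≤ W₃) (s : Γ(X, W₃)) :
    ors h (ors h' s) = ors (h.trans h') s := by
  have : (homOfLE (h.trans h')).op = (homOfLE h').op ≫ (homOfLE h).op := rfl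
  simp [ors, this]

@[simp] lemma ors_self {W : X.Opens} (h : W ≤ W) (s : Γ(X, W)) : ors h s = s := by
  simp [ors]

lemma rs_smul {W' W : X.Opens} (h : W' ≤ W) (r : Γ(X, W)) (s : Γ(F, W)) :
    rs F h (r • s) = ors h r • rs F h s :=
  Scheme.Modules.map_smul F (homOfLE h) r s

lemma ap_smul (φ : F ⟶ G) {W : X.Opens} (r : Γ(X, W)) (s : Γ(F, W)) :
    ap φ W (r • s) = r • ap φ W s :=
  Scheme.Modules.Hom.app_smul φ r s

lemma ap_rs (φ : F ⟶ G) {W' W : X.Opens} (h : W' ≤ W) (s : Γ(F, W)) :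
    ap φ W' (rs F h s) = rs G h (ap φ W s) :=
  congr($(φ.mapPresheaf.naturality (homOfLE h).op) s)

@[simp] lemma ap_comp (φ : F ⟶ G) (ψ : G ⟶ H) {W : X.Opens} (s : Γ(F, W)) :
    ap (φ ≫ ψ) W s = ap ψ W (ap φ W s) := rfl

@[simp] lemma ap_id {W : X.Opens} (s : Γ(F, W)) : ap (𝟙 F) W s = s := rfl

@[simp] lemma ap_zero {W : X.Opens} (s : Γ(F, W)) : ap (0 : F ⟶ G) W s = 0 := rfl

@[simp] lemma ap_add (φ ψ : F ⟶ G) {W : X.Opens} (s : Γ(F, W)) :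
    ap (φ + ψ) W s = ap φ W s + ap ψ W s := rfl

@[simp] lemma ap_sub (φ ψ : F ⟶ G) {W : X.Opens} (s : Γ(F, W)) :
    ap (φ - ψ) W s = ap φ W s - ap ψ W s := rfl

lemma hom_ext_ap {φ ψ : F ⟶ G} (h : ∀ W (s : Γ(F, W)), ap φ W s = ap ψ W s) : φ = ψ := by
  apply Scheme.Modules.hom_ext
  intro W
  ext s
  exact h W s

/-- Construct a morphism of sheaves of modules from its action on sections. -/
def mkHom (f : ∀ W, Γ(F, W) →+ Γ(G, W))
    (hr : ∀ {W' W : X.Opens} (h : W' ≤ W) (s : Γ(F, W)), f W' (rs F h s) = rs G h (f W s))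
    (hs : ∀ {W : X.Opens} (r : Γ(X, W)) (s : Γ(F, W)), f W (r • s) = r • f W s) : F ⟶ G :=
  SheafOfModules.Hom.mk (PresheafOfModules.homMk
    { app := fun W => AddCommGrpCat.ofHom (f W.unop)
      naturality := fun W W' i => by
        ext s
        exact hr (leOfHom i.unop) s }
    (fun W r s => hs r s))

lemma sec_ext {W : X.Opens} {s t : Γ(F, W)}
    (h : ∀ x ∈ W, ∃ (W' : X.Opens) (h : W' ≤ W), x ∈ W' ∧ rs F h s = rs F h t) : s = t := by
  choose! W' hW' hx hs using h
  refine TopCat.Sheaf.eq_of_locally_eq' (⟨F.presheaf, F.isSheaf⟩ : TopCat.Sheaf Ab X)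
    (fun x : W => W' x) W (fun x => homOfLE (hW' x x.2)) ?_ s t ?_
  · intro x hxW
    simp only [Opens.mem_iSup]
    exact ⟨⟨x, hxW⟩, hx x hxW⟩
  · intro x
    exact hs x x.2

lemma sec_glue {W : X.Opens} {ι : Type*} (U : ι → X.Opens) (hU : ∀ i, U i ≤ W)
    (hc : ∀ x ∈ W, ∃ i, x ∈ U i) (s : ∀ i, Γ(F, U i))
    (hs : ∀ i j, rs F (inf_le_left : U i ⊓ U j ≤ U i) (s i) =
      rs F (inf_le_right : U i ⊓ U j ≤ U j) (s j)) :
    ∃ t : Γ(F, W), ∀ i, rs F (hU i) t = s i := by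
  obtain ⟨t, ht, -⟩ := TopCat.Sheaf.existsUnique_gluing'
    (⟨F.presheaf, F.isSheaf⟩ : TopCat.Sheaf Ab X) U W (fun i => homOfLE (hU i))
    (by
      intro x hx
      simpa only [Opens.mem_iSup] using hc x hx) s (fun i j => hs i j)
  exact ⟨t, ht⟩

/-- Gluing of a locally defined section which is locally unique. -/
lemma sec_glue_prop {W : X.Opens} (P : ∀ W' : X.Opens, Γ(F, W') → Prop)
    (hP : ∀ {W₁ W₂ : X.Opens} (h : W₁ ≤ W₂) (s), W₂ ≤ W → P W₂ s → P W₁ (rs F h s))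
    (hu : ∀ {W₁ : X.Opens} (s t), W₁ ≤ W → P W₁ s → P W₁ t → s = t)
    (he : ∀ x ∈ W, ∃ (W' : X.Opens) (_ : W' ≤ W) (s : Γ(F, W')), x ∈ W' ∧ P W' s) :
    ∃ t : Γ(F, W), ∀ x ∈ W, ∃ (W' : X.Opens) (h : W' ≤ W), x ∈ W' ∧ P W' (rs F h t) := by
  choose! W' hW' s hx hs using he
  obtain ⟨t, ht⟩ := sec_glue (F := F) (W := W) (fun x : W => W' x) (fun x => hW' x x.2)
    (fun x hxW => ⟨⟨x, hxW⟩, hx x hxW⟩) (fun x => s x) (fun x y =>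
      hu _ _ (inf_le_left.trans (hW' x x.2)) (hP _ _ (hW' x x.2) (hs x x.2))
        (hP _ _ (hW' y y.2) (hs y y.2)))
  refine ⟨t, fun x hxW => ⟨W' x, hW' x hxW, hx x hxW, ?_⟩⟩
  rw [show rs F _ t = s x from ht ⟨x, hxW⟩]
  exact hs x hxW

/-! ### Subsheaves -/

/-- A subsheaf of modules, given by its sections. -/
structure Sub (F : X.Modules) where
  /-- the sections -/
  mem : ∀ W : X.Opens, Set Γ(F, W)
  zero : ∀ W, 0 ∈ mem W
  add : ∀ {W s t}, s ∈ mem W → t ∈ mem W → s + t ∈ mem W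
  smul : ∀ {W s} (r : Γ(X, W)), s ∈ mem W → r • s ∈ mem W
  res : ∀ {W' W : X.Opens} (h : W' ≤ W) {s}, s ∈ mem W → rs F h s ∈ mem W'
  loc : ∀ {W : X.Opens} {s : Γ(F, W)},
    (∀ x ∈ W, ∃ (W' : X.Opens) (h : W' ≤ W), x ∈ W' ∧ rs F h s ∈ mem W') → s ∈ mem W

namespace Sub

variable (N : Sub F)

/-- The underlying presheaf submodule. -/
def toPre : PresheafOfModules.Submodule F.val where
  obj W :=
    { carrier := N.mem W.unop
      zero_mem' := N.zero _
      add_mem' := fun hs ht => N.add hs ht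
      smul_mem' := fun r _ hs => N.smul (W := W.unop) r hs }
  map {_ _} f := fun _ hs => N.res (leOfHom f.unop) hs

lemma isSheaf : TopCat.Presheaf.IsSheaf (X := X.toTopCat) (N.toPre.toPresheafOfModules).presheaf := by
  rw [TopCat.Presheaf.isSheaf_iff_isSheafUniqueGluing]
  intro ι U sf hsf
  let s' : ∀ i, Γ(F, U i) := fun i => (sf i).1
  have hs' : ∀ i, s' i ∈ N.mem (U i) := fun i => (sf i).2
  obtain ⟨t, ht⟩ := sec_glue (F := F) (W := iSup U) U (fun i => le_iSup U i)
    (fun x hx => by simpa only [Opens.mem_iSup] using hx) s'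
    (fun i j => congrArg Subtype.val (hsf i j))
  have htm : t ∈ N.mem (iSup U) := N.loc fun x hx => by
    obtain ⟨i, hi⟩ := by simpa only [Opens.mem_iSup] using hx
    exact ⟨U i, le_iSup U i, hi, by rw [ht i]; exact hs' i⟩
  refine ⟨⟨t, htm⟩, fun i => Subtype.ext (ht i), fun t' ht' => Subtype.ext ?_⟩
  refine sec_ext (F := F) fun x hx => ?_
  obtain ⟨i, hi⟩ := by simpa only [Opens.mem_iSup] using hx
  refine ⟨U i, le_iSup U i, hi, ?_⟩
  rw [ht i]
  exact congrArg Subtype.val (ht' i)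

/-- The subsheaf as a sheaf of modules. -/
def obj : X.Modules := ⟨N.toPre.toPresheafOfModules, N.isSheaf⟩

/-- The inclusion. -/
def ι : N.obj ⟶ F := ⟨N.toPre.ι⟩

/-- Sections of the subsheaf. -/
def sec {W : X.Opens} (s : Γ(F, W)) (hs : s ∈ N.mem W) : Γ(N.obj, W) := ⟨s, hs⟩

@[simp] lemma ap_ι_sec {W : X.Opens} (s : Γ(F, W)) (hs : s ∈ N.mem W) :
    ap N.ι W (N.sec s hs) = s := rfl

lemma ι_mem {W : X.Opens} (s : Γ(N.obj, W)) : ap N.ι W s ∈ N.mem W := Subtype.prop (p := fun s => s ∈ N.mem W) s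

lemma ι_inj {W : X.Opens} {s t : Γ(N.obj, W)} (h : ap N.ι W s = ap N.ι W t) : s = t :=
  Subtype.ext h

end Sub

lemma mono_of_inj {φ : F ⟶ G} (h : ∀ W (s : Γ(F, W)), ap φ W s = 0 → s = 0) : Mono φ := by
  refine Preadditive.mono_of_cancel_zero _ fun {K} ψ hψ => ?_
  refine hom_ext_ap fun W s => ?_
  apply h
  rw [← ap_comp, hψ]
  simp

instance (N : Sub F) : Mono N.ι :=
  mono_of_inj fun _ _ h => N.ι_inj (by rw [h, map_zero])

/-- Lift a morphism to a subsheaf. -/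
def Sub.lift (N : Sub G) (φ : F ⟶ G) (h : ∀ W s, ap φ W s ∈ N.mem W) : F ⟶ N.obj :=
  mkHom (fun W =>
    { toFun := fun s => N.sec (ap φ W s) (h W s)
      map_zero' := N.ι_inj (by simp)
      map_add' := fun s t => N.ι_inj (by simp) })
    (fun h s => N.ι_inj (by simp [ap_rs]))
    (fun r s => N.ι_inj (by simp [ap_smul]))

@[simp] lemma Sub.lift_ι (N : Sub G) (φ : F ⟶ G) (h : ∀ W s, ap φ W s ∈ N.mem W) :
    N.lift φ h ≫ N.ι = φ := rfl

/-- The kernel subsheaf. -/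
def kerSub (φ : F ⟶ G) : Sub F where
  mem W := {s | ap φ W s = 0}
  zero W := by simp
  add hs ht := by simp_all
  smul r hs := by simp_all [ap_smul]
  res h s hs := by simp_all [ap_rs]
  loc {W s} h := by
    refine sec_ext fun x hx => ?_
    obtain ⟨W', hW', hx', h'⟩ := h x hx
    refine ⟨W', hW', hx', ?_⟩
    rw [← ap_rs, map_zero]
    exact h'

lemma inj_of_mono (φ : F ⟶ G) [Mono φ] {W : X.Opens} {s : Γ(F, W)} (hs : ap φ W s = 0) :
    s = 0 := by
  have h0 : (kerSub φ).ι ≫ φ = 0 := hom_ext_ap fun W s => (kerSub φ).ι_mem s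
  have h1 : (kerSub φ).ι = 0 := by rw [← cancel_mono φ, h0, zero_comp]
  have hs' : s ∈ (kerSub φ).mem W := hs
  have := congr(ap $h1 W ((kerSub φ).sec s hs'))
  simpa using this

lemma injective_of_mono (φ : F ⟶ G) [Mono φ] (W : X.Opens) : Function.Injective (ap φ W) :=
  (injective_iff_map_eq_zero _).2 fun _ => inj_of_mono φ

/-- A section is locally in the image of a morphism. -/
def LocIm (φ : F ⟶ G) {W : X.Opens} (s : Γ(G, W)) : Prop :=
  ∀ x ∈ W, ∃ (W' : X.Opens) (h : W' ≤ W), x ∈ W' ∧ ∃ t : Γ(F, W'), ap φ W' t = rs G h s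

lemma LocIm.of_ap (φ : F ⟶ G) {W : X.Opens} (s : Γ(F, W)) : LocIm φ (ap φ W s) :=
  fun _ hx => ⟨W, le_rfl, hx, s, by simp⟩

lemma locIm_trans {φ : F ⟶ G} {W : X.Opens} {s : Γ(G, W)}
    (h : ∀ x ∈ W, ∃ (W' : X.Opens) (h : W' ≤ W), x ∈ W' ∧ LocIm φ (rs G h s)) : LocIm φ s := by
  intro x hx
  obtain ⟨W', hW', hx', h'⟩ := h x hx
  obtain ⟨W'', hW'', hx'', t, ht⟩ := h' x hx'
  exact ⟨W'', hW''.trans hW', hx'', t, by rw [ht, rs_rs]⟩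

lemma LocIm.rs {φ : F ⟶ G} {W W' : X.Opens} (h : W' ≤ W) {s : Γ(G, W)} (hs : LocIm φ s) :
    LocIm φ (rs G h s) := by
  intro x hx
  obtain ⟨W'', hW'', hx'', t, ht⟩ := hs x (h hx)
  refine ⟨W'' ⊓ W', inf_le_right, ⟨hx'', hx⟩, LN.rs F inf_le_left t, ?_⟩
  rw [ap_rs, ht, rs_rs, rs_rs]

/-- The image subsheaf. -/
def imSub (φ : F ⟶ G) : Sub G where
  mem W := {s | LocIm φ s}
  zero W x hx := ⟨W, le_rfl, hx, 0, by simp⟩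
  add {W s t} hs ht x hx := by
    obtain ⟨W₁, h₁, hx₁, s', hs'⟩ := hs x hx
    obtain ⟨W₂, h₂, hx₂, t', ht'⟩ := ht x hx
    refine ⟨W₁ ⊓ W₂, inf_le_left.trans h₁, ⟨hx₁, hx₂⟩,
      rs F inf_le_left s' + rs F inf_le_right t', ?_⟩
    rw [map_add, ap_rs, ap_rs, hs', ht', rs_rs, rs_rs, map_add]
  smul {W s} r hs x hx := by
    obtain ⟨W₁, h₁, hx₁, s', hs'⟩ := hs x hx
    exact ⟨W₁, h₁, hx₁, ors h₁ r • s', by rw [ap_smul, hs', rs_smul]⟩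
  res h _ hs := hs.rs h
  loc h := locIm_trans h

lemma ap_mem_imSub (φ : F ⟶ G) (W : X.Opens) (s : Γ(F, W)) : ap φ W s ∈ (imSub φ).mem W :=
  LocIm.of_ap φ s

lemma epi_of_locIm {φ : F ⟶ G} (h : ∀ (W) (s : Γ(G, W)), LocIm φ s) : Epi φ := by
  refine Preadditive.epi_of_cancel_zero _ fun {K} ψ hψ => ?_
  refine hom_ext_ap fun W s => ?_
  refine sec_ext fun x hx => ?_
  obtain ⟨W', hW', hx', t, ht⟩ := h W s x hx
  refine ⟨W', hW', hx', ?_⟩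
  rw [← ap_rs, ← ht, ← ap_comp, hψ]
  simp

lemma locIm_of_epi (φ : F ⟶ G) [Epi φ] {W : X.Opens} (s : Γ(G, W)) : LocIm φ s := by
  have : (imSub φ).lift φ (ap_mem_imSub φ) ≫ (imSub φ).ι = φ := by simp
  have : Epi (imSub φ).ι := by
    have h : Epi ((imSub φ).lift φ (ap_mem_imSub φ) ≫ (imSub φ).ι) := by
      rw [this]; infer_instance
    exact epi_of_epi ((imSub φ).lift φ (ap_mem_imSub φ)) _
  have : IsIso (imSub φ).ι := isIso_of_mono_of_epi _
  have h2 : ap (imSub φ).ι W (ap (inv (imSub φ).ι) W s) = s := by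
    rw [← ap_comp]; simp
  have := (imSub φ).ι_mem (ap (inv (imSub φ).ι) W s)
  rwa [h2] at this

lemma isIso_of_bij {φ : F ⟶ G} (h : ∀ W, Function.Bijective (ap φ W)) : IsIso φ := by
  rw [Scheme.Modules.Hom.isIso_iff_isIso_app]
  intro W
  rw [ConcreteCategory.isIso_iff_bijective]
  exact h W

lemma bij_of_isIso (φ : F ⟶ G) [IsIso φ] (W : X.Opens) : Function.Bijective (ap φ W) := by
  have : IsIso (φ.app W) := inferInstance
  exact (ConcreteCategory.isIso_iff_bijective _).1 this

/-- Bijectivity on sections can be checked from injectivity and local surjectivity. -/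
lemma bij_of_inj_of_locIm {φ : F ⟶ G} {W : X.Opens}
    (hi : ∀ W' ≤ W, ∀ s : Γ(F, W'), ap φ W' s = 0 → s = 0)
    (hs : ∀ s : Γ(G, W), LocIm φ s) : Function.Bijective (ap φ W) := by
  refine ⟨(injective_iff_map_eq_zero _).2 (hi W le_rfl), fun s => ?_⟩
  obtain ⟨t, ht⟩ := sec_glue_prop (F := F) (W := W)
    (fun W' t => ∃ h : W' ≤ W, ap φ W' t = rs G h s)
    (fun {W₁ W₂} h t _ ⟨h', ht⟩ => ⟨h.trans h', by rw [ap_rs, ht, rs_rs]⟩)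
    (fun {W₁} t t' hW ⟨_, ht⟩ ⟨_, ht'⟩ => by
      rw [← sub_eq_zero]
      exact hi _ hW _ (by rw [map_sub, ht, ht', sub_self]))
    (fun x hx => by
      obtain ⟨W', hW', hx', t, ht⟩ := hs s x hx
      exact ⟨W', hW', t, hx', hW', ht⟩)
  refine ⟨t, sec_ext fun x hx => ?_⟩
  obtain ⟨W', hW', hx', _, ht'⟩ := ht x hx
  exact ⟨W', hW', hx', by rw [← ap_rs, ht']⟩

/-- Kernel of a morphism on sections. -/
lemma exists_kernel_lift (φ : F ⟶ G) {W : X.Opens} (s : Γ(F, W)) (hs : ap φ W s = 0) :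
    ∃ t : Γ(kernel φ, W), ap (kernel.ι φ) W t = s := by
  have h0 : (kerSub φ).ι ≫ φ = 0 := hom_ext_ap fun W s => (kerSub φ).ι_mem s
  have hs' : s ∈ (kerSub φ).mem W := hs
  refine ⟨ap (kernel.lift φ (kerSub φ).ι h0) W ((kerSub φ).sec s hs'), ?_⟩
  rw [← ap_comp, kernel.lift_ι, Sub.ap_ι_sec]

lemma exact_iff_locIm (S : ShortComplex X.Modules) :
    S.Exact ↔ ∀ (W : X.Opens) (s : Γ(S.X₂, W)), ap S.g W s = 0 → LocIm S.f s := by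
  rw [S.exact_iff_epi_kernel_lift]
  constructor
  · intro he W s hs
    obtain ⟨t, ht⟩ := exists_kernel_lift S.g s hs
    intro x hx
    obtain ⟨W', hW', hx', r, hr⟩ := locIm_of_epi (kernel.lift S.g S.f S.zero) t x hx
    refine ⟨W', hW', hx', r, ?_⟩
    rw [← ht, ← ap_rs, ← hr, ← ap_comp, kernel.lift_ι]
  · intro h
    refine epi_of_locIm fun W s x hx => ?_
    obtain ⟨W', hW', hx', r, hr⟩ := h W (ap (kernel.ι S.g) W s)
      (by rw [← ap_comp, kernel.condition, ap_zero]) x hx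
    refine ⟨W', hW', hx', r, ?_⟩
    apply injective_of_mono (kernel.ι S.g) W'
    rw [← ap_comp, kernel.lift_ι, hr, ap_rs]

end

section

variable {X : Scheme.{u}} {F G H : X.Modules}

/-! ### Extension by zero of the restriction to an open subset -/

/-- The subsheaf of sections vanishing near every point outside `V`. -/
def jSub (V : X.Opens) (F : X.Modules) : Sub F where
  mem W := {s | ∀ x ∈ W, x ∈ V ∨ ∃ (W' : X.Opens) (h : W' ≤ W), x ∈ W' ∧ rs F h s = 0}
  zero W x hx := Or.inr ⟨W, le_rfl, hx, by simp⟩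
  add {W s t} hs ht x hx := by
    obtain h | ⟨W₁, h₁, hx₁, hs'⟩ := hs x hx
    · exact Or.inl h
    obtain h | ⟨W₂, h₂, hx₂, ht'⟩ := ht x hx
    · exact Or.inl h
    refine Or.inr ⟨W₁ ⊓ W₂, inf_le_left.trans h₁, ⟨hx₁, hx₂⟩, ?_⟩
    rw [map_add, ← rs_rs inf_le_left h₁, hs', ← rs_rs inf_le_right h₂, ht']
    simp
  smul {W s} r hs x hx := by
    obtain h | ⟨W₁, h₁, hx₁, hs'⟩ := hs x hx
    · exact Or.inl h
    · exact Or.inr ⟨W₁, h₁, hx₁, by rw [rs_smul, hs', smul_zero]⟩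
  res {W' W} h {s} hs x hx := by
    obtain h | ⟨W₁, h₁, hx₁, hs'⟩ := hs x (h hx)
    · exact Or.inl h
    · refine Or.inr ⟨W₁ ⊓ W', inf_le_right, ⟨hx₁, hx⟩, ?_⟩
      rw [rs_rs, ← rs_rs inf_le_left h₁, hs', map_zero]
  loc {W s} h x hx := by
    obtain ⟨W', h', hx', hs⟩ := h x hx
    obtain h | ⟨W₁, h₁, hx₁, hs'⟩ := hs x hx'
    · exact Or.inl h
    · exact Or.inr ⟨W₁, h₁.trans h', hx₁, by rw [← rs_rs h₁ h', hs']⟩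

lemma mem_jSub_of_le {V W : X.Opens} (h : W ≤ V) (s : Γ(F, W)) : s ∈ (jSub V F).mem W :=
  fun _ hx => Or.inl (h hx)

lemma jSub_mono {Y V : X.Opens} (h : Y ≤ V) {W : X.Opens} {s : Γ(F, W)}
    (hs : s ∈ (jSub Y F).mem W) : s ∈ (jSub V F).mem W :=
  fun x hx => (hs x hx).imp (fun h' => h h') id

lemma ap_mem_jSub (φ : F ⟶ G) {V W : X.Opens} {s : Γ(F, W)}
    (hs : s ∈ (jSub V F).mem W) : ap φ W s ∈ (jSub V G).mem W := by
  intro x hx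
  obtain h | ⟨W₁, h₁, hx₁, hs'⟩ := hs x hx
  · exact Or.inl h
  · exact Or.inr ⟨W₁, h₁, hx₁, by rw [← ap_rs, hs', map_zero]⟩

/-- Extension by zero of the restriction to `V`, as an endofunctor. -/
def J (V : X.Opens) : X.Modules ⥤ X.Modules where
  obj F := (jSub V F).obj
  map {F G} φ := (jSub V G).lift ((jSub V F).ι ≫ φ)
    (fun _ s => ap_mem_jSub φ ((jSub V F).ι_mem s))

/-- The inclusion of the extension by zero. -/
def jin (V : X.Opens) (F : X.Modules) : (J V).obj F ⟶ F := (jSub V F).ι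

/-- The inclusion of the extension by zero, as a natural transformation. -/
def jι (V : X.Opens) : J V ⟶ 𝟭 X.Modules where
  app F := jin V F

instance (V : X.Opens) (F : X.Modules) : Mono (jin V F) :=
  inferInstanceAs (Mono (jSub V F).ι)

@[simp] lemma J_map_ι (V : X.Opens) (φ : F ⟶ G) :
    (J V).map φ ≫ jin V G = jin V F ≫ φ := rfl

lemma J_map_ι' (V : X.Opens) (φ : F ⟶ G) :
    (J V).map φ ≫ jin V G = jin V F ≫ φ := rfl

lemma ap_J_map (V : X.Opens) (φ : F ⟶ G) {W : X.Opens} (s : Γ((J V).obj F, W)) :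
    ap (jin V G) W (ap ((J V).map φ) W s) = ap φ W (ap (jin V F) W s) := rfl

lemma jι_mem {V W : X.Opens} (s : Γ((J V).obj F, W)) :
    ap (jin V F) W s ∈ (jSub V F).mem W := (jSub V F).ι_mem s

lemma jι_inj {V W : X.Opens} {s t : Γ((J V).obj F, W)}
    (h : ap (jin V F) W s = ap (jin V F) W t) : s = t :=
  (jSub V F).ι_inj h

/-- Sections of the extension by zero. -/
def jsec {V W : X.Opens} (s : Γ(F, W)) (hs : s ∈ (jSub V F).mem W) : Γ((J V).obj F, W) :=
  (jSub V F).sec s hs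

@[simp] lemma ap_jι_jsec {V W : X.Opens} (s : Γ(F, W)) (hs : s ∈ (jSub V F).mem W) :
    ap (jin V F) W (jsec s hs) = s := rfl

lemma J_local {V W : X.Opens} (s : Γ((J V).obj F, W)) {x : X} (hx : x ∈ W) :
    x ∈ V ∨ ∃ (W' : X.Opens) (h : W' ≤ W), x ∈ W' ∧ rs _ h s = 0 := by
  refine (jι_mem s x hx).imp id fun ⟨W', h', hx', h0⟩ => ⟨W', h', hx', ?_⟩
  apply jι_inj
  rw [ap_rs, h0, map_zero]

lemma jι_bij {V W : X.Opens} (h : W ≤ V) (F : X.Modules) :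
    Function.Bijective (ap (jin V F) W) :=
  ⟨injective_of_mono _ _, fun s => ⟨jsec s (mem_jSub_of_le h s), rfl⟩⟩

/-- Morphisms out of an extension by zero are determined on sections over opens inside `V`. -/
lemma J_hom_ext {V : X.Opens} {φ ψ : (J V).obj F ⟶ G}
    (h : ∀ W ≤ V, ∀ s, ap φ W s = ap ψ W s) : φ = ψ := by
  refine hom_ext_ap fun W s => sec_ext fun x hx => ?_
  obtain hV | ⟨W', h', hx', h0⟩ := J_local s hx
  · exact ⟨W ⊓ V, inf_le_left, ⟨hx, hV⟩, by rw [← ap_rs, ← ap_rs, h _ inf_le_right]⟩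
  · exact ⟨W', h', hx', by rw [← ap_rs, ← ap_rs, h0, map_zero, map_zero]⟩

lemma J_isIso {V : X.Opens} {φ : F ⟶ G} (h : ∀ W ≤ V, Function.Bijective (ap φ W)) :
    IsIso ((J V).map φ) := by
  refine isIso_of_bij fun W => bij_of_inj_of_locIm ?_ ?_
  · intro W' _ s hs
    refine sec_ext fun x hx => ?_
    obtain hV | ⟨W'', h', hx', h0⟩ := J_local s hx
    · refine ⟨W' ⊓ V, inf_le_left, ⟨hx, hV⟩, ?_⟩
      apply jι_inj
      apply (h _ inf_le_right).1
      rw [← ap_J_map, ap_rs, hs]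
      simp
    · exact ⟨W'', h', hx', by rw [h0, map_zero]⟩
  · intro s x hx
    obtain hV | ⟨W', h', hx', h0⟩ := J_local s hx
    · obtain ⟨t, ht⟩ := (h (W ⊓ V) inf_le_right).2 (ap (jin V G) _ (rs _ inf_le_left s))
      refine ⟨W ⊓ V, inf_le_left, ⟨hx, hV⟩, jsec t (mem_jSub_of_le inf_le_right t), ?_⟩
      apply jι_inj
      rw [ap_J_map, ap_jι_jsec, ht]
    · exact ⟨W', h', hx', 0, by rw [h0, map_zero]⟩

lemma J_locIm {V : X.Opens} {φ : F ⟶ G} {W : X.Opens} {s : Γ((J V).obj G, W)}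
    (h : LocIm φ (ap (jin V G) W s)) : LocIm ((J V).map φ) s := by
  intro x hx
  obtain hV | ⟨W', h', hx', h0⟩ := J_local s hx
  · obtain ⟨W', h', hx', t, ht⟩ := h x hx
    refine ⟨W' ⊓ V, inf_le_left.trans h', ⟨hx', hV⟩,
      jsec (rs _ inf_le_left t) (mem_jSub_of_le inf_le_right _), ?_⟩
    apply jι_inj
    rw [ap_J_map, ap_jι_jsec, ap_rs, ht, rs_rs, ap_rs]
  · exact ⟨W', h', hx', 0, by rw [h0, map_zero]⟩

instance (V : X.Opens) : (J V).Additive where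
  map_add {F G φ ψ} := by
    rw [← cancel_mono (jin V G)]
    simp only [J_map_ι, Preadditive.comp_add, Preadditive.add_comp]

instance (V : X.Opens) (φ : F ⟶ G) [Epi φ] : Epi ((J V).map φ) :=
  epi_of_locIm fun _ _ => J_locIm (locIm_of_epi φ _)

instance (V : X.Opens) : (J V).PreservesHomology :=
  Functor.preservesHomology_of_map_exact _ fun S hS => by
    rw [exact_iff_locIm] at hS ⊢
    intro W s hs
    refine J_locIm (hS _ _ ?_)
    have := congrArg (ap (jin V _) W) hs
    exact this.trans (map_zero _)

instance (V : X.Opens) : PreservesFiniteLimits (J V) :=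
  Functor.preservesFiniteLimits_of_preservesHomology _

instance (V : X.Opens) : PreservesFiniteColimits (J V) :=
  Functor.preservesFiniteColimits_of_preservesHomology _

/-- The inclusion of extensions by zero. -/
def jle {Y V : X.Opens} (h : Y ≤ V) : J Y ⟶ J V where
  app F := (jSub V F).lift (jin Y F) (fun _ s => jSub_mono h (jι_mem s))

@[simp] lemma jle_ι {Y V : X.Opens} (h : Y ≤ V) (F : X.Modules) :
    (jle h).app F ≫ jin V F = jin Y F := rfl

lemma ap_jle_ι {Y V : X.Opens} (h : Y ≤ V) {W : X.Opens} (s : Γ((J Y).obj F, W)) :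
    ap (jin V F) W (ap ((jle h).app F) W s) = ap (jin Y F) W s := rfl

instance {Y V : X.Opens} (h : Y ≤ V) (F : X.Modules) : Mono ((jle h).app F) := by
  have : Mono ((jle h).app F ≫ jin V F) := by rw [jle_ι]; infer_instance
  exact mono_of_mono _ (jin V F)

lemma jle_bij {Y V W : X.Opens} (h : Y ≤ V) (hW : W ≤ Y) (F : X.Modules) :
    Function.Bijective (ap ((jle h).app F) W) := by
  refine ⟨injective_of_mono _ _, fun s => ?_⟩
  refine ⟨jsec (ap (jin V F) W s) (mem_jSub_of_le hW _), jι_inj ?_⟩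
  rw [ap_jle_ι, ap_jι_jsec]

instance (F : X.Modules) : IsIso (jin (⊤ : X.Opens) F) :=
  isIso_of_bij fun _ => jι_bij le_top F

/-! ### Push-forward of the restriction -/

/-- The push-forward of the restriction to `V`. -/
def T (V : X.Opens) : X.Modules ⥤ X.Modules :=
  Scheme.Modules.restrictFunctor V.ι ⋙ Scheme.Modules.pushforward V.ι

/-- The restriction morphism. -/
def tη (V : X.Opens) (F : X.Modules) : F ⟶ (T V).obj F :=
  (Scheme.Modules.restrictAdjunction V.ι).unit.app F

/-- The restriction morphism, as a natural transformation. -/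
def Tη (V : X.Opens) : 𝟭 X.Modules ⟶ T V := (Scheme.Modules.restrictAdjunction V.ι).unit

/-- The intersection with `V`, in the form that occurs in sections of `T V`. -/
def cap (V W : X.Opens) : X.Opens := V.ι ''ᵁ (V.ι ⁻¹ᵁ W)

lemma cap_eq (V W : X.Opens) : cap V W = V ⊓ W := by
  simpa [cap] using V.ι.image_preimage_eq_opensRange_inf W

lemma cap_le_left (V W : X.Opens) : cap V W ≤ V := by rw [cap_eq]; exact inf_le_left
lemma cap_le (V W : X.Opens) : cap V W ≤ W := by rw [cap_eq]; exact inf_le_right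

lemma cap_mono (V : X.Opens) {W W' : X.Opens} (h : W' ≤ W) : cap V W' ≤ cap V W := by
  rw [cap_eq, cap_eq]; exact inf_le_inf_left _ h

/-- Sections of `T V`. -/
def tsec {V : X.Opens} (G : X.Modules) (W : X.Opens) : Γ((T V).obj G, W) ≃+ Γ(G, cap V W) :=
  AddEquiv.refl _

lemma tsec_rs {V : X.Opens} {W' W : X.Opens} (h : W' ≤ W) (s : Γ((T V).obj G, W)) :
    tsec G W' (rs _ h s) = rs G (cap_mono V h) (tsec G W s) := rfl

lemma tsec_ap {V : X.Opens} (φ : F ⟶ G) {W : X.Opens} (s : Γ((T V).obj F, W)) :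
    tsec G W (ap ((T V).map φ) W s) = ap φ (cap V W) (tsec F W s) := rfl

lemma tsec_η {V : X.Opens} {W : X.Opens} (s : Γ(F, W)) :
    tsec F W (ap (tη V F) W s) = rs F (cap_le V W) s := rfl

lemma rs_bij_of_eq {W W' : X.Opens} (h : W' = W) (F : X.Modules) :
    Function.Bijective (rs F h.le) := by
  subst h
  exact ⟨fun s t h => by simpa using h, fun s => ⟨s, by simp⟩⟩

lemma tη_bij {V W : X.Opens} (h : W ≤ V) (F : X.Modules) :
    Function.Bijective (ap (tη V F) W) := by
  have h1 : cap V W = W := by rw [cap_eq]; exact inf_eq_right.2 h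
  refine ((tsec F W).bijective.of_comp_iff' _).1 ?_
  have h2 : ⇑(tsec F W) ∘ ⇑(ap (tη V F) W) = ⇑(rs F h1.le) :=
    funext fun s => tsec_η s
  rw [h2]
  exact rs_bij_of_eq h1 F

lemma tsec_smul {V : X.Opens} {W : X.Opens} (r : Γ(X, W)) (s : Γ((T V).obj G, W)) :
    tsec G W (r • s) = ors (cap_le V W) r • tsec G W s :=
  congrArg (fun a : Γ(X, cap V W) => a • tsec G W s)
    congr($(V.ι.app_appIso_inv W).hom r)

end

section

variable {X : Scheme.{u}} {F G H : X.Modules}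

instance (V : X.Opens) (F : X.Modules) : IsIso ((J V).map (tη V F)) :=
  J_isIso fun _ hW => tη_bij hW F

lemma T_isIso {V : X.Opens} {φ : F ⟶ G} (h : ∀ W ≤ V, Function.Bijective (ap φ W)) :
    IsIso ((T V).map φ) :=
  isIso_of_bij fun W => by
    refine ((tsec G W).bijective.of_comp_iff' _).1 ?_
    have h2 : ⇑(tsec G W) ∘ ⇑(ap ((T V).map φ) W) = ⇑(ap φ (cap V W)) ∘ ⇑(tsec F W) :=
      funext fun s => tsec_ap φ s
    rw [h2]
    exact (h _ (cap_le_left V W)).comp (tsec F W).bijective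

instance (V : X.Opens) (F : X.Modules) : IsIso ((T V).map (jin V F)) :=
  T_isIso fun _ hW => jι_bij hW F

lemma tη_naturality (V : X.Opens) (φ : F ⟶ G) : φ ≫ tη V G = tη V F ≫ (T V).map φ :=
  (Tη V).naturality φ

/-- The counit of the adjunction. -/
def jκ (V : X.Opens) (G : X.Modules) : (J V).obj ((T V).obj G) ⟶ G :=
  inv ((J V).map (tη V G)) ≫ jin V G

@[simp] lemma J_tη_jκ (V : X.Opens) (G : X.Modules) : (J V).map (tη V G) ≫ jκ V G = jin V G := by
  simp [jκ]

lemma jκ_naturality (V : X.Opens) (φ : F ⟶ G) :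
    (J V).map ((T V).map φ) ≫ jκ V G = jκ V F ≫ φ := by
  rw [← cancel_epi ((J V).map (tη V F)), ← Category.assoc, ← Functor.map_comp, ← tη_naturality,
    Functor.map_comp, Category.assoc, J_tη_jκ, ← Category.assoc, J_tη_jκ, J_map_ι']

lemma tη_jκ {V W : X.Opens} (t : Γ((J V).obj ((T V).obj G), W)) :
    ap (tη V G) W (ap (jκ V G) W t) = ap (jin V _) W t := by
  obtain ⟨r, rfl⟩ := (bij_of_isIso ((J V).map (tη V G)) W).2 t
  have h := congr(ap $(J_tη_jκ V G) W r)
  rw [ap_comp] at h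
  rw [h, ← ap_comp, ← ap_comp, J_map_ι']

/-- The unit of the adjunction. -/
def tu (V : X.Opens) (F : X.Modules) : F ⟶ (T V).obj ((J V).obj F) :=
  tη V F ≫ inv ((T V).map (jin V F))

lemma tη_T (V : X.Opens) (G : X.Modules) : tη V ((T V).obj G) = (T V).map (tη V G) := by
  refine hom_ext_ap fun W s => ?_
  apply (tsec ((T V).obj G) W).injective
  rw [tsec_η, tsec_ap]
  apply (tsec G (cap V W)).injective
  rw [tsec_rs, tsec_η]

lemma left_tri (V : X.Opens) (F : X.Modules) :
    (J V).map (tu V F) ≫ jκ V ((J V).obj F) = 𝟙 _ := by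
  rw [← cancel_mono (jin V F), Category.assoc, ← jκ_naturality, tu, Functor.map_comp,
    Category.assoc, ← Category.assoc ((J V).map (inv _)), ← Functor.map_comp]
  simp

instance (V : X.Opens) (G : X.Modules) : IsIso ((T V).map (tη V G)) :=
  T_isIso fun _ hW => tη_bij hW G

lemma right_tri (V : X.Opens) (G : X.Modules) :
    tu V ((T V).obj G) ≫ (T V).map (jκ V G) = 𝟙 _ := by
  have h := congrArg (T V).map (J_map_ι' V (tη V G))
  rw [Functor.map_comp, Functor.map_comp] at h
  rw [tu, Category.assoc, tη_T, jκ, Functor.map_comp, ← Category.assoc (inv _),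
    Functor.map_inv, ← IsIso.inv_comp]
  rw [← cancel_mono ((T V).map (tη V G)), Category.assoc, Category.assoc, ← h,
    IsIso.inv_hom_id, Category.comp_id, Category.id_comp]

lemma tu_naturality (V : X.Opens) (φ : F ⟶ G) :
    φ ≫ tu V G = tu V F ≫ (T V).map ((J V).map φ) := by
  rw [tu, ← Category.assoc, tη_naturality, tu, Category.assoc, Category.assoc]
  congr 1
  rw [IsIso.eq_inv_comp, ← Category.assoc, IsIso.comp_inv_eq, ← Functor.map_comp,
    ← Functor.map_comp, J_map_ι']

/-- Extension by zero is left adjoint to the push-forward of the restriction. -/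
def adjJT (V : X.Opens) : J V ⊣ T V :=
  Adjunction.mkOfUnitCounit
    { unit :=
        { app := tu V
          naturality := fun F G φ => tu_naturality V φ }
      counit :=
        { app := jκ V
          naturality := fun F G φ => jκ_naturality V φ }
      left_triangle := by
        ext F : 2
        exact (congrArg _ (Category.id_comp _)).trans (left_tri V F)
      right_triangle := by
        ext G : 2
        exact (congrArg _ (Category.id_comp _)).trans (right_tri V G) }

instance (V : X.Opens) : (J V).IsLeftAdjoint := (adjJT V).isLeftAdjoint

instance (V : X.Opens) : (T V).Additive := (adjJT V).right_adjoint_additive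

instance (V : X.Opens) (F : X.Modules) [Injective F] : Injective ((T V).obj F) :=
  (adjJT V).map_injective F ‹_›

/-! ### Morphisms given on sections over opens inside `V` -/

/-- A linear map on sections over all opens inside `V`. -/
structure LocHom (V : X.Opens) (F G : X.Modules) where
  /-- the map on sections -/
  f : ∀ W, W ≤ V → Γ(F, W) →+ Γ(G, W)
  res : ∀ {W' W : X.Opens} (h : W' ≤ W) (hW : W ≤ V) (s : Γ(F, W)),
    f W' (h.trans hW) (rs F h s) = rs G h (f W hW s)
  smul : ∀ {W : X.Opens} (hW : W ≤ V) (r : Γ(X, W)) (s : Γ(F, W)),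
    f W hW (r • s) = r • f W hW s

/-- The morphism to `T V` associated to a local morphism. -/
def tdesc {V : X.Opens} (ψ : LocHom V F G) : F ⟶ (T V).obj G :=
  mkHom (fun W => (tsec G W).symm.toAddMonoidHom.comp
      ((ψ.f (cap V W) (cap_le_left V W)).comp (rs F (cap_le V W))))
    (fun {W' W} h s => by
      apply (tsec G W').injective
      rw [tsec_rs]
      simp only [AddMonoidHom.coe_comp, Function.comp_apply, AddEquiv.toAddMonoidHom_eq_coe,
        AddMonoidHom.coe_coe, AddEquiv.apply_symm_apply]
      rw [← ψ.res, rs_rs, rs_rs])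
    (fun {W} r s => by
      apply (tsec G W).injective
      rw [tsec_smul]
      simp only [AddMonoidHom.coe_comp, Function.comp_apply, AddEquiv.toAddMonoidHom_eq_coe,
        AddMonoidHom.coe_coe, AddEquiv.apply_symm_apply]
      rw [← ψ.smul, rs_smul])

lemma tsec_tdesc {V : X.Opens} (ψ : LocHom V F G) {W : X.Opens} (s : Γ(F, W)) :
    tsec G W (ap (tdesc ψ) W s) = ψ.f (cap V W) (cap_le_left V W) (rs F (cap_le V W) s) := rfl

/-- The morphism from `J V` associated to a local morphism. -/
def jdesc {V : X.Opens} (ψ : LocHom V F G) : (J V).obj F ⟶ G :=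
  (J V).map (tdesc ψ) ≫ jκ V G

lemma ap_jdesc {V : X.Opens} (ψ : LocHom V F G) {W : X.Opens} (hW : W ≤ V)
    (s : Γ((J V).obj F, W)) : ap (jdesc ψ) W s = ψ.f W hW (ap (jin V F) W s) := by
  apply (tη_bij hW G).1
  rw [jdesc, ap_comp, tη_jκ, ap_J_map]
  apply (tsec G W).injective
  rw [tsec_tdesc, ψ.res _ hW, tsec_η]

/-! ### The sheaves representing sections -/

variable (X) in
/-- The structure sheaf. -/
def OX : X.Modules := SheafOfModules.unit X.ringCatSheaf

/-- Sections of the structure sheaf. -/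
def osec (W : X.Opens) : Γ(OX X, W) ≃+ Γ(X, W) := AddEquiv.refl _

lemma osec_rs {W' W : X.Opens} (h : W' ≤ W) (s : Γ(OX X, W)) :
    osec W' (rs _ h s) = ors h (osec W s) := rfl

lemma osec_smul {W : X.Opens} (r : Γ(X, W)) (s : Γ(OX X, W)) :
    osec W (r • s) = r * osec W s := rfl

/-- The extension by zero of the structure sheaf of `V`. -/
abbrev O (V : X.Opens) : X.Modules := (J V).obj (OX X)

/-- The unit section. -/
def one (V : X.Opens) : Γ(O V, V) := jsec ((osec V).symm 1) (mem_jSub_of_le le_rfl _)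

lemma jin_one (V : X.Opens) : ap (jin V (OX X)) V (one V) = (osec V).symm 1 := rfl

/-- The morphism associated to a section. -/
def ofSec {V : X.Opens} (s : Γ(F, V)) : O V ⟶ F :=
  jdesc
    { f := fun W hW =>
        { toFun := fun r => osec W r • rs F hW s
          map_zero' := by rw [map_zero, zero_smul]
          map_add' := fun a b => by rw [map_add, add_smul] }
      res := fun {W' W} h hW a => by
        simp only [AddMonoidHom.coe_mk, ZeroHom.coe_mk]
        rw [osec_rs, rs_smul, rs_rs]
      smul := fun {W} hW r a => by
        simp only [AddMonoidHom.coe_mk, ZeroHom.coe_mk]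
        rw [osec_smul, mul_smul] }

lemma ap_ofSec {V W : X.Opens} (s : Γ(F, V)) (hW : W ≤ V) (t : Γ(O V, W)) :
    ap (ofSec s) W t = osec W (ap (jin V (OX X)) W t) • rs F hW s :=
  ap_jdesc _ hW t

lemma O_eq_smul {V W : X.Opens} (hW : W ≤ V) (t : Γ(O V, W)) :
    t = osec W (ap (jin V (OX X)) W t) • rs _ hW (one V) := by
  apply jι_inj
  apply (osec W).injective
  rw [ap_smul, ap_rs, jin_one, osec_smul, osec_rs, AddEquiv.apply_symm_apply, map_one, mul_one]

/-- Morphisms from `O V` are sections over `V`. -/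
def ev (V : X.Opens) (F : X.Modules) : (O V ⟶ F) ≃+ Γ(F, V) where
  toFun φ := ap φ V (one V)
  invFun s := ofSec s
  left_inv φ := by
    change ofSec (ap φ V (one V)) = φ
    refine J_hom_ext fun W hW t => ?_
    rw [ap_ofSec _ hW, ← ap_rs, ← ap_smul, ← O_eq_smul hW t]
  right_inv s := by
    change ap (ofSec s) V (one V) = s
    rw [ap_ofSec _ le_rfl, jin_one, AddEquiv.apply_symm_apply, one_smul, rs_self]
  map_add' φ ψ := rfl

lemma ev_apply {V : X.Opens} (φ : O V ⟶ F) : ev V F φ = ap φ V (one V) := rfl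

lemma ev_comp {V : X.Opens} (φ : O V ⟶ F) (ψ : F ⟶ G) : ev V G (φ ≫ ψ) = ap ψ V (ev V F φ) :=
  rfl

/-- The inclusion of `O Y` in `O V`. -/
def ole {Y V : X.Opens} (h : Y ≤ V) : O Y ⟶ O V := (jle h).app (OX X)

lemma ole_one {Y V : X.Opens} (h : Y ≤ V) : ap (ole h) Y (one Y) = rs _ h (one V) := by
  apply jι_inj
  rw [ap_rs, jin_one, ole, ap_jle_ι, jin_one]
  apply (osec Y).injective
  rw [osec_rs, AddEquiv.apply_symm_apply, AddEquiv.apply_symm_apply, map_one]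

lemma ev_ole {Y V : X.Opens} (h : Y ≤ V) (φ : O V ⟶ F) :
    ev Y F (ole h ≫ φ) = rs F h (ev V F φ) := by
  rw [ev_apply, ev_apply, ap_comp, ole_one, ap_rs]

/-! ### Multiplication by a function on `V` -/

/-- Multiplication by a function on `V` on `J V`. -/
def mulApp {V : X.Opens} (f : Γ(X, V)) (F : X.Modules) : (J V).obj F ⟶ (J V).obj F :=
  jdesc
    { f := fun W hW =>
        { toFun := fun r => jsec (ors hW f • r) (mem_jSub_of_le hW _)
          map_zero' := jι_inj (by simp)
          map_add' := fun a b => jι_inj (by simp) }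
      res := fun {W' W} h hW a => jι_inj (by
        simp only [AddMonoidHom.coe_mk, ZeroHom.coe_mk]
        rw [ap_jι_jsec, ap_rs, ap_jι_jsec, rs_smul, ors_ors])
      smul := fun {W} hW r a => jι_inj (by
        simp only [AddMonoidHom.coe_mk, ZeroHom.coe_mk]
        rw [ap_jι_jsec, ap_smul, ap_jι_jsec, smul_smul, smul_smul, mul_comm]) }

lemma ap_mulApp {V : X.Opens} (f : Γ(X, V)) (F : X.Modules) {W : X.Opens} (hW : W ≤ V)
    (s : Γ((J V).obj F, W)) : ap (mulApp f F) W s = ors hW f • s := by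
  apply jι_inj
  rw [mulApp, ap_jdesc _ hW, ap_smul]
  rfl

/-- Multiplication by a function on `V`, as a natural transformation. -/
def mul {V : X.Opens} (f : Γ(X, V)) : J V ⟶ J V where
  app F := mulApp f F
  naturality F G φ := J_hom_ext fun W hW s => by
    rw [ap_comp, ap_comp, ap_mulApp f _ hW, ap_mulApp f _ hW, ap_smul]

lemma ap_mul {V : X.Opens} (f : Γ(X, V)) (F : X.Modules) {W : X.Opens} (hW : W ≤ V)
    (s : Γ((J V).obj F, W)) : ap ((mul f).app F) W s = ors hW f • s := ap_mulApp f F hW s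

lemma jle_mul {Y V : X.Opens} (h : Y ≤ V) (f : Γ(X, V)) :
    jle h ≫ mul f = mul (ors h f) ≫ jle h := by
  ext F : 2
  refine J_hom_ext fun W hW s => ?_
  rw [NatTrans.comp_app, NatTrans.comp_app, ap_comp, ap_comp, ap_mul _ _ (hW.trans h),
    ap_mul _ _ hW, ap_smul, ors_ors]

lemma mul_mul {V : X.Opens} (f g : Γ(X, V)) : mul f ≫ mul g = mul (f * g) := by
  ext F : 2
  refine J_hom_ext fun W hW s => ?_
  rw [NatTrans.comp_app, ap_comp, ap_mul _ _ hW, ap_mul _ _ hW, ap_mul _ _ hW, smul_smul, map_mul,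
    mul_comm]

lemma mul_one' (V : X.Opens) : mul (1 : Γ(X, V)) = 𝟙 _ := by
  ext F : 2
  refine J_hom_ext fun W hW s => ?_
  rw [ap_mul _ _ hW, map_one, one_smul, NatTrans.id_app, ap_id]

lemma mul_add' {V : X.Opens} (f g : Γ(X, V)) : mul (f + g) = mul f + mul g := by
  ext F : 2
  refine J_hom_ext fun W hW s => ?_
  rw [NatTrans.app_add, ap_add, ap_mul _ _ hW, ap_mul _ _ hW, ap_mul _ _ hW, map_add, add_smul]

lemma ev_mul {V : X.Opens} (f : Γ(X, V)) (φ : O V ⟶ F) :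
    ev V F ((mul f).app (OX X) ≫ φ) = f • ev V F φ := by
  rw [ev_apply, ev_apply, ap_comp, ← ap_smul]
  congr 1
  exact (ap_mul f _ le_rfl _).trans (by rw [ors_self])

/-! ### Composition of extensions by zero -/

lemma isIso_J_jin {Y V : X.Opens} (h : Y ≤ V) (F : X.Modules) : IsIso ((J Y).map (jin V F)) :=
  J_isIso fun _ hW => jι_bij (hW.trans h) F

lemma isIso_jle_J (V W : X.Opens) (F : X.Modules) :
    IsIso ((jle (inf_le_left : V ⊓ W ≤ V)).app ((J W).obj F)) := by
  refine isIso_of_bij fun U => ⟨injective_of_mono _ _, fun s => ?_⟩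
  have hm : ap (jin V _) U s ∈ (jSub (V ⊓ W) ((J W).obj F)).mem U := fun x hx => by
    obtain h | ⟨W', h', hx', h0⟩ := J_local s hx
    · obtain h₂ | h₂ := J_local (ap (jin V _) U s) hx
      · exact Or.inl (Opens.mem_inf.2 ⟨h, h₂⟩)
      · exact Or.inr h₂
    · exact Or.inr ⟨W', h', hx', by rw [← ap_rs, h0, map_zero]⟩
  refine ⟨jsec _ hm, jι_inj ?_⟩
  rw [ap_jle_ι, ap_jι_jsec]

end

section

section
variable {C : Type u} [SmallCategory C] (R : Cᵒᵖ ⥤ RingCat.{u})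

instance presheaf_ab5 : AB5OfSize.{u, u} (PresheafOfModules.{u} R) where
  ofShape J _ _ :=
    HasExactColimitsOfShape.domain_of_functor J (PresheafOfModules.toPresheaf R)
end

variable {X : Scheme.{u}}

def sheafifyAdj (X : Scheme.{u}) := PresheafOfModules.sheafificationAdjunction (𝟙 X.ringCatSheaf.obj)

instance : AB5OfSize.{u, u} X.Modules where
  ofShape J _ _ := (sheafifyAdj X).hasExactColimitsOfShape J


instance : HasSeparator X.Modules where
  hasSeparator := by
    refine ⟨∐ fun V : X.Opens => O V, isSeparator_sigma _ |>.2 ?_⟩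
    intro F G φ ψ h
    refine hom_ext_ap fun W s => ?_
    obtain ⟨a, rfl⟩ := (ev W F).surjective s
    rw [← ev_comp, ← ev_comp, h (O W) ⟨W⟩ a]

instance : IsGrothendieckAbelian.{u} X.Modules where

instance : EnoughInjectives X.Modules := inferInstance

end

section

/-- `ρ : A → B` exhibits `B` as the localization of `A` at the endomorphism `f`, up to the
bijectivity of the endomorphism `g` of `B` compatible with `f`. -/
structure IsLocMap {A B : Type*} [AddCommGroup A] [AddCommGroup B] (f : A →+ A) (g : B →+ B)
    (ρ : A →+ B) : Prop where
  comm : ∀ a, ρ (f a) = g (ρ a)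
  inj : ∀ a, ρ a = 0 → ∃ n : ℕ, f^[n] a = 0
  surj : ∀ b, ∃ (n : ℕ) (a : A), ρ a = g^[n] b

lemma iterate_comm {A B : Type*} [AddCommGroup A] [AddCommGroup B] {f : A →+ A} {g : B →+ B}
    {ρ : A →+ B} (h : ∀ a, ρ (f a) = g (ρ a)) (n : ℕ) (a : A) : ρ (f^[n] a) = g^[n] (ρ a) := by
  induction n generalizing a with
  | zero => rfl
  | succ n ih => rw [Function.iterate_succ_apply, Function.iterate_succ_apply, ih, h]

/-- The five lemma for localization maps. -/
lemma IsLocMap.five {A B : Fin 5 → Type*} [∀ i, AddCommGroup (A i)] [∀ i, AddCommGroup (B i)]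
    {f : ∀ i, A i →+ A i} {g : ∀ i, B i →+ B i} {ρ : ∀ i, A i →+ B i}
    (hc : ∀ i a, ρ i (f i a) = g i (ρ i a))
    (a0 : A 0 →+ A 1) (a1 : A 1 →+ A 2) (a2 : A 2 →+ A 3) (a3 : A 3 →+ A 4)
    (b0 : B 0 →+ B 1) (b1 : B 1 →+ B 2) (b2 : B 2 →+ B 3) (b3 : B 3 →+ B 4)
    (ha1 : ∀ x, a1 x = 0 ↔ ∃ y, a0 y = x) (ha2 : ∀ x, a2 x = 0 ↔ ∃ y, a1 y = x)
    (ha3 : ∀ x, a3 x = 0 ↔ ∃ y, a2 y = x)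
    (hb1 : ∀ x, b1 x = 0 ↔ ∃ y, b0 y = x) (hb2 : ∀ x, b2 x = 0 ↔ ∃ y, b1 y = x)
    (hb3 : ∀ x, b3 x = 0 ↔ ∃ y, b2 y = x)
    (fa0 : ∀ x, a0 (f 0 x) = f 1 (a0 x)) (fa1 : ∀ x, a1 (f 1 x) = f 2 (a1 x))
    (fa2 : ∀ x, a2 (f 2 x) = f 3 (a2 x)) (fa3 : ∀ x, a3 (f 3 x) = f 4 (a3 x))
    (gb0 : ∀ x, b0 (g 0 x) = g 1 (b0 x)) (gb1 : ∀ x, b1 (g 1 x) = g 2 (b1 x))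
    (gb2 : ∀ x, b2 (g 2 x) = g 3 (b2 x))
    (r0 : ∀ x, b0 (ρ 0 x) = ρ 1 (a0 x)) (r1 : ∀ x, b1 (ρ 1 x) = ρ 2 (a1 x))
    (r2 : ∀ x, b2 (ρ 2 x) = ρ 3 (a2 x)) (r3 : ∀ x, b3 (ρ 3 x) = ρ 4 (a3 x))
    (s0 : ∀ b, ∃ (n : ℕ) (a : A 0), ρ 0 a = (g 0)^[n] b)
    (l1 : IsLocMap (f 1) (g 1) (ρ 1)) (l3 : IsLocMap (f 3) (g 3) (ρ 3))
    (i4 : ∀ a, ρ 4 a = 0 → ∃ n : ℕ, (f 4)^[n] a = 0) :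
    IsLocMap (f 2) (g 2) (ρ 2) where
  comm := hc 2
  inj x hx := by
    obtain ⟨n, hn⟩ := l3.inj (a2 x) (by rw [← r2, hx, map_zero])
    rw [← iterate_comm fa2, ha2] at hn
    obtain ⟨y, hy⟩ := hn
    have : b1 (ρ 1 y) = 0 := by rw [r1, hy, iterate_comm (hc 2), hx, iterate_map_zero]
    obtain ⟨z, hz⟩ := (hb1 _).1 this
    obtain ⟨m, w, hw⟩ := s0 z
    obtain ⟨k, hk⟩ := l1.inj ((f 1)^[m] y - a0 w) (by
      rw [map_sub, ← r0, hw, iterate_comm (hc 1), iterate_comm gb0, hz, sub_self])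
    refine ⟨k + (m + n), ?_⟩
    rw [Function.iterate_add_apply, Function.iterate_add_apply, ← hy, ← iterate_comm fa1,
      ← iterate_comm fa1]
    have h2 := congrArg a1 hk
    rw [iterate_map_sub, map_sub, map_zero, sub_eq_zero, ← iterate_comm fa0] at h2
    rw [h2]
    exact (ha1 _).2 ⟨_, rfl⟩
  surj b := by
    obtain ⟨n, x, hx⟩ := l3.surj (b2 b)
    have : ρ 4 (a3 x) = 0 := by
      rw [← r3, hx, ← iterate_comm gb2]; exact (hb3 _).2 ⟨_, rfl⟩
    obtain ⟨m, hm⟩ := i4 _ this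
    rw [← iterate_comm fa3, ha3] at hm
    obtain ⟨y, hy⟩ := hm
    have h0 : b2 ((g 2)^[m + n] b - ρ 2 y) = 0 := by
      rw [map_sub, r2, hy, iterate_comm (hc 3), hx, iterate_comm gb2, Function.iterate_add_apply,
        sub_self]
    obtain ⟨z, hz⟩ := (hb2 _).1 h0
    obtain ⟨k, w, hw⟩ := l1.surj z
    refine ⟨k + (m + n), (f 2)^[k] y + a1 w, ?_⟩
    rw [map_add, ← r1, hw, iterate_comm gb1, hz, iterate_map_sub, iterate_comm (hc 2),
      ← Function.iterate_add_apply]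
    abel

variable {X : Scheme.{u}} {F G : X.Modules}

def smulHom (F : X.Modules) {W : X.Opens} (f : Γ(X, W)) : Γ(F, W) →+ Γ(F, W) :=
  DistribSMul.toAddMonoidHom _ f

@[simp] lemma smulHom_apply {W : X.Opens} (f : Γ(X, W)) (s : Γ(F, W)) : smulHom F f s = f • s := rfl

lemma smulHom_iterate {W : X.Opens} (f : Γ(X, W)) (s : Γ(F, W)) (n : ℕ) :
    (smulHom F f)^[n] s = f ^ n • s := by
  induction n with
  | zero => simp
  | succ n ih => rw [Function.iterate_succ_apply', ih, smulHom_apply, smul_smul, pow_succ']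

/-- Restriction of sections of `F` from `W` to `W'` is localization at `f`. -/
def Loc (F : X.Modules) {W' W : X.Opens} (h : W' ≤ W) (f : Γ(X, W)) : Prop :=
  IsLocMap (smulHom F f) (smulHom F (ors h f)) (rs F h)

lemma loc_iff {W' W : X.Opens} (h : W' ≤ W) (f : Γ(X, W)) :
    Loc F h f ↔ (∀ s : Γ(F, W), rs F h s = 0 → ∃ n : ℕ, f ^ n • s = 0) ∧
      ∀ t : Γ(F, W'), ∃ (n : ℕ) (s : Γ(F, W)), rs F h s = ors h f ^ n • t := by
  constructor
  · intro H
    refine ⟨fun s hs => ?_, fun t => ?_⟩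
    · obtain ⟨n, hn⟩ := H.inj s hs
      exact ⟨n, by rw [← smulHom_iterate, hn]⟩
    · obtain ⟨n, s, hs⟩ := H.surj t
      exact ⟨n, s, by rw [hs, smulHom_iterate]⟩
  · rintro ⟨h1, h2⟩
    refine ⟨fun a => by simp [rs_smul], fun s hs => ?_, fun t => ?_⟩
    · obtain ⟨n, hn⟩ := h1 s hs
      exact ⟨n, by rw [smulHom_iterate, hn]⟩
    · obtain ⟨n, s, hs⟩ := h2 t
      exact ⟨n, s, by rw [hs, smulHom_iterate]⟩


lemma loc_congr {W₁ W₂ Y₁ Y₂ : X.Opens} (hW : W₁ = W₂) (hY : Y₁ = Y₂) (h₁ : Y₁ ≤ W₁)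
    (h₂ : Y₂ ≤ W₂) (f : Γ(X, W₂)) : Loc F h₁ (ors hW.le f) ↔ Loc F h₂ f := by
  subst hW hY
  rw [ors_self]

/-- The basic open of `Spec R`, as an open of the scheme. -/
def bas {R : CommRingCat.{u}} (f : R) : (Spec R).Opens := PrimeSpectrum.basicOpen f

lemma isLocalizing_iff {R : CommRingCat.{u}} (M : (Spec R).Modules) :
    IsLocalizing (modulesSpecToSheaf.obj M) ↔
      ∀ f : R, Loc M (W' := bas f) (W := ⊤) le_top
        ((Scheme.ΓSpecIso R).inv f) := by
  refine forall_congr' fun f => ?_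
  let φ := ((modulesSpecToSheaf.obj M).obj.map (PrimeSpectrum.basicOpen f).leTop.op).hom
  have key : ∀ (n : ℕ) (U : (Spec R).Opens) (x : Γ(M, U)), f ^ n • x = (ors le_top ((Scheme.ΓSpecIso R).inv f) ^ n : Γ(Spec R, U)) • x := by
    intro n U x
    rw [Scheme.Modules.smul_Spec_def, map_pow, map_pow]; rfl
  rw [loc_iff]
  constructor
  · intro hf
    refine ⟨fun s hs => ?_, fun t => ?_⟩
    · obtain ⟨⟨_, n, rfl⟩, hn⟩ := (IsLocalizedModule.eq_zero_iff (.powers f) φ).mp hs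
      refine ⟨n, ?_⟩
      have := key n _ s
      rw [ors_self] at this
      exact this.symm.trans hn
    · obtain ⟨⟨y, ⟨_, n, rfl⟩⟩, hy⟩ := IsLocalizedModule.surj (.powers f) φ t
      exact ⟨n, y, hy.symm.trans (key n (bas f) t)⟩
  · rintro ⟨h1, h2⟩
    refine IsLocalizedModule.Away.mk_of_addCommGroup ?_ ?_ ?_
    · exact Scheme.Modules.isUnit_algebraMap_end_of_le_basicOpen f le_rfl
    · intro t
      obtain ⟨n, s, hs⟩ := h2 t
      exact ⟨n, s, (key n (bas f) t).trans hs.symm⟩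
    · intro s hs
      obtain ⟨n, hn⟩ := h1 s hs
      have := key n _ s
      rw [ors_self] at this
      exact ⟨n, this.trans hn⟩

lemma loc_restrict_iff {Y : Scheme.{u}} (i : Y ⟶ X) [IsOpenImmersion i] {V V' : Y.Opens}
    (h : V' ≤ V) (f : Γ(Y, V)) :
    Loc (F.restrict i) h f ↔ Loc F (i.image_mono h) ((i.appIso V).inv f) := by
  have e : ∀ (n : ℕ) (U : Y.Opens) (g : Γ(Y,U)) (x : Γ(F.restrict i, U)),
      g ^ n • x = (show Γ(F, i ''ᵁ U) from (i.appIso U).inv g ^ n • (show Γ(F, i ''ᵁ U) from x)) := by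
    intro n U g x
    rw [← map_pow]; rfl
  have e2 : (i.appIso V').inv (ors h f) = ors (i.image_mono h) ((i.appIso V).inv f) :=
    congr($(i.appIso_inv_naturality (homOfLE h).op) f)
  rw [loc_iff, loc_iff]
  simp only [e, e2]
  rfl

lemma fromSpec_image_top' {W : X.Opens} (hW : IsAffineOpen W) : hW.fromSpec ''ᵁ ⊤ = W := by
  rw [Scheme.Hom.image_top_eq_opensRange, hW.opensRange_fromSpec]

lemma isLocalizing_restrict_iff {W : X.Opens} (hW : IsAffineOpen W) :
    IsLocalizing (modulesSpecToSheaf.obj (F.restrict hW.fromSpec)) ↔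
      ∀ f : Γ(X, W), Loc F (X.basicOpen_le f) f := by
  rw [isLocalizing_iff]
  refine forall_congr' fun f => ?_
  have hb : hW.fromSpec ''ᵁ (bas f) = X.basicOpen f := hW.fromSpec_image_basicOpen f
  rw [loc_restrict_iff, ← loc_congr (fromSpec_image_top' hW) hb (hW.fromSpec.image_mono le_top)]
  suffices h : (hW.fromSpec.appIso ⊤).inv ((Scheme.ΓSpecIso Γ(X, W)).inv f) =
      ors (fromSpec_image_top' hW).le f by rw [h]
  have h2 : ((Scheme.ΓSpecIso Γ(X, W)).inv f) = (hW.fromSpec.appIso ⊤).hom (ors (fromSpec_image_top' hW).le f) := by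
    rw [Scheme.Hom.appIso_hom']
    have h3 : X.presheaf.map (homOfLE (fromSpec_image_top' hW).le).op ≫
        hW.fromSpec.appLE (hW.fromSpec ''ᵁ ⊤) ⊤ (hW.fromSpec.preimage_image_eq ⊤).ge =
        (Scheme.ΓSpecIso Γ(X, W)).inv := by
      rw [Scheme.Hom.map_appLE, Scheme.Hom.appLE, hW.fromSpec_app_self, Category.assoc, ← Functor.map_comp]
      exact (congrArg _ ((Spec Γ(X, W)).presheaf.map_id _)).trans (Category.comp_id _)
    exact congr($h3.symm f)
  rw [h2]
  exact congr($((hW.fromSpec.appIso ⊤).hom_inv_id) _)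


lemma loc_of_isQuasicoherent (hF : F.IsQuasicoherent) {W : X.Opens} (hW : IsAffineOpen W)
    (f : Γ(X, W)) : Loc F (X.basicOpen_le f) f := by
  have h : (F.restrict hW.fromSpec).IsQuasicoherent :=
    Scheme.Modules.isQuasicoherent_restrictFunctor hW.fromSpec F
  rw [isQuasicoherent_iff_isIso_fromTildeΓ, isIso_fromTildeΓ_iff_isLocalizing,
    isLocalizing_restrict_iff] at h
  exact h f

def presentationMap {C D : Type u} [SmallCategory C] [SmallCategory D] {K : GrothendieckTopology C}
    {L : GrothendieckTopology D} {R : Sheaf K RingCat.{u}} {S : Sheaf L RingCat.{u}}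
    [HasSheafify K AddCommGrpCat.{u}] [K.WEqualsLocallyBijective AddCommGrpCat.{u}]
    [HasSheafify L AddCommGrpCat.{u}] [L.WEqualsLocallyBijective AddCommGrpCat.{u}]
    {M : SheafOfModules.{u} R} (p : M.Presentation) (F : SheafOfModules.{u} R ⥤ SheafOfModules.{u} S)
    (hF : PreservesColimitsOfSize.{u, u} F)
    (η : SheafOfModules.unit S ≅ F.obj (SheafOfModules.unit R)) : (F.obj M).Presentation :=
  p.map F η

lemma exists_presentation_of_loc {W : X.Opens} (hW : IsAffineOpen W)
    (h : ∀ f : Γ(X, W), Loc F (X.basicOpen_le f) f) :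
    Nonempty (SheafOfModules.Presentation (F.over W)) := by
  rw [← isLocalizing_restrict_iff hW, ← isIso_fromTildeΓ_iff_isLocalizing] at h
  have p1 : (F.restrict hW.fromSpec).Presentation :=
    haveI : IsIso (C := SheafOfModules _) (Scheme.Modules.fromTildeΓ (F.restrict hW.fromSpec)) := h
    SheafOfModules.Presentation.ofIsIso (F.restrict hW.fromSpec).fromTildeΓ
      (presentationTilde _ Set.univ (by simp) _ (Submodule.span_eq _))
  let i := ((Scheme.Modules.restrictFunctorComp hW.isoSpec.hom hW.fromSpec).symm ≪≫
        Scheme.Modules.restrictFunctorCongr hW.isoSpec_hom_fromSpec).app F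
  have p2 : (F.restrict W.ι).Presentation :=
    haveI : IsIso (C := SheafOfModules _) i.hom := i.isIso_hom
    SheafOfModules.Presentation.ofIsIso i.hom
      (Scheme.Modules.presentationRestrict hW.isoSpec.hom p1)
  let e := Scheme.Modules.overEquiv W
  have : e.inverse.IsEquivalence := e.isEquivalence_inverse
  have p3 : (e.inverse.obj (F.restrict W.ι)).Presentation :=
    presentationMap p2 e.inverse e.symm.toAdjunction.leftAdjoint_preservesColimits
      (TopologicalSpace.Opens.sheafOfModulesEquivOverInverseUnit _ _).symm
  exact ⟨SheafOfModules.Presentation.ofIsIso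
    ((e.inverse.mapIso ((Scheme.Modules.overFunctorEquiv W).app F).symm) ≪≫
      (e.unitIso.app _).symm).hom p3⟩

lemma isQuasicoherent_of_loc {ι : Type u} (U : ι → X.Opens) (hU : iSup U = ⊤)
    (h : ∀ i, IsAffineOpen (U i) ∧ ∀ f : Γ(X, U i), Loc F (X.basicOpen_le f) f) :
    F.IsQuasicoherent := by
  let q : SheafOfModules.QuasicoherentData.{u} (R := X.ringCatSheaf) F :=
    { I := ι
      X := U
      coversTop := (Opens.coversTop_iff (T := X) U).2 hU
      presentation := fun i => (exists_presentation_of_loc (h i).1 (h i).2).some }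
  exact q.isQuasicoherent

/-- Quasi-coherence is localization of sections over affine opens. -/
lemma isQuasicoherent_iff_loc : F.IsQuasicoherent ↔
    ∀ (W : X.Opens) (_ : IsAffineOpen W) (f : Γ(X, W)), Loc F (X.basicOpen_le f) f := by
  refine ⟨fun h W hW f => loc_of_isQuasicoherent h hW f, fun h => ?_⟩
  refine isQuasicoherent_of_loc (fun W : X.affineOpens => W.1) ?_ fun W => ⟨W.2, h W.1 W.2⟩
  exact iSup_affineOpens_eq_top X

end

open DerivedCategory Pretriangulated

section Triangles

variable {D : Type*} [Category* D] [HasZeroObject D] [HasShift D ℤ] [Preadditive D]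
  [∀ n : ℤ, (shiftFunctor D n).Additive] [Pretriangulated D]

/-- Three morphisms forming a distinguished triangle. -/
def DT {A B E : D} (f : A ⟶ B) (g : B ⟶ E) (h : E ⟶ A⟦(1 : ℤ)⟧) : Prop :=
  Triangle.mk f g h ∈ distTriang D

variable {A B E : D} {f : A ⟶ B} {g : B ⟶ E} {h : E ⟶ A⟦(1 : ℤ)⟧}

lemma DT.rot (hT : DT f g h) : DT g h (-f⟦1⟧') := rot_of_distTriang _ hT

lemma DT.comp₁₂ (hT : DT f g h) : f ≫ g = 0 := comp_distTriang_mor_zero₁₂ _ hT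

lemma DT.comp₂₃ (hT : DT f g h) : g ≫ h = 0 := comp_distTriang_mor_zero₂₃ _ hT

lemma DT.comp₃₁ (hT : DT f g h) : h ≫ f⟦1⟧' = 0 := comp_distTriang_mor_zero₃₁ _ hT

lemma DT.lift₁ (hT : DT f g h) {Z : D} (ξ : Z ⟶ B) (hξ : ξ ≫ g = 0) : ∃ ζ : Z ⟶ A, ξ = ζ ≫ f :=
  Triangle.coyoneda_exact₂ _ hT ξ hξ

lemma DT.lift₂ (hT : DT f g h) {Z : D} (ξ : Z ⟶ E) (hξ : ξ ≫ h = 0) : ∃ ζ : Z ⟶ B, ξ = ζ ≫ g :=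
  Triangle.coyoneda_exact₃ _ hT ξ hξ

lemma DT.lift₃ (hT : DT f g h) {Z : D} (ξ : Z ⟶ A⟦(1 : ℤ)⟧) (hξ : ξ ≫ f⟦1⟧' = 0) :
    ∃ ζ : Z ⟶ E, ξ = ζ ≫ h :=
  Triangle.coyoneda_exact₁ _ hT ξ hξ

lemma DT.desc₃ (hT : DT f g h) {Z : D} (ξ : B ⟶ Z) (hξ : f ≫ ξ = 0) : ∃ ζ : E ⟶ Z, ξ = g ≫ ζ :=
  Triangle.yoneda_exact₂ _ hT ξ hξ

lemma DT.desc₁ (hT : DT f g h) {Z : D} (ξ : E ⟶ Z) (hξ : g ≫ ξ = 0) :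
    ∃ ζ : A⟦(1 : ℤ)⟧ ⟶ Z, ξ = h ≫ ζ :=
  Triangle.yoneda_exact₃ _ hT ξ hξ

lemma DT.desc₂ (hT : DT f g h) {Z : D} (ξ : A⟦(1 : ℤ)⟧ ⟶ Z) (hξ : h ≫ ξ = 0) :
    ∃ ζ : B⟦(1 : ℤ)⟧ ⟶ Z, ξ = f⟦1⟧' ≫ ζ := by
  obtain ⟨ζ, hζ⟩ := hT.rot.desc₁ ξ hξ
  exact ⟨-ζ, by rw [hζ]; simp⟩

lemma exists_DT (f : A ⟶ B) : ∃ (E : D) (g : B ⟶ E) (h : E ⟶ A⟦(1 : ℤ)⟧), DT f g h :=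
  distinguished_cocone_triangle f

lemma exists_DT₂ (g : B ⟶ E) : ∃ (A : D) (f : A ⟶ B) (h : E ⟶ A⟦(1 : ℤ)⟧), DT f g h :=
  distinguished_cocone_triangle₁ g

end Triangles

section Abelian

universe u'

variable {C : Type u'} [Category.{v} C] [Abelian C] [HasDerivedCategory.{w} C]

/-- The map induced in degree zero homology by a morphism from an object in degree zero. -/
def sh {A : C} {E : DerivedCategory C} (ξ : (singleFunctor C 0).obj A ⟶ E) :
    A ⟶ (homologyFunctor C 0).obj E :=
  (singleFunctorCompHomologyFunctorIso C 0).inv.app A ≫ (homologyFunctor C 0).map ξ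

lemma sh_comp {A : C} {E E' : DerivedCategory C} (ξ : (singleFunctor C 0).obj A ⟶ E) (φ : E ⟶ E') :
    sh (ξ ≫ φ) = sh ξ ≫ (homologyFunctor C 0).map φ := by
  simp [sh]

lemma sh_map {A B : C} {E : DerivedCategory C} (p : B ⟶ A) (ξ : (singleFunctor C 0).obj A ⟶ E) :
    sh ((singleFunctor C 0).map p ≫ ξ) = p ≫ sh ξ := by
  have h := (singleFunctorCompHomologyFunctorIso C 0).inv.naturality p
  dsimp only [Functor.comp_map, Functor.id_map] at h
  rw [sh, sh, Functor.map_comp, ← Category.assoc, ← Category.assoc, ← h]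

lemma sh_add {A : C} {E : DerivedCategory C} (ξ ζ : (singleFunctor C 0).obj A ⟶ E) :
    sh (ξ + ζ) = sh ξ + sh ζ := by
  simp [sh]

@[simp] lemma sh_zero {A : C} {E : DerivedCategory C} :
    sh (0 : (singleFunctor C 0).obj A ⟶ E) = 0 := by
  simp [sh]

/-- `sh` as an additive map. -/
def shHom (A : C) (E : DerivedCategory C) :
    ((singleFunctor C 0).obj A ⟶ E) →+ (A ⟶ (homologyFunctor C 0).obj E) where
  toFun := sh
  map_zero' := sh_zero
  map_add' := sh_add

lemma sh_bijective_single (A B : C) :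
    Function.Bijective (sh (A := A) (E := (singleFunctor C 0).obj B)) := by
  have key : ∀ a : A ⟶ B, sh ((singleFunctor C 0).map a) =
      a ≫ (singleFunctorCompHomologyFunctorIso C 0).inv.app B := fun a =>
    ((singleFunctorCompHomologyFunctorIso C 0).inv.naturality a).symm
  constructor
  · intro ξ ζ h
    obtain ⟨a, rfl⟩ := (singleFunctor C 0).map_surjective ξ
    obtain ⟨b, rfl⟩ := (singleFunctor C 0).map_surjective ζ
    rw [key, key, cancel_mono] at h
    rw [h]
  · intro φ
    refine ⟨(singleFunctor C 0).map (φ ≫ (singleFunctorCompHomologyFunctorIso C 0).hom.app B), ?_⟩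
    rw [key, Category.assoc, Iso.hom_inv_id_app]
    exact Category.comp_id _

lemma isIso_homology_mor₁ (T : Triangle (DerivedCategory C)) (hT : T ∈ distTriang _) (n : ℤ)
    (h : IsZero ((homologyFunctor C (n - 1)).obj T.obj₃))
    (h' : IsZero ((homologyFunctor C n).obj T.obj₃)) :
    IsIso ((homologyFunctor C n).map T.mor₁) := by
  have : Mono ((homologyFunctor C n).map T.mor₁) :=
    (HomologySequence.exact₁ T hT (n - 1) n (by lia)).mono_g (h.eq_of_src _ _)
  have : Epi ((homologyFunctor C n).map T.mor₁) :=
    (HomologySequence.exact₂ T hT n).epi_f (h'.eq_of_tgt _ _)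
  exact isIso_of_mono_of_epi _

lemma isIso_homology_mor₂ (T : Triangle (DerivedCategory C)) (hT : T ∈ distTriang _) (n : ℤ)
    (h : IsZero ((homologyFunctor C n).obj T.obj₁))
    (h' : IsZero ((homologyFunctor C (n + 1)).obj T.obj₁)) :
    IsIso ((homologyFunctor C n).map T.mor₂) := by
  have : Mono ((homologyFunctor C n).map T.mor₂) :=
    (HomologySequence.exact₂ T hT n).mono_g (h.eq_of_src _ _)
  have : Epi ((homologyFunctor C n).map T.mor₂) :=
    (HomologySequence.exact₃ T hT n (n + 1) rfl).epi_f (h'.eq_of_tgt _ _)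
  exact isIso_of_mono_of_epi _

lemma sh_bijective_of_iso {A : C} {E E' : DerivedCategory C} (e : E ≅ E')
    (h : Function.Bijective (sh (A := A) (E := E))) :
    Function.Bijective (sh (A := A) (E := E')) := by
  constructor
  · intro ξ ζ hh
    rw [← cancel_mono e.inv]
    apply h.1
    rw [sh_comp, sh_comp, hh]
  · intro φ
    obtain ⟨ξ, hξ⟩ := h.2 (φ ≫ (homologyFunctor C 0).map e.inv)
    exact ⟨ξ ≫ e.hom, by rw [sh_comp, hξ, Category.assoc, ← Functor.map_comp]; simp⟩

/-- Morphisms from an object in degree zero to a complex in nonnegative degrees. -/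
lemma sh_bijective (A : C) (E : DerivedCategory C) [E.IsGE 0] :
    Function.Bijective (sh (A := A) (E := E)) := by
  have hT := TStructure.t.triangleLTGE_distinguished 1 E
  set T := (TStructure.t.triangleLTGE 1).obj E with hTdef
  have h1 : T.obj₁.IsLE 0 :=
    inferInstanceAs (TStructure.t.IsLE ((TStructure.t.truncLT 1).obj E) (1 - 1))
  have h3 : T.obj₃.IsGE 1 :=
    inferInstanceAs (TStructure.t.IsGE ((TStructure.t.truncGE 1).obj E) 1)
  have h1' : T.obj₁.IsGE 0 := inferInstanceAs (TStructure.t.IsGE ((TStructure.t.truncLT 1).obj E) 0)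
  have := isIso_homology_mor₁ T hT 0 (T.obj₃.isZero_of_isGE 1 _ (by lia))
    (T.obj₃.isZero_of_isGE 1 _ (by lia))
  change Function.Bijective (sh (A := A) (E := T.obj₂))
  obtain ⟨Y, ⟨e⟩⟩ := exists_iso_singleFunctor_obj_of_isGE_of_isLE T.obj₁ 0
  have hb := sh_bijective_of_iso (A := A) e.symm (sh_bijective_single A Y)
  have hz : ∀ ξ : (singleFunctor C 0).obj A ⟶ T.obj₃, ξ = 0 := fun ξ =>
    TStructure.t.zero_of_isLE_of_isGE ξ 0 1 (by lia) inferInstance inferInstance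
  have hl : ∀ ξ : (singleFunctor C 0).obj A ⟶ T.obj₂, ∃ ζ, ξ = ζ ≫ T.mor₁ := fun ξ =>
    T.coyoneda_exact₂ hT ξ (hz _)
  constructor
  · refine (injective_iff_map_eq_zero (shHom A T.obj₂)).2 fun ξ hξ => ?_
    obtain ⟨ζ, rfl⟩ := hl ξ
    have h0 : sh ζ ≫ (homologyFunctor C 0).map T.mor₁ = 0 ≫ (homologyFunctor C 0).map T.mor₁ := by
      rw [← sh_comp, zero_comp]; exact hξ
    rw [cancel_mono] at h0
    have : ζ = 0 := hb.1 (by rw [h0, sh_zero])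
    rw [this, zero_comp]
  · intro φ
    obtain ⟨ζ, hζ⟩ := hb.2 (φ ≫ inv ((homologyFunctor C 0).map T.mor₁))
    exact ⟨ζ ≫ T.mor₁, by rw [sh_comp, hζ, Category.assoc, IsIso.inv_hom_id, Category.comp_id]⟩

lemma exists_epi_of_isLE {A : C} {E : DerivedCategory C} [E.IsLE (-1)]
    (ξ : (singleFunctor C 0).obj A ⟶ E) :
    ∃ (B : C) (p : B ⟶ A), Epi p ∧ (singleFunctor C 0).map p ≫ ξ = 0 := by
  obtain ⟨K, _, ⟨e⟩⟩ := exists_iso_Q_obj_of_isLE E (-1)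
  obtain ⟨M, _, s, hs, g, hg⟩ := right_fac_of_isStrictlyLE
    (X := (CochainComplex.singleFunctor C 0).obj A) (ξ ≫ e.hom) 0
  let t : (CochainComplex.singleFunctor C 0).obj (M.X 0) ⟶ M :=
    HomologicalComplex.mkHomFromSingle (𝟙 _)
      (fun k hk => (M.isZero_of_isStrictlyLE 0 k (by simp at hk; lia)).eq_of_tgt _ _)
  obtain ⟨p, hp⟩ := (CochainComplex.singleFunctor C 0).map_surjective (t ≫ s)
  have htg : t ≫ g = 0 := by
    ext i
    by_cases hi : i = 0
    · exact (K.isZero_of_isStrictlyLE (-1) i (by lia)).eq_of_tgt _ _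
    · exact (HomologicalComplex.isZero_single_obj_X (.up ℤ) 0 (M.X 0) i hi).eq_of_src _ _
  refine ⟨M.X 0, p, ?_, ?_⟩
  · have hq : QuasiIso s := (isIso_Q_map_iff_quasiIso C s).1 hs
    have h1 := HomologicalComplex.isIso_iCycles M 0 1 (by simp)
      ((M.isZero_of_isStrictlyLE 0 1 (by lia)).eq_of_tgt _ _)
    have h2 := HomologicalComplex.isIso_iCycles ((CochainComplex.singleFunctor C 0).obj (M.X 0))
      0 1 (by simp) ((HomologicalComplex.isZero_single_obj_X (.up ℤ) 0 (M.X 0) 1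
        (by lia)).eq_of_tgt _ _)
    have h3 : IsIso (t.f 0) := by
      rw [HomologicalComplex.mkHomFromSingle_f]
      exact IsIso.comp_isIso' (Iso.isIso_hom (HomologicalComplex.singleObjXSelf _ _ _))
        (inferInstanceAs (IsIso (𝟙 (M.X 0))))
    have h4 : IsIso (HomologicalComplex.cyclesMap t 0) := by
      have := HomologicalComplex.cyclesMap_i t 0
      have h5 : IsIso (HomologicalComplex.cyclesMap t 0 ≫ M.iCycles 0) := by
        rw [this]; infer_instance
      exact IsIso.of_isIso_comp_right _ (M.iCycles 0)
    have he : Epi (HomologicalComplex.homologyMap t 0) := by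
      have h5 : Epi (HomologicalComplex.homologyπ _ 0 ≫ HomologicalComplex.homologyMap t 0) := by
        rw [HomologicalComplex.homologyπ_naturality]
        exact epi_comp _ _
      exact epi_of_epi (HomologicalComplex.homologyπ _ 0) _
    have h2 : Epi ((HomologicalComplex.homologyFunctor C (.up ℤ) 0).map
      ((CochainComplex.singleFunctor C 0).map p)) := by
      rw [hp]
      change Epi (HomologicalComplex.homologyMap (t ≫ s) 0)
      rw [HomologicalComplex.homologyMap_comp]
      exact epi_comp _ _
    let α := HomologicalComplex.homologyFunctorSingleIso C (.up ℤ) 0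
    have h6 : p = α.inv.app _ ≫ (HomologicalComplex.homologyFunctor C (.up ℤ) 0).map
        ((CochainComplex.singleFunctor C 0).map p) ≫ α.hom.app _ := by
      have := α.hom.naturality p
      dsimp only [Functor.comp_map, Functor.id_map] at this
      change _ = α.inv.app _ ≫ (HomologicalComplex.homologyFunctor C (.up ℤ) 0).map
        ((HomologicalComplex.single C (.up ℤ) 0).map p) ≫ α.hom.app _
      rw [this, Iso.inv_hom_id_app_assoc]
    have h7 : Epi (α.hom.app A) := inferInstance
    rw [h6]
    exact epi_comp' inferInstance (epi_comp' h2 h7)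
  · rw [← cancel_mono e.hom, Category.assoc, zero_comp]
    refine (congrArg (fun z => (singleFunctor C 0).map p ≫ z) hg).trans ?_
    change Q.map ((CochainComplex.singleFunctor C 0).map p) ≫ _ = 0
    rw [hp, Q.map_comp, Category.assoc, IsIso.hom_inv_id_assoc, ← Q.map_comp, htg, Q.map_zero]

lemma exists_trunc (E : DerivedCategory C) (n : ℤ) :
    ∃ (L G : DerivedCategory C) (i : L ⟶ E) (p : E ⟶ G) (d : G ⟶ L⟦(1 : ℤ)⟧),
      DT i p d ∧ L.IsLE (n - 1) ∧ G.IsGE n :=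
  ⟨_, _, _, _, _, TStructure.t.triangleLTGE_distinguished n E,
    inferInstanceAs (TStructure.t.IsLE ((TStructure.t.truncLT n).obj E) (n - 1)),
    inferInstanceAs (TStructure.t.IsGE ((TStructure.t.truncGE n).obj E) n)⟩

/-- The image in degree zero homology of a morphism from an object in degree zero detects
the morphism, locally. -/
lemma exists_epi_of_sh_eq_zero {A : C} {E : DerivedCategory C}
    (ξ : (singleFunctor C 0).obj A ⟶ E) (h : sh ξ = 0) :
    ∃ (B : C) (p : B ⟶ A), Epi p ∧ (singleFunctor C 0).map p ≫ ξ = 0 := by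
  obtain ⟨L, G, i, q, d, hT, h1, h3⟩ := exists_trunc E 0
  have h1 : L.IsLE (-1) := h1
  obtain ⟨ζ, hζ⟩ := hT.lift₁ ξ ((sh_bijective A G).1 (by
    rw [sh_zero, sh_comp, h, zero_comp]))
  obtain ⟨B, p, hp, h⟩ := exists_epi_of_isLE ζ
  refine ⟨B, p, hp, ?_⟩
  rw [hζ, ← Category.assoc, h, zero_comp]

lemma exists_epi_lift_sh {A : C} {E : DerivedCategory C} (φ : A ⟶ (homologyFunctor C 0).obj E) :
    ∃ (B : C) (p : B ⟶ A) (ξ : (singleFunctor C 0).obj B ⟶ E), Epi p ∧ sh ξ = p ≫ φ := by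
  obtain ⟨L, G, i, q, d, hT, h1, h3⟩ := exists_trunc E 0
  have h2 : IsLE (L⟦(1 : ℤ)⟧) (-1) :=
    have := TStructure.t.isLE_shift L (0 - 1) 1 (-2) (by lia)
    TStructure.t.isLE_of_le (L⟦(1 : ℤ)⟧) (-2) (-1)
  have hi : IsIso ((homologyFunctor C 0).map q) := isIso_homology_mor₂ _ hT 0
    (L.isZero_of_isLE (0 - 1) _ (by lia)) (L.isZero_of_isLE (0 - 1) _ (by lia))
  obtain ⟨ζ, hζ⟩ := (sh_bijective A G).2 (φ ≫ (homologyFunctor C 0).map q)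
  obtain ⟨B, p, hp, h⟩ := exists_epi_of_isLE (ζ ≫ d)
  obtain ⟨ξ, hξ⟩ := hT.lift₂ ((singleFunctor C 0).map p ≫ ζ)
    (by rw [Category.assoc]; exact h)
  refine ⟨B, p, ξ, hp, ?_⟩
  have h4 := (congrArg sh hξ).trans (sh_comp ξ q)
  rw [sh_map, hζ, ← Category.assoc, cancel_mono] at h4
  exact h4.symm

end Abelian

section ExactFunctors

variable {C : Type u} [Category.{v} C] [Abelian C] [HasDerivedCategory.{w} C]
  (G G₁ G₂ G₃ : C ⥤ C)
  [G.Additive] [PreservesFiniteLimits G] [PreservesFiniteColimits G]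
  [G₁.Additive] [PreservesFiniteLimits G₁] [PreservesFiniteColimits G₁]
  [G₂.Additive] [PreservesFiniteLimits G₂] [PreservesFiniteColimits G₂]
  [G₃.Additive] [PreservesFiniteLimits G₃] [PreservesFiniteColimits G₃]

/-- The functor induced by an exact endofunctor on complexes. -/
abbrev cx : CochainComplex C ℤ ⥤ CochainComplex C ℤ := G.mapHomologicalComplex (.up ℤ)

/-- The functor induced by an exact endofunctor on the derived category. -/
abbrev DF : DerivedCategory C ⥤ DerivedCategory C := G.mapDerivedCategory

/-- The comparison isomorphism for the derived functor of an exact functor. -/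
abbrev dfac (K : CochainComplex C ℤ) : (DF G).obj (Q.obj K) ≅ Q.obj ((cx G).obj K) :=
  G.mapDerivedCategoryFactors.app K

lemma dfac_naturality {K L : CochainComplex C ℤ} (f : K ⟶ L) :
    (DF G).map (Q.map f) ≫ (dfac G L).hom = (dfac G K).hom ≫ Q.map ((cx G).map f) :=
  G.mapDerivedCategoryFactors.hom.naturality f

variable {G₁ G₂ G₃}

/-- The natural transformation induced by a natural transformation on complexes. -/
abbrev cxn (α : G₁ ⟶ G₂) : cx G₁ ⟶ cx G₂ := NatTrans.mapHomologicalComplex α (.up ℤ)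

/-- The natural transformation induced on derived functors of exact functors. -/
def dnat (α : G₁ ⟶ G₂) : DF G₁ ⟶ DF G₂ :=
  Localization.liftNatTrans Q (HomologicalComplex.quasiIso C (.up ℤ))
    (cx G₁ ⋙ Q) (cx G₂ ⋙ Q) _ _ (Functor.whiskerRight (cxn α) Q)

lemma dnat_app (α : G₁ ⟶ G₂) (K : CochainComplex C ℤ) :
    (dnat α).app (Q.obj K) ≫ (dfac G₂ K).hom = (dfac G₁ K).hom ≫ Q.map ((cxn α).app K) := by
  have h : (dnat α).app (Q.obj K) = (dfac G₁ K).hom ≫ Q.map ((cxn α).app K) ≫ (dfac G₂ K).inv :=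
    Localization.liftNatTrans_app _ _ _ _ _ _ _ _
  rw [h, Category.assoc, Category.assoc, Iso.inv_hom_id, Category.comp_id]

lemma exists_iso_Q (N : DerivedCategory C) :
    ∃ K : CochainComplex C ℤ, Nonempty (Q.obj K ≅ N) :=
  ⟨_, ⟨Q.objObjPreimageIso N⟩⟩

/-- Natural transformations between functors on the derived category agree as soon as they agree on
images of complexes. -/
lemma natTrans_ext {E : Type*} [Category E] {A B : DerivedCategory C ⥤ E} {α β : A ⟶ B}
    (h : ∀ K : CochainComplex C ℤ, α.app (Q.obj K) = β.app (Q.obj K)) : α = β := by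
  ext N
  obtain ⟨K, ⟨e⟩⟩ := exists_iso_Q N
  rw [← cancel_epi (A.map e.hom), α.naturality, β.naturality, h]

lemma dnat_comp (α : G₁ ⟶ G₂) (β : G₂ ⟶ G₃) : dnat (α ≫ β) = dnat α ≫ dnat β := by
  refine natTrans_ext fun K => ?_
  rw [← cancel_mono (dfac G₃ K).hom, dnat_app, NatTrans.comp_app, Category.assoc, dnat_app,
    ← Category.assoc, dnat_app, Category.assoc, ← Q.map_comp]
  congr 1

lemma dnat_id : dnat (𝟙 G) = 𝟙 _ := by
  refine natTrans_ext fun K => ?_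
  rw [← cancel_mono (dfac G K).hom, dnat_app, NatTrans.id_app, Category.id_comp]
  exact (congrArg ((dfac G K).hom ≫ ·) (Q.map_id _)).trans (Category.comp_id _)

lemma dnat_add (α β : G₁ ⟶ G₂) : dnat (α + β) = dnat α + dnat β := by
  refine natTrans_ext fun K => ?_
  rw [← cancel_mono (dfac G₂ K).hom, dnat_app, NatTrans.app_add, Preadditive.add_comp, dnat_app,
    dnat_app, ← Preadditive.comp_add, ← Q.map_add]
  congr 1

lemma dnat_zero : dnat (0 : G₁ ⟶ G₂) = 0 := by
  have h := dnat_add (0 : G₁ ⟶ G₂) 0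
  rw [add_zero] at h
  exact left_eq_add.mp h

lemma isIso_dnat_app_Q (α : G₁ ⟶ G₂) (K : CochainComplex C ℤ) (h : ∀ i, IsIso (α.app (K.X i))) :
    IsIso ((dnat α).app (Q.obj K)) := by
  have h1 : IsIso ((cxn α).app K) := by
    have : ∀ i, IsIso (((cxn α).app K).f i) := h
    exact HomologicalComplex.Hom.isIso_of_components _
  have h2 : IsIso ((dnat α).app (Q.obj K) ≫ (dfac G₂ K).hom) := by
    rw [dnat_app]; infer_instance
  exact IsIso.of_isIso_comp_right _ (dfac G₂ K).hom

/-- The transformation to the identity induced by a transformation `G ⟶ 𝟭 C`. -/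
def dcounit {G : C ⥤ C} [G.Additive] [PreservesFiniteLimits G] [PreservesFiniteColimits G]
    (α : G ⟶ 𝟭 C) : DF G ⟶ 𝟭 _ :=
  Localization.liftNatTrans Q (HomologicalComplex.quasiIso C (.up ℤ))
    (cx G ⋙ Q) Q _ _ (Functor.whiskerRight (NatTrans.mapHomologicalComplex α (.up ℤ) ≫
      (Functor.mapHomologicalComplexIdIso C (.up ℤ)).hom) Q)

variable {G}

/-- The map on complexes induced by a transformation to the identity. -/
def cxc (α : G ⟶ 𝟭 C) (K : CochainComplex C ℤ) : (cx G).obj K ⟶ K where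
  f i := α.app (K.X i)
  comm' i j _ := (α.naturality (K.d i j)).symm

lemma dcounit_app (α : G ⟶ 𝟭 C) (K : CochainComplex C ℤ) :
    (dcounit α).app (Q.obj K) = (dfac G K).hom ≫ Q.map (cxc α K) := by
  have h := Localization.liftNatTrans_app Q (HomologicalComplex.quasiIso C (.up ℤ))
    (cx G ⋙ Q) Q (DF G) (𝟭 _) (Functor.whiskerRight (NatTrans.mapHomologicalComplex α (.up ℤ) ≫
      (Functor.mapHomologicalComplexIdIso C (.up ℤ)).hom) Q) K
  refine h.trans (congrArg ((dfac G K).hom ≫ ·) ?_)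
  refine (Category.comp_id _).trans (congrArg Q.map ?_)
  ext i
  exact Category.comp_id _

lemma dnat_dcounit (α : G₁ ⟶ G₂) (β : G₂ ⟶ 𝟭 C) : dnat α ≫ dcounit β = dcounit (α ≫ β) := by
  refine natTrans_ext fun K => ?_
  rw [NatTrans.comp_app, dcounit_app, dcounit_app, ← Category.assoc, dnat_app, Category.assoc,
    ← Q.map_comp]
  congr 1

lemma isIso_dcounit_app_Q (α : G ⟶ 𝟭 C) (K : CochainComplex C ℤ)
    (h : ∀ i, IsIso (α.app (K.X i))) : IsIso ((dcounit α).app (Q.obj K)) := by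
  have h1 : IsIso (cxc α K) := by
    have : ∀ i, IsIso ((cxc α K).f i) := h
    exact HomologicalComplex.Hom.isIso_of_components _
  rw [dcounit_app]
  infer_instance

/-- A quasi-isomorphism criterion: the derived functor inverts what the functor inverts
termwise. -/
lemma isIso_DF_map_Q {K L : CochainComplex C ℤ} (f : K ⟶ L) (h : ∀ i, IsIso (G.map (f.f i))) :
    IsIso ((DF G).map (Q.map f)) := by
  have h1 : IsIso ((cx G).map f) := by
    have : ∀ i, IsIso (((cx G).map f).f i) := h
    exact HomologicalComplex.Hom.isIso_of_components _
  have h2 : IsIso ((DF G).map (Q.map f) ≫ (dfac G L).hom) := by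
    rw [dfac_naturality]; infer_instance
  exact IsIso.of_isIso_comp_right _ (dfac G L).hom

lemma isIso_app_of_iso {E : Type*} [Category E] {A B : DerivedCategory C ⥤ E} (α : A ⟶ B)
    {M N : DerivedCategory C} (e : M ≅ N) [IsIso (α.app M)] : IsIso (α.app N) := by
  have h : IsIso (A.map e.hom ≫ α.app N) := by
    rw [α.naturality]; infer_instance
  exact IsIso.of_isIso_comp_left (A.map e.hom) _

/-- A short exact sequence of functors. -/
structure SES (α : G₁ ⟶ G₂) (β : G₂ ⟶ G₃) : Prop where
  w : ∀ F, α.app F ≫ β.app F = 0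
  ex : ∀ F, (ShortComplex.mk (α.app F) (β.app F) (w F)).ShortExact

lemma SES.shortExact {α : G₁ ⟶ G₂} {β : G₂ ⟶ G₃} (h : SES α β) (K : CochainComplex C ℤ) :
    (ShortComplex.mk ((cxn α).app K) ((cxn β).app K) (by ext i; exact h.w (K.X i))).ShortExact :=
  HomologicalComplex.shortExact_of_degreewise_shortExact _ fun i => h.ex (K.X i)

variable (G) in
/-- The image of `N` under the derived functor, computed by a complex representing `N`. -/
def drep (N : DerivedCategory C) : Q.obj ((cx G).obj (Q.objPreimage N)) ≅ (DF G).obj N :=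
  (dfac G _).symm ≪≫ (DF G).mapIso (Q.objObjPreimageIso N)

lemma drep_nat (γ : G₁ ⟶ G₂) (N : DerivedCategory C) :
    (drep G₁ N).hom ≫ (dnat γ).app N = Q.map ((cxn γ).app (Q.objPreimage N)) ≫ (drep G₂ N).hom := by
  have h := dnat_app γ (Q.objPreimage N)
  change ((dfac G₁ _).inv ≫ (DF G₁).map (Q.objObjPreimageIso N).hom) ≫ (dnat γ).app N =
        Q.map ((cxn γ).app _) ≫ (dfac G₂ _).inv ≫ (DF G₂).map (Q.objObjPreimageIso N).hom
  rw [Category.assoc, (dnat γ).naturality, Iso.inv_comp_eq, ← Category.assoc, ← Category.assoc,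
      ← h, Category.assoc _ (dfac G₂ _).hom, Iso.hom_inv_id, Category.comp_id]

/-- The connecting morphism attached to a short exact sequence of exact functors. -/
def dδ {α : G₁ ⟶ G₂} {β : G₂ ⟶ G₃} (h : SES α β) (N : DerivedCategory C) :
    (DF G₃).obj N ⟶ ((DF G₁).obj N)⟦(1 : ℤ)⟧ :=
  (drep G₃ N).inv ≫ triangleOfSESδ (h.shortExact _) ≫ (drep G₁ N).hom⟦1⟧'

lemma dδ_DT {α : G₁ ⟶ G₂} {β : G₂ ⟶ G₃} (h : SES α β) (N : DerivedCategory C) :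
    DT ((dnat α).app N) ((dnat β).app N) (dδ h N) := by
  refine isomorphic_distinguished _ (triangleOfSES_distinguished (h.shortExact _)) _
      (Triangle.isoMk _ _ (drep G₁ N) (drep G₂ N) (drep G₃ N) ?_ ?_ ?_).symm
  · exact (drep_nat α N).symm
  · exact (drep_nat β N).symm
  · exact (Iso.hom_inv_id_assoc (drep G₃ N) _).symm

variable {G₁' G₂' G₃' : C ⥤ C}
  [G₁'.Additive] [PreservesFiniteLimits G₁'] [PreservesFiniteColimits G₁']
  [G₂'.Additive] [PreservesFiniteLimits G₂'] [PreservesFiniteColimits G₂']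
  [G₃'.Additive] [PreservesFiniteLimits G₃'] [PreservesFiniteColimits G₃']

lemma dδ_nat {α : G₁ ⟶ G₂} {β : G₂ ⟶ G₃} (h : SES α β) {α' : G₁' ⟶ G₂'} {β' : G₂' ⟶ G₃'}
    (h' : SES α' β') (γ₁ : G₁ ⟶ G₁') (γ₂ : G₂ ⟶ G₂') (γ₃ : G₃ ⟶ G₃')
    (h1 : α ≫ γ₂ = γ₁ ≫ α') (h2 : β ≫ γ₃ = γ₂ ≫ β') (N : DerivedCategory C) :
    dδ h N ≫ ((dnat γ₁).app N)⟦1⟧' = (dnat γ₃).app N ≫ dδ h' N := by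
  have hφ := triangleOfSESδ_naturality (h.shortExact (Q.objPreimage N))
    (h'.shortExact (Q.objPreimage N))
    { τ₁ := (cxn γ₁).app _, τ₂ := (cxn γ₂).app _, τ₃ := (cxn γ₃).app _
      comm₁₂ := by
        ext i
        exact (NatTrans.congr_app h1 ((Q.objPreimage N).X i)).symm
      comm₂₃ := by
        ext i
        exact (NatTrans.congr_app h2 ((Q.objPreimage N).X i)).symm }
  rw [← cancel_epi (drep G₃ N).hom, ← Category.assoc _ ((dnat γ₃).app N), drep_nat, dδ, dδ,
    Category.assoc, Category.assoc, Category.assoc, Iso.hom_inv_id_assoc, Iso.hom_inv_id_assoc,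
    ← Functor.map_comp, drep_nat, Functor.map_comp, ← Category.assoc, hφ, Category.assoc]

section Single

variable (G) in
/-- The derived functor of an exact functor on objects in degree zero. -/
def dsingle (A : C) : (DF G).obj ((singleFunctor C 0).obj A) ≅ (singleFunctor C 0).obj (G.obj A) :=
  dfac G ((CochainComplex.singleFunctor C 0).obj A) ≪≫
    Q.mapIso ((HomologicalComplex.singleMapHomologicalComplex G (.up ℤ) 0).app A)

lemma dsingle_nat (γ : G₁ ⟶ G₂) (A : C) :
    (dnat γ).app ((singleFunctor C 0).obj A) ≫ (dsingle G₂ A).hom =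
      (dsingle G₁ A).hom ≫ (singleFunctor C 0).map (γ.app A) := by
  have h := dnat_app γ ((CochainComplex.singleFunctor C 0).obj A)
  have key {A' A B₁ B₂ : C} (e : A' ⟶ A) (j₁ : B₁ ≅ G₁.obj A) (j₂ : B₂ ≅ G₂.obj A) :
      γ.app A' ≫ G₂.map e ≫ j₂.inv = (G₁.map e ≫ j₁.inv) ≫ j₁.hom ≫ γ.app A ≫ j₂.inv := by
    simp
  have h2 : (cxn γ).app ((CochainComplex.singleFunctor C 0).obj A) ≫
      (HomologicalComplex.singleMapHomologicalComplex G₂ (.up ℤ) 0).hom.app A =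
      (HomologicalComplex.singleMapHomologicalComplex G₁ (.up ℤ) 0).hom.app A ≫
        (CochainComplex.singleFunctor C 0).map (γ.app A) := by
    refine HomologicalComplex.to_single_hom_ext (j := 0) ?_
    change γ.app (((HomologicalComplex.single C (.up ℤ) 0).obj A).X 0) ≫
      ((HomologicalComplex.singleMapHomologicalComplex G₂ (.up ℤ) 0).hom.app A).f 0 =
      ((HomologicalComplex.singleMapHomologicalComplex G₁ (.up ℤ) 0).hom.app A).f 0 ≫
        ((HomologicalComplex.single C (.up ℤ) 0).map (γ.app A)).f 0
    rw [HomologicalComplex.singleMapHomologicalComplex_hom_app_self,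
      HomologicalComplex.singleMapHomologicalComplex_hom_app_self,
      HomologicalComplex.single_map_f_self]
    exact key _ _ _
  have h3 := (Q.map_comp _ _).symm.trans ((congrArg Q.map h2).trans (Q.map_comp _ _))
  change (dnat γ).app (Q.obj ((CochainComplex.singleFunctor C 0).obj A)) ≫ (dfac G₂ _).hom ≫
    Q.map ((HomologicalComplex.singleMapHomologicalComplex G₂ (.up ℤ) 0).hom.app A) =
    ((dfac G₁ _).hom ≫
      Q.map ((HomologicalComplex.singleMapHomologicalComplex G₁ (.up ℤ) 0).hom.app A)) ≫
        Q.map ((CochainComplex.singleFunctor C 0).map (γ.app A))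
  exact ((Category.assoc _ _ _).symm.trans (congrArg (· ≫ _) h)).trans
    ((Category.assoc _ _ _).trans ((congrArg (_ ≫ ·) h3).trans (Category.assoc _ _ _).symm))

end Single

lemma DT.map (G : C ⥤ C) [G.Additive] [PreservesFiniteLimits G] [PreservesFiniteColimits G]
    {A B E : DerivedCategory C} {f : A ⟶ B} {g : B ⟶ E} {h : E ⟶ A⟦(1 : ℤ)⟧} (hT : DT f g h) :
    ∃ h', DT ((DF G).map f) ((DF G).map g) h' :=
  ⟨_, (DF G).map_distinguished _ hT⟩

end ExactFunctors

section Quotients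

variable {X : Scheme.{u}} {F G : X.Modules}

/-- The quotient of the extension by zero from `V` by the extension by zero from `Y`. -/
def Φ {Y V : X.Opens} (h : Y ≤ V) : X.Modules ⥤ X.Modules where
  obj F := cokernel ((jle h).app F)
  map φ := cokernel.map _ _ ((J Y).map φ) ((J V).map φ) ((jle h).naturality φ).symm
  map_id F := by
    refine (cancel_epi (cokernel.π ((jle h).app F))).1 ?_
    simp
  map_comp {F _ _} φ ψ := by
    refine (cancel_epi (cokernel.π ((jle h).app F))).1 ?_
    simp

/-- The projection onto the quotient. -/
def Φπ {Y V : X.Opens} (h : Y ≤ V) : J V ⟶ Φ h where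
  app F := cokernel.π _
  naturality F G φ := (cokernel.π_desc _ _ _).symm

variable {Y V : X.Opens} (h : Y ≤ V)

instance (F : X.Modules) : Epi ((Φπ h).app F) := inferInstanceAs (Epi (cokernel.π _))

lemma jle_Φπ (F : X.Modules) : (jle h).app F ≫ (Φπ h).app F = 0 := cokernel.condition _

lemma Φ_shortExact (F : X.Modules) :
    (ShortComplex.mk ((jle h).app F) ((Φπ h).app F) (jle_Φπ h F)).ShortExact where
  exact := ShortComplex.exact_cokernel _
  mono_f := inferInstanceAs (Mono ((jle h).app F))
  epi_g := inferInstanceAs (Epi ((Φπ h).app F))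

instance : (Φ h).Additive where
  map_add {F G φ ψ} := by
    rw [← cancel_epi ((Φπ h).app F), ← (Φπ h).naturality, Preadditive.comp_add,
      ← (Φπ h).naturality, ← (Φπ h).naturality, Functor.map_add, Preadditive.add_comp]

lemma Φ_ap_map (φ : F ⟶ G) {W : X.Opens} (s : Γ((J V).obj F, W)) :
    ap ((Φ h).map φ) W (ap ((Φπ h).app F) W s) = ap ((Φπ h).app G) W (ap ((J V).map φ) W s) := by
  rw [← ap_comp, ← ap_comp, (Φπ h).naturality]

lemma Φ_locIm {W : X.Opens} (t : Γ((Φ h).obj F, W)) {x : X} (hx : x ∈ W) :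
    ∃ (W' : X.Opens) (h' : W' ≤ W), x ∈ W' ∧
      ∃ s : Γ((J V).obj F, W'), ap ((Φπ h).app F) W' s = rs _ h' t :=
  locIm_of_epi ((Φπ h).app F) t x hx

lemma Φ_eq_zero_iff {W : X.Opens} (s : Γ((J V).obj F, W)) :
    ap ((Φπ h).app F) W s = 0 ↔ LocIm ((jle h).app F) s := by
  constructor
  · exact (exact_iff_locIm _).1 (Φ_shortExact h F).exact W s
  · intro hs
    refine sec_ext fun x hx => ?_
    obtain ⟨W', hW', hx', t, ht⟩ := hs x hx
    refine ⟨W', hW', hx', ?_⟩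
    rw [map_zero, ← ap_rs, ← ht, ← ap_comp, jle_Φπ, ap_zero]

lemma Φ_zero_of_le {W : X.Opens} (hW : W ≤ Y) (s : Γ((J V).obj F, W)) :
    ap ((Φπ h).app F) W s = 0 := by
  obtain ⟨t, rfl⟩ := (jle_bij h hW F).2 s
  rw [← ap_comp, jle_Φπ, ap_zero]

lemma Φ_zero_of_le' {W : X.Opens} (hW : W ≤ Y) (t : Γ((Φ h).obj F, W)) : t = 0 := by
  refine sec_ext fun x hx => ?_
  obtain ⟨W', hW', hx', s, hs⟩ := Φ_locIm h t hx
  exact ⟨W', hW', hx', by rw [map_zero, ← hs, Φ_zero_of_le h (hW'.trans hW)]⟩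

lemma Φ_exact {S : ShortComplex X.Modules} (hS : S.Exact) {W : X.Opens}
    (t : Γ((Φ h).obj S.X₂, W)) (ht : ap ((Φ h).map S.g) W t = 0) :
    LocIm ((Φ h).map S.f) t := by
  have hJ : ∀ (W : X.Opens) (s : Γ((J V).obj S.X₂, W)), ap ((J V).map S.g) W s = 0 →
      LocIm ((J V).map S.f) s := (exact_iff_locIm (S.map (J V))).1 (hS.map (J V))
  refine locIm_trans fun x hx => ?_
  by_cases hY : x ∈ Y
  · refine ⟨W ⊓ Y, inf_le_left, ⟨hx, hY⟩, ?_⟩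
    rw [Φ_zero_of_le' h inf_le_right (rs _ (inf_le_left : W ⊓ Y ≤ W) t),
      ← map_zero (ap ((Φ h).map S.f) (W ⊓ Y))]
    exact LocIm.of_ap _ _
  obtain ⟨W₁, h₁, hx₁, a, ha⟩ := Φ_locIm h t hx
  have h2 : ap ((Φπ h).app S.X₃) W₁ (ap ((J V).map S.g) W₁ a) = 0 := by
    rw [← Φ_ap_map, ha, ap_rs, ht, map_zero]
  obtain ⟨W₂, h₂, hx₂, b, hb⟩ := (Φ_eq_zero_iff h _).1 h2 x hx₁
  obtain hx3 | ⟨W₃, h₃, hx₃, hb'⟩ := J_local b hx₂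
  · exact absurd hx3 hY
  have h4 : ap ((J V).map S.g) W₃ (rs _ (h₃.trans h₂) a) = 0 := by
    rw [ap_rs, ← rs_rs h₃ h₂, ← hb, ← ap_rs, hb', map_zero]
  obtain ⟨W₄, h₄, hx₄, c, hc⟩ := hJ W₃ _ h4 x hx₃
  refine ⟨W₄, ((h₄.trans h₃).trans h₂).trans h₁, hx₄, ?_⟩
  have h6 : rs ((Φ h).obj S.X₂) (((h₄.trans h₃).trans h₂).trans h₁) t =
      ap ((Φ h).map S.f) W₄ (ap ((Φπ h).app S.X₁) W₄ c) := by
    rw [Φ_ap_map, hc, rs_rs, ap_rs, ha, rs_rs]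
  rw [h6]
  exact LocIm.of_ap _ _

instance : (Φ h).PreservesHomology :=
  Functor.preservesHomology_of_map_exact _ fun S hS =>
    (exact_iff_locIm (S.map (Φ h))).2 fun _ t ht => Φ_exact h hS t ht

instance : PreservesFiniteLimits (Φ h) := Functor.preservesFiniteLimits_of_preservesHomology _
instance : PreservesFiniteColimits (Φ h) := Functor.preservesFiniteColimits_of_preservesHomology _

/-- Functoriality of the quotient in the pair of open subsets. -/
def Φm {Y V Y' V' : X.Opens} (h : Y ≤ V) (h' : Y' ≤ V') (hY : Y ≤ Y') (hV : V ≤ V') :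
    Φ h ⟶ Φ h' where
  app F := cokernel.map _ _ ((jle hY).app F) ((jle hV).app F) (by
    rw [← cancel_mono (jin V' F), Category.assoc, Category.assoc]
    simp only [jle_ι])
  naturality F G φ := by
    refine (cancel_epi (cokernel.π ((jle h).app F))).1 ?_
    simp [Φ]

lemma Φπ_Φm {Y V Y' V' : X.Opens} (h : Y ≤ V) (h' : Y' ≤ V') (hY : Y ≤ Y') (hV : V ≤ V') :
    Φπ h ≫ Φm h h' hY hV = jle hV ≫ Φπ h' := by
  ext F : 2
  exact cokernel.π_desc _ _ _

lemma isIso_Φm {Y Z : X.Opens} (F : X.Modules) :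
    IsIso ((Φm (inf_le_left : Y ⊓ Z ≤ Y) (le_sup_right : Z ≤ Y ⊔ Z) inf_le_right
      le_sup_left).app F) := by
  set α := (Φm (inf_le_left : Y ⊓ Z ≤ Y) (le_sup_right : Z ≤ Y ⊔ Z) inf_le_right
      le_sup_left).app F with hα
  have key : ∀ {W : X.Opens} (s : Γ((J Y).obj F, W)), ap α W (ap ((Φπ _).app F) W s) =
      ap ((Φπ _).app F) W (ap ((jle le_sup_left).app F) W s) := fun s => by
    rw [hα, ← ap_comp, ← ap_comp, ← NatTrans.comp_app, Φπ_Φm, NatTrans.comp_app]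
  have h1 : Mono α := by
    refine mono_of_inj fun W t ht => sec_ext fun x hx => ?_
    obtain ⟨W₁, h₁, hx₁, a, ha⟩ := Φ_locIm _ t hx
    by_cases hYZ : x ∈ Y ⊓ Z
    · refine ⟨W ⊓ (Y ⊓ Z), inf_le_left, ⟨hx, hYZ⟩, ?_⟩
      rw [Φ_zero_of_le' _ inf_le_right (rs _ _ t), map_zero]
    have h2 : ∃ (W' : X.Opens) (h : W' ≤ W₁), x ∈ W' ∧ rs _ h a = 0 := by
      obtain hY | h2 := J_local a hx₁
      · have hZ : x ∉ Z := fun hZ => hYZ ⟨hY, hZ⟩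
        have h3 : ap ((Φπ (le_sup_right : Z ≤ Y ⊔ Z)).app F) W₁
            (ap ((jle le_sup_left).app F) W₁ a) = 0 := by
          rw [← key, ha, ap_rs, ht, map_zero]
        obtain ⟨W₂, h₂, hx₂, b, hb⟩ := (Φ_eq_zero_iff _ _).1 h3 x hx₁
        obtain hx3 | ⟨W₃, h₃, hx₃, hb'⟩ := J_local b hx₂
        · exact absurd hx3 hZ
        refine ⟨W₃, h₃.trans h₂, hx₃, inj_of_mono ((jle (le_sup_left : Y ≤ Y ⊔ Z)).app F) ?_⟩
        rw [ap_rs, ← rs_rs h₃ h₂, ← hb, ← ap_rs, hb', map_zero]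
      · exact h2
    obtain ⟨W₂, h₂, hx₂, h3⟩ := h2
    refine ⟨W₂, h₂.trans h₁, hx₂, ?_⟩
    rw [map_zero, ← rs_rs h₂ h₁, ← ha, ← ap_rs, h3, map_zero]
  have h2 : Epi α := by
    refine epi_of_locIm fun W t => locIm_trans fun x hx => ?_
    have hzero : ∀ (W' : X.Opens) (h : W' ≤ W), rs _ h t = 0 → LocIm α (rs _ h t) := by
      intro W' h h0
      rw [h0, ← map_zero (ap α W')]
      exact LocIm.of_ap _ _
    by_cases hZ : x ∈ Z
    · exact ⟨W ⊓ Z, inf_le_left, ⟨hx, hZ⟩, hzero _ _ (Φ_zero_of_le' _ inf_le_right _)⟩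
    obtain ⟨W₁, h₁, hx₁, a, ha⟩ := Φ_locIm _ t hx
    obtain hYZ | ⟨W₂, h₂, hx₂, h3⟩ := J_local a hx₁
    · have hY : x ∈ Y := hYZ.resolve_right hZ
      refine ⟨W₁ ⊓ Y, inf_le_left.trans h₁, ⟨hx₁, hY⟩, ?_⟩
      obtain ⟨b, hb⟩ := (jle_bij (le_sup_left : Y ≤ Y ⊔ Z) inf_le_right F).2
        (rs _ (inf_le_left : W₁ ⊓ Y ≤ W₁) a)
      have h4 : rs _ (inf_le_left.trans h₁) t = ap α _ (ap ((Φπ _).app F) (W₁ ⊓ Y) b) := by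
        rw [key, hb, ap_rs, ha, rs_rs]
      rw [h4]
      exact LocIm.of_ap _ _
    · refine ⟨W₂, h₂.trans h₁, hx₂, hzero _ _ ?_⟩
      rw [← rs_rs h₂ h₁, ← ha, ← ap_rs, h3, map_zero]
  exact isIso_of_mono_of_epi _

end Quotients

section MayerVietoris

variable {D : Type*} [Category* D] [HasZeroObject D] [HasShift D ℤ] [Preadditive D]
  [∀ n : ℤ, (shiftFunctor D n).Additive] [Pretriangulated D]

/-- A Mayer–Vietoris square, with its boundary morphism. -/
structure MV {N₀ N₁ N₂ N : D} (a : N₀ ⟶ N₁) (i : N₀ ⟶ N₂) (j : N₁ ⟶ N) (k : N₂ ⟶ N)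
    (d : N ⟶ N₀⟦(1 : ℤ)⟧) : Prop where
  comm : a ≫ j = i ≫ k
  left_d : j ≫ d = 0
  right_d : k ≫ d = 0
  d_left : d ≫ a⟦1⟧' = 0
  d_right : d ≫ i⟦1⟧' = 0
  desc : ∀ {E : D} (z : N ⟶ E), j ≫ z = 0 → k ≫ z = 0 → ∃ w : N₀⟦(1 : ℤ)⟧ ⟶ E, z = d ≫ w
  glue : ∀ {E : D} (x : N₁ ⟶ E) (y : N₂ ⟶ E), a ≫ x = i ≫ y → ∃ z : N ⟶ E, j ≫ z = x ∧ k ≫ z = y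
  split : ∀ {E : D} (v : N₀⟦(1 : ℤ)⟧ ⟶ E), d ≫ v = 0 →
    ∃ (x : N₁⟦(1 : ℤ)⟧ ⟶ E) (y : N₂⟦(1 : ℤ)⟧ ⟶ E), v = a⟦1⟧' ≫ x + i⟦1⟧' ≫ y

lemma MV.of_DT {N₀ N₁ N₂ N Q Q' : D} {a : N₀ ⟶ N₁} {p : N₁ ⟶ Q} {d : Q ⟶ N₀⟦(1 : ℤ)⟧}
    (hT : DT a p d) {k : N₂ ⟶ N} {p' : N ⟶ Q'} {d' : Q' ⟶ N₂⟦(1 : ℤ)⟧} (hT' : DT k p' d')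
    {i : N₀ ⟶ N₂} {j : N₁ ⟶ N} (φ : Q ⟶ Q') [IsIso φ] (h₁ : a ≫ j = i ≫ k)
    (h₂ : p ≫ φ = j ≫ p') (h₃ : d ≫ i⟦1⟧' = φ ≫ d') : MV a i j k (p' ≫ inv φ ≫ d) where
  comm := h₁
  left_d := by
    rw [← Category.assoc, ← h₂, Category.assoc, IsIso.hom_inv_id_assoc, hT.comp₂₃]
  right_d := by rw [← Category.assoc, hT'.comp₁₂, zero_comp]
  d_left := by rw [Category.assoc, Category.assoc, hT.comp₃₁, comp_zero, comp_zero]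
  d_right := by
    rw [Category.assoc, Category.assoc, h₃, IsIso.inv_hom_id_assoc, hT'.comp₂₃]
  desc z hj hk := by
    obtain ⟨w, rfl⟩ := hT'.desc₃ z hk
    obtain ⟨v, hv⟩ := hT.desc₁ (φ ≫ w) (by rw [← Category.assoc, h₂, Category.assoc, hj])
    exact ⟨v, by rw [Category.assoc, Category.assoc, ← hv, IsIso.inv_hom_id_assoc]⟩
  glue {E} x y hxy := by
    have h4 : d' ≫ y⟦1⟧' = 0 := by
      rw [← cancel_epi φ, comp_zero, ← Category.assoc, ← h₃, Category.assoc, ← Functor.map_comp,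
        ← hxy, Functor.map_comp, ← Category.assoc, hT.comp₃₁, zero_comp]
    obtain ⟨z', hz'⟩ := hT'.rot.rot.desc₃ (y⟦1⟧') h4
    obtain ⟨z, rfl⟩ := (shiftFunctor D (1 : ℤ)).map_surjective z'
    have h5 : k ≫ (-z) = y := by
      refine (shiftFunctor D (1 : ℤ)).map_injective ?_
      rw [hz', Functor.map_comp, Functor.map_neg, Preadditive.comp_neg, Preadditive.neg_comp]
    obtain ⟨w, hw⟩ := hT.desc₃ (x - j ≫ (-z)) (by
      rw [Preadditive.comp_sub, ← Category.assoc, h₁, Category.assoc, h5, hxy, sub_self])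
    refine ⟨-z + p' ≫ inv φ ≫ w, ?_, ?_⟩
    · rw [Preadditive.comp_add, ← Category.assoc j p', ← h₂, Category.assoc,
        IsIso.hom_inv_id_assoc, ← hw]
      abel
    · rw [Preadditive.comp_add, h5, ← Category.assoc k p', hT'.comp₁₂, zero_comp, add_zero]
  split v hv := by
    rw [Category.assoc, Category.assoc] at hv
    obtain ⟨y, hy⟩ := hT'.desc₁ _ hv
    obtain ⟨x, hx⟩ := hT.desc₂ (v - i⟦1⟧' ≫ y) (by
      rw [Preadditive.comp_sub, ← Category.assoc d, h₃, Category.assoc, ← hy,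
        IsIso.hom_inv_id_assoc, sub_self])
    exact ⟨x, y, by rw [← hx]; abel⟩

end MayerVietoris

section Geometric

variable {X : Scheme.{u}} [HasDerivedCategory.{u + 1} X.Modules]

/-- The derived extension by zero from `V`. -/
abbrev DJ (V : X.Opens) : DerivedCategory X.Modules ⥤ DerivedCategory X.Modules := DF (J V)

/-- The transition between derived extensions by zero. -/
def dle {Y V : X.Opens} (h : Y ≤ V) (N : DerivedCategory X.Modules) :
    (DJ Y).obj N ⟶ (DJ V).obj N := (dnat (jle h)).app N

/-- Multiplication by a function on the derived extension by zero. -/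
def dmul {V : X.Opens} (f : Γ(X, V)) (N : DerivedCategory X.Modules) :
    (DJ V).obj N ⟶ (DJ V).obj N := (dnat (mul f)).app N

/-- The derived counit. -/
def dε (V : X.Opens) (N : DerivedCategory X.Modules) : (DJ V).obj N ⟶ N := (dcounit (jι V)).app N

variable {U W Y Z V : X.Opens} {M N : DerivedCategory X.Modules}

lemma jle_jle (h : Y ≤ V) (h' : V ≤ W) : jle h ≫ jle h' = jle (h.trans h') := by
  ext F : 2
  rw [← cancel_mono (jin W F), NatTrans.comp_app, Category.assoc, jle_ι, jle_ι, jle_ι]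

lemma jle_self : jle (le_refl V) = 𝟙 _ := by
  ext F : 2
  rw [← cancel_mono (jin V F), jle_ι]
  exact (Category.id_comp _).symm

lemma jle_jι (h : Y ≤ V) : jle h ≫ jι V = jι Y := by
  ext F : 2
  exact jle_ι h F

lemma jle_sq {Y V Y' V' : X.Opens} (h : Y ≤ V) (h' : Y' ≤ V') (hY : Y ≤ Y') (hV : V ≤ V') :
    jle h ≫ jle hV = jle hY ≫ jle h' := by rw [jle_jle, jle_jle]

lemma dle_dle (h : Y ≤ V) (h' : V ≤ W) (N) : dle h N ≫ dle h' N = dle (h.trans h') N := by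
  rw [dle, dle, dle, ← NatTrans.comp_app, ← dnat_comp, jle_jle]

lemma dle_self (N) : dle (le_refl V) N = 𝟙 _ := by
  rw [dle, jle_self, dnat_id, NatTrans.id_app]

lemma dle_naturality (h : Y ≤ V) (φ : M ⟶ N) :
    (DJ Y).map φ ≫ dle h N = dle h M ≫ (DJ V).map φ := (dnat (jle h)).naturality φ

lemma dmul_naturality (f : Γ(X, V)) (φ : M ⟶ N) :
    (DJ V).map φ ≫ dmul f N = dmul f M ≫ (DJ V).map φ := (dnat (mul f)).naturality φ

lemma dle_dmul (h : Y ≤ V) (f : Γ(X, V)) (N) :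
    dle h N ≫ dmul f N = dmul (ors h f) N ≫ dle h N := by
  rw [dle, dmul, dmul, ← NatTrans.comp_app, ← NatTrans.comp_app, ← dnat_comp, ← dnat_comp, jle_mul]

lemma dmul_dmul (f g : Γ(X, V)) (N) : dmul f N ≫ dmul g N = dmul (f * g) N := by
  rw [dmul, dmul, dmul, ← NatTrans.comp_app, ← dnat_comp, mul_mul]

lemma dmul_one (N) : dmul (1 : Γ(X, V)) N = 𝟙 _ := by
  rw [dmul, mul_one', dnat_id, NatTrans.id_app]

lemma dmul_add (f g : Γ(X, V)) (N) : dmul (f + g) N = dmul f N + dmul g N := by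
  rw [dmul, mul_add', dnat_add, NatTrans.app_add]; rfl

lemma dε_naturality (φ : M ⟶ N) : (DJ V).map φ ≫ dε V N = dε V M ≫ φ :=
  (dcounit (jι V)).naturality φ

lemma dle_dε (h : Y ≤ V) (N) : dle h N ≫ dε V N = dε Y N := by
  rw [dle, dε, ← NatTrans.comp_app, dnat_dcounit, jle_jι]; rfl

lemma isIso_DJ_dε (h : W ≤ V) (N : DerivedCategory X.Modules) : IsIso ((DJ W).map (dε V N)) := by
  obtain ⟨K, ⟨e⟩⟩ := exists_iso_Q N
  have h1 : IsIso ((DJ W).map (dε V (Q.obj K))) := by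
    rw [dε, dcounit_app, Functor.map_comp]
    have := isIso_DF_map_Q (G := J W) (cxc (jι V) K) fun i => isIso_J_jin h (K.X i)
    infer_instance
  have : IsIso ((Functor.whiskerRight (dcounit (jι V)) (DJ W)).app (Q.obj K)) := h1
  exact isIso_app_of_iso (Functor.whiskerRight (dcounit (jι V)) (DJ W)) e

lemma isIso_dle_DJ (V W : X.Opens) (N : DerivedCategory X.Modules) :
    IsIso (dle (inf_le_left : V ⊓ W ≤ V) ((DJ W).obj N)) := by
  obtain ⟨K, ⟨e⟩⟩ := exists_iso_Q N
  have h1 : IsIso (dle (inf_le_left : V ⊓ W ≤ V) (Q.obj ((cx (J W)).obj K))) :=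
    isIso_dnat_app_Q _ _ fun i => isIso_jle_J V W (K.X i)
  have e' : Q.obj ((cx (J W)).obj K) ≅ (DJ W).obj N :=
    (dfac (J W) K).symm ≪≫ (DJ W).mapIso e
  have : IsIso ((dnat (jle (inf_le_left : V ⊓ W ≤ V))).app (Q.obj ((cx (J W)).obj K))) := h1
  exact isIso_app_of_iso _ e'

/-- Composition of derived extensions by zero. -/
def dJJ (V W : X.Opens) (N : DerivedCategory X.Modules) :
    (DJ (V ⊓ W)).obj N ≅ (DJ V).obj ((DJ W).obj N) :=
  haveI := isIso_DJ_dε (inf_le_right : V ⊓ W ≤ W) N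
  haveI := isIso_dle_DJ V W N
  (asIso ((DJ (V ⊓ W)).map (dε W N))).symm ≪≫ asIso (dle inf_le_left ((DJ W).obj N))

/-- The derived quotient of two extensions by zero. -/
abbrev DΦ (h : Y ≤ V) : DerivedCategory X.Modules ⥤ DerivedCategory X.Modules := DF (Φ h)

lemma Φ_SES (h : Y ≤ V) : SES (jle h) (Φπ h) := ⟨jle_Φπ h, Φ_shortExact h⟩

/-- The projection to the derived quotient. -/
def dπ (h : Y ≤ V) (N : DerivedCategory X.Modules) : (DJ V).obj N ⟶ (DΦ h).obj N :=
  (dnat (Φπ h)).app N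

/-- The connecting morphism of the derived quotient. -/
def dδΦ (h : Y ≤ V) (N : DerivedCategory X.Modules) :
    (DΦ h).obj N ⟶ ((DJ Y).obj N)⟦(1 : ℤ)⟧ := dδ (Φ_SES h) N

lemma Φ_DT (h : Y ≤ V) (N) : DT (dle h N) (dπ h N) (dδΦ h N) := dδ_DT (Φ_SES h) N

/-- Multiplication on the quotient. -/
def Φmul (h : Y ≤ V) (f : Γ(X, V)) : Φ h ⟶ Φ h where
  app F := cokernel.map _ _ ((mul (ors h f)).app F) ((mul f).app F)
    (NatTrans.congr_app (jle_mul h f) F)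
  naturality F G φ := by
    refine (cancel_epi (cokernel.π ((jle h).app F))).1 ?_
    simp [Φ]

lemma Φπ_Φmul (h : Y ≤ V) (f : Γ(X, V)) : Φπ h ≫ Φmul h f = mul f ≫ Φπ h := by
  ext F : 2
  exact cokernel.π_desc _ _ _

/-- Multiplication on the derived quotient. -/
def dΦmul (h : Y ≤ V) (f : Γ(X, V)) (N : DerivedCategory X.Modules) :
    (DΦ h).obj N ⟶ (DΦ h).obj N := (dnat (Φmul h f)).app N

/-- Functoriality of the derived quotient in the pair. -/
def dΦm {Y V Y' V' : X.Opens} (h : Y ≤ V) (h' : Y' ≤ V') (hY : Y ≤ Y') (hV : V ≤ V')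
    (N : DerivedCategory X.Modules) : (DΦ h).obj N ⟶ (DΦ h').obj N := (dnat (Φm h h' hY hV)).app N

lemma dπ_dΦm {Y V Y' V' : X.Opens} (h : Y ≤ V) (h' : Y' ≤ V') (hY : Y ≤ Y') (hV : V ≤ V') (N) :
    dπ h N ≫ dΦm h h' hY hV N = dle hV N ≫ dπ h' N := by
  rw [dπ, dΦm, dle, dπ, ← NatTrans.comp_app, ← NatTrans.comp_app, ← dnat_comp, ← dnat_comp, Φπ_Φm]

lemma dδΦ_dle {Y V Y' V' : X.Opens} (h : Y ≤ V) (h' : Y' ≤ V') (hY : Y ≤ Y') (hV : V ≤ V') (N) :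
    dδΦ h N ≫ (dle hY N)⟦1⟧' = dΦm h h' hY hV N ≫ dδΦ h' N :=
  dδ_nat (Φ_SES h) (Φ_SES h') (jle hY) (jle hV) (Φm h h' hY hV) (jle_sq h h' hY hV)
    (Φπ_Φm h h' hY hV) N

instance isIso_dΦm (Y Z : X.Opens) (N : DerivedCategory X.Modules) :
    IsIso (dΦm (inf_le_left : Y ⊓ Z ≤ Y) (le_sup_right : Z ≤ Y ⊔ Z) inf_le_right
      le_sup_left N) := by
  obtain ⟨K, ⟨e⟩⟩ := exists_iso_Q N
  have := isIso_dnat_app_Q (Φm (inf_le_left : Y ⊓ Z ≤ Y) (le_sup_right : Z ≤ Y ⊔ Z) inf_le_right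
      le_sup_left) K fun i => isIso_Φm (K.X i)
  exact isIso_app_of_iso _ e

/-- The Mayer–Vietoris boundary. -/
def dbd (Y Z : X.Opens) (N : DerivedCategory X.Modules) :
    (DJ (Y ⊔ Z)).obj N ⟶ ((DJ (Y ⊓ Z)).obj N)⟦(1 : ℤ)⟧ :=
  dπ le_sup_right N ≫ inv (dΦm (inf_le_left : Y ⊓ Z ≤ Y) (le_sup_right : Z ≤ Y ⊔ Z) inf_le_right
    le_sup_left N) ≫ dδΦ inf_le_left N

lemma mv (Y Z : X.Opens) (N : DerivedCategory X.Modules) :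
    MV (dle inf_le_left N) (dle inf_le_right N) (dle le_sup_left N) (dle le_sup_right N)
      (dbd Y Z N) :=
  MV.of_DT (Φ_DT inf_le_left N) (Φ_DT le_sup_right N) _ (by rw [dle_dle, dle_dle])
    (dπ_dΦm _ _ _ _ _) (dδΦ_dle _ _ _ _ _)

end Geometric

section Sections

variable {X : Scheme.{u}} [HasDerivedCategory.{u + 1} X.Modules]

variable (X) in
/-- The structure sheaf in the derived category. -/
abbrev SX : DerivedCategory X.Modules := (singleFunctor X.Modules 0).obj (OX X)

/-- The extension by zero of the structure sheaf in the derived category. -/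
abbrev OD (V : X.Opens) : DerivedCategory X.Modules := (DJ V).obj (SX X)

/-- The zeroth cohomology sheaf. -/
abbrev H0 (E : DerivedCategory X.Modules) : X.Modules := (homologyFunctor X.Modules 0).obj E

/-- The section of the cohomology sheaf defined by a morphism. -/
def sg (V : X.Opens) (E : DerivedCategory X.Modules) : (OD V ⟶ E) →+ Γ(H0 E, V) :=
  (ev V (H0 E)).toAddMonoidHom.comp ((shHom (O V) E).comp
    (Preadditive.leftComp E (dsingle (J V) (OX X)).inv))

variable {Y V : X.Opens} {E E' : DerivedCategory X.Modules}

lemma sg_apply (ξ : OD V ⟶ E) :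
    sg V E ξ = ev V (H0 E) (sh ((dsingle (J V) (OX X)).inv ≫ ξ)) := rfl

lemma sg_comp (ξ : OD V ⟶ E) (φ : E ⟶ E') :
    sg V E' (ξ ≫ φ) = ap ((homologyFunctor X.Modules 0).map φ) V (sg V E ξ) := by
  rw [sg_apply, sg_apply, ← ev_comp, ← sh_comp, Category.assoc]

lemma dsingle_nat' {G₁ G₂ : X.Modules ⥤ X.Modules} [G₁.Additive] [PreservesFiniteLimits G₁]
    [PreservesFiniteColimits G₁] [G₂.Additive] [PreservesFiniteLimits G₂]
    [PreservesFiniteColimits G₂] (γ : G₁ ⟶ G₂) (A : X.Modules) :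
    (dsingle G₁ A).inv ≫ (dnat γ).app ((singleFunctor _ 0).obj A) =
      (singleFunctor _ 0).map (γ.app A) ≫ (dsingle G₂ A).inv := by
  rw [Iso.inv_comp_eq, ← Category.assoc, ← dsingle_nat, Category.assoc, Iso.hom_inv_id,
    Category.comp_id]

lemma sg_dle (h : Y ≤ V) (ξ : OD V ⟶ E) : sg Y E (dle h _ ≫ ξ) = rs _ h (sg V E ξ) := by
  rw [sg_apply, sg_apply, ← ev_ole, ole, ← sh_map, dle, ← Category.assoc, dsingle_nat',
    Category.assoc]

lemma sg_dmul (f : Γ(X, V)) (ξ : OD V ⟶ E) : sg V E (dmul f _ ≫ ξ) = f • sg V E ξ := by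
  rw [sg_apply, sg_apply, ← ev_mul, ← sh_map, dmul, ← Category.assoc, dsingle_nat', Category.assoc]

lemma sg_bij (V : X.Opens) (E : DerivedCategory X.Modules) [E.IsGE 0] :
    Function.Bijective (sg V E) := by
  refine (ev V (H0 E)).bijective.comp ((sh_bijective (O V) E).comp ?_)
  exact ⟨fun a b h => (cancel_epi (dsingle (J V) (OX X)).inv).1 h,
    fun b => ⟨(dsingle (J V) (OX X)).hom ≫ b, Iso.inv_hom_id_assoc _ _⟩⟩

lemma exists_cover_of_epi {B : X.Modules} (p : B ⟶ O V) [Epi p] {x : X} (hx : x ∈ V) :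
    ∃ (V' : X.Opens) (h : V' ≤ V), x ∈ V' ∧ ∃ q : O V' ⟶ B, q ≫ p = ole h := by
  obtain ⟨V', h, hx', b, hb⟩ := locIm_of_epi p (one V) x hx
  refine ⟨V', h, hx', (ev V' B).symm b, (ev V' (O V)).injective ?_⟩
  rw [ev_comp, AddEquiv.apply_symm_apply, hb, ev_apply, ole_one]

lemma dle_single (h : Y ≤ V) : dle h (SX X) =
    (dsingle (J Y) (OX X)).hom ≫ (singleFunctor _ 0).map (ole h) ≫ (dsingle (J V) (OX X)).inv := by
  rw [← Iso.inv_comp_eq, dle, dsingle_nat', ole]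

lemma sg_eq_zero {ξ : OD V ⟶ E} (hξ : sg V E ξ = 0) {x : X} (hx : x ∈ V) :
    ∃ (V' : X.Opens) (h : V' ≤ V), x ∈ V' ∧ dle h _ ≫ ξ = 0 := by
  rw [sg_apply] at hξ
  obtain ⟨B, p, hp, h0⟩ := exists_epi_of_sh_eq_zero _ ((map_eq_zero_iff _ (ev V _).injective).1 hξ)
  obtain ⟨V', h, hx', q, hq⟩ := exists_cover_of_epi p hx
  refine ⟨V', h, hx', ?_⟩
  rw [dle_single, ← hq, Functor.map_comp, Category.assoc, Category.assoc, Category.assoc, h0,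
    comp_zero, comp_zero]

lemma sg_lift (s : Γ(H0 E, V)) {x : X} (hx : x ∈ V) :
    ∃ (V' : X.Opens) (h : V' ≤ V), x ∈ V' ∧ ∃ ξ : OD V' ⟶ E, sg V' E ξ = rs _ h s := by
  obtain ⟨B, p, ξ, hp, hξ⟩ := exists_epi_lift_sh ((ev V _).symm s)
  obtain ⟨V', h, hx', q, hq⟩ := exists_cover_of_epi p hx
  refine ⟨V', h, hx', (dsingle _ _).hom ≫ (singleFunctor _ 0).map q ≫ ξ, ?_⟩
  rw [sg_apply, Iso.inv_hom_id_assoc, sh_map, hξ, ← Category.assoc, hq, ev_ole,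
    AddEquiv.apply_symm_apply]

end Sections

section Pairs

variable {X : Scheme.{u}}

/-- Two principal open subsets covering an affine open subset. -/
structure Pair (Y Z : X.Opens) : Prop where
  affine : IsAffineOpen (Y ⊔ Z)
  basic : ∃ f g : Γ(X, Y ⊔ Z), X.basicOpen f = Y ∧ X.basicOpen g = Z

lemma basicOpen_ors {Y V : X.Opens} (h : Y ≤ V) (f : Γ(X, V)) :
    X.basicOpen (ors h f) = Y ⊓ X.basicOpen f := X.basicOpen_res f _

variable {Y Z W : X.Opens}

lemma Pair.exists_comb (h : Pair Y Z) : ∃ f g : Γ(X, Y ⊔ Z), X.basicOpen f = Y ∧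
    X.basicOpen g = Z ∧ ∀ n m : ℕ, ∃ a b, a * f ^ n + b * g ^ m = 1 := by
  obtain ⟨f, g, hf, hg⟩ := h.basic
  refine ⟨f, g, hf, hg, fun n m => ?_⟩
  have h1 : Ideal.span {f, g} = ⊤ := by
    rw [← h.affine.self_le_iSup_basicOpen_iff]
    refine sup_le ?_ ?_
    · conv_lhs => rw [← hf]
      exact le_iSup (fun i : ({f, g} : Set _) => X.basicOpen i.1) ⟨f, by simp⟩
    · conv_lhs => rw [← hg]
      exact le_iSup (fun i : ({f, g} : Set _) => X.basicOpen i.1) ⟨g, by simp⟩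
  have h2 : IsCoprime f g := by
    rwa [← Ideal.isCoprime_span_singleton_iff, Ideal.isCoprime_iff_sup_eq, ← Ideal.span_union,
      Set.singleton_union]
  exact h2.pow

lemma Pair.symm (h : Pair Y Z) : Pair Z Y := by
  obtain ⟨ha, f, g, hf, hg⟩ := h
  have e : Z ⊔ Y = Y ⊔ Z := sup_comm _ _
  refine ⟨e ▸ ha, ors e.le g, ors e.le f, ?_, ?_⟩
  · rw [basicOpen_ors, hg]; exact inf_eq_right.2 le_sup_left
  · rw [basicOpen_ors, hf]; exact inf_eq_right.2 le_sup_right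

lemma Pair.left (h : Pair Y Z) : IsAffineOpen Y := by
  obtain ⟨ha, f, g, hf, hg⟩ := h
  have h := ha.basicOpen f
  rwa [hf] at h

lemma Pair.right (h : Pair Y Z) : IsAffineOpen Z := h.symm.left

lemma Pair.inter (h : Pair Y Z) : IsAffineOpen (Y ⊓ Z) := by
  obtain ⟨ha, f, g, hf, hg⟩ := h
  have h : IsAffineOpen (X.basicOpen f ⊓ X.basicOpen g) := by
    rw [← X.basicOpen_mul]; exact ha.basicOpen _
  rwa [hf, hg] at h

/-- Local properties of affine opens that glue along two principal opens hold on all affines. -/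
lemma affine_induction (hW : IsAffineOpen W) (P : X.Opens → Prop) (hbot : P ⊥)
    (hmono : ∀ Y Y' : X.Opens, Y ≤ W → Y' ≤ Y → P Y → P Y')
    (hglue : ∀ Y Z : X.Opens, Y ⊔ Z ≤ W → Pair Y Z → P Y → P Z → P (Y ⊔ Z))
    (hloc : ∀ x ∈ W, ∃ V : X.Opens, V ≤ W ∧ x ∈ V ∧ ∀ Y ≤ V, P Y) : P W := by
  let I : Ideal Γ(X, W) :=
    { carrier := {f | P (X.basicOpen f)}
      zero_mem' := by change P (X.basicOpen 0); rw [X.basicOpen_zero]; exact hbot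
      add_mem' := by
        intro f g hf hg
        have hle : X.basicOpen (f + g) ≤ W := X.basicOpen_le _
        have e : X.basicOpen (ors hle f) ⊔ X.basicOpen (ors hle g) = X.basicOpen (f + g) := by
          rw [basicOpen_ors, basicOpen_ors, ← inf_sup_left]
          exact inf_eq_left.2 (X.basicOpen_add_le f g)
        have h1 : ∀ a : Γ(X, W), X.basicOpen (ors hle a) ≤ X.basicOpen a := fun a => by
          rw [basicOpen_ors]; exact inf_le_right
        have hp : Pair (X.basicOpen (ors hle f)) (X.basicOpen (ors hle g)) := by
          refine ⟨by rw [e]; exact hW.basicOpen _, ors e.le (ors hle f), ors e.le (ors hle g), ?_, ?_⟩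
          · rw [basicOpen_ors]; exact inf_eq_right.2 le_sup_left
          · rw [basicOpen_ors]; exact inf_eq_right.2 le_sup_right
        change P (X.basicOpen (f + g))
        have h2 := hglue _ _ (e.le.trans hle) hp (hmono _ _ (X.basicOpen_le f) (h1 f) hf)
          (hmono _ _ (X.basicOpen_le g) (h1 g) hg)
        rwa [e] at h2
      smul_mem' := by
        intro r f hf
        refine hmono _ _ (X.basicOpen_le f) ?_ hf
        rw [smul_eq_mul, X.basicOpen_mul]
        exact inf_le_right }
  have h1 : Ideal.span (I : Set Γ(X, W)) = ⊤ := by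
    rw [← hW.self_le_iSup_basicOpen_iff]
    intro x hx
    obtain ⟨V, hV, hxV, hP⟩ := hloc x hx
    obtain ⟨f, hf, hxf⟩ := hW.exists_basicOpen_le (V := V) ⟨x, hxV⟩ hx
    have h2 : X.basicOpen f ≤ ⨆ i : (I : Set Γ(X, W)), X.basicOpen i.1 :=
      le_iSup (fun i : (I : Set Γ(X, W)) => X.basicOpen i.1) ⟨f, hP _ hf⟩
    exact h2 hxf
  rw [Ideal.span_eq] at h1
  have h2 : (1 : Γ(X, W)) ∈ I := h1 ▸ Submodule.mem_top
  change P (X.basicOpen 1) at h2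
  rwa [X.basicOpen_one] at h2

end Pairs

section AffineComparison

variable {X : Scheme.{u}} [HasDerivedCategory.{u + 1} X.Modules] {E E' : DerivedCategory X.Modules}

/-- Derived sections on affine opens are sections of the zeroth cohomology sheaf. -/
def B0 (E : DerivedCategory X.Modules) : Prop :=
  ∀ W : X.Opens, IsAffineOpen W → Function.Bijective (sg W E)

/-- Derived sections on the intersection of two principal opens are sums of restrictions. -/
def Dec (E : DerivedCategory X.Modules) : Prop :=
  ∀ Y Z : X.Opens, Pair Y Z → ∀ η : OD (Y ⊓ Z) ⟶ E, ∃ (y : OD Y ⟶ E) (z : OD Z ⟶ E),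
    η = dle inf_le_left _ ≫ y + dle inf_le_right _ ≫ z

lemma loc_dec {F : X.Modules} (hF : F.IsQuasicoherent) {Y Z : X.Opens} (h : Pair Y Z)
    (s : Γ(F, Y ⊓ Z)) :
    ∃ (y : Γ(F, Y)) (z : Γ(F, Z)), s = rs F inf_le_left y + rs F inf_le_right z := by
  obtain ⟨f, g, hf, hg, hc⟩ := h.exists_comb
  have key : ∀ {Y Z W : X.Opens} (hY : Y ≤ W) (hZ : Z ≤ W) (g : Γ(X, W)) (_ : X.basicOpen g = Z)
      (_ : IsAffineOpen Y) (s : Γ(F, Y ⊓ Z)), ∃ (n : ℕ) (y : Γ(F, Y)),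
        rs F inf_le_left y = ors ((inf_le_left : Y ⊓ Z ≤ Y).trans hY) g ^ n • s := by
    intro Y Z W hY hZ g hg hYa s
    have e : Y ⊓ Z = X.basicOpen (ors hY g) := by rw [basicOpen_ors, hg]
    obtain ⟨n, y, hy⟩ := ((loc_iff _ _).1 (loc_of_isQuasicoherent hF hYa (ors hY g))).2
      (rs F e.ge s)
    refine ⟨n, y, (rs_bij_of_eq e.symm F).1 ?_⟩
    rw [rs_rs, hy, rs_smul, map_pow, ors_ors, ors_ors]
  obtain ⟨m, y, hy⟩ := key (le_sup_left : Y ≤ Y ⊔ Z) le_sup_right g hg h.left s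
  obtain ⟨n, z, hz⟩ := key (le_sup_right : Z ≤ Y ⊔ Z) le_sup_left f hf h.right
    (rs F (inf_comm Y Z).ge s)
  obtain ⟨a, b, hab⟩ := hc n m
  refine ⟨ors le_sup_left b • y, ors le_sup_right a • z, ?_⟩
  have hz' := congrArg (rs F (inf_comm Y Z).le) hz
  rw [rs_rs, rs_smul, map_pow, ors_ors, rs_rs, rs_self] at hz'
  rw [rs_smul, rs_smul, hy, hz', ors_ors, ors_ors, smul_smul, smul_smul, ← add_smul, ← map_pow,
    ← map_pow, ← map_mul, ← map_mul, ← map_add, add_comm, hab, map_one, one_smul]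

lemma dec_of_B0 (h : B0 E) (hq : (H0 E).IsQuasicoherent) : Dec E := by
  intro Y Z hp η
  obtain ⟨y, z, hyz⟩ := loc_dec hq hp (sg _ _ η)
  obtain ⟨y, rfl⟩ := (h Y hp.left).2 y
  obtain ⟨z, rfl⟩ := (h Z hp.right).2 z
  refine ⟨y, z, (h _ hp.inter).1 ?_⟩
  rw [hyz, map_add, sg_dle, sg_dle]

lemma J_bot_id : 𝟙 (J (⊥ : X.Opens)) = 0 := by
  ext F : 2
  refine J_hom_ext fun W hW s => sec_ext fun x hx => absurd (hW hx) (by simp)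

lemma DJ_bot (N : DerivedCategory X.Modules) : 𝟙 ((DJ (⊥ : X.Opens)).obj N) = 0 := by
  rw [← NatTrans.id_app, ← dnat_id, J_bot_id, dnat_zero]
  rfl

lemma DJ_bot_hom {N E : DerivedCategory X.Modules} (φ : (DJ (⊥ : X.Opens)).obj N ⟶ E) : φ = 0 := by
  rw [← Category.id_comp φ, DJ_bot, zero_comp]

lemma eq_zero_of_dec (h : Dec E) {W : X.Opens} (hW : IsAffineOpen W) {ξ : OD W ⟶ E⟦(1 : ℤ)⟧}
    (hξ : ∀ x ∈ W, ∃ (V : X.Opens) (hV : V ≤ W), x ∈ V ∧ dle hV _ ≫ ξ = 0) : ξ = 0 := by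
  have h1 : ∀ hWW : W ≤ W, dle hWW _ ≫ ξ = 0 := by
    refine affine_induction hW (fun Y => ∀ hY : Y ≤ W, dle hY _ ≫ ξ = 0)
      (fun _ => DJ_bot_hom _) ?_ ?_ ?_
    · intro Y Y' hY hY' hP hY''
      rw [← dle_dle hY' hY, Category.assoc, hP hY, comp_zero]
    · intro Y Z hle hp hY hZ hle'
      have hY' := hY (le_sup_left.trans hle)
      have hZ' := hZ (le_sup_right.trans hle)
      obtain ⟨w, hw⟩ := (mv Y Z (SX X)).desc (dle hle _ ≫ ξ)
        (by rw [← Category.assoc, dle_dle, hY']) (by rw [← Category.assoc, dle_dle, hZ'])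
      obtain ⟨η, rfl⟩ := (shiftFunctor (DerivedCategory X.Modules) (1 : ℤ)).map_surjective w
      obtain ⟨y, z, rfl⟩ := h Y Z hp η
      rw [hw, Functor.map_add, Functor.map_comp, Functor.map_comp, Preadditive.comp_add,
        ← Category.assoc, (mv Y Z (SX X)).d_left, ← Category.assoc, (mv Y Z (SX X)).d_right,
        zero_comp, zero_comp, add_zero]
    · intro x hx
      obtain ⟨V, hV, hxV, h0⟩ := hξ x hx
      refine ⟨V, hV, hxV, fun Y hYV hYW => ?_⟩
      rw [← dle_dle hYV hV, Category.assoc, h0, comp_zero]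
  rw [← h1 le_rfl, dle_self, Category.id_comp]

lemma B0_of_dec (h : Dec E) : B0 (E⟦(1 : ℤ)⟧) := by
  have hinj : ∀ W : X.Opens, IsAffineOpen W → Function.Injective (sg W (E⟦(1 : ℤ)⟧)) := by
    intro W hW
    refine (injective_iff_map_eq_zero _).2 fun ξ hξ => eq_zero_of_dec h hW fun x hx => ?_
    exact sg_eq_zero hξ hx
  refine fun W hW => ⟨hinj W hW, fun s => ?_⟩
  have h1 : ∀ hWW : W ≤ W, ∃ ξ, sg W _ ξ = rs _ hWW s := by
    refine affine_induction hW (fun Y => ∀ hY : Y ≤ W, ∃ ξ, sg Y _ ξ = rs _ hY s) ?_ ?_ ?_ ?_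
    · exact fun _ => ⟨0, sec_ext fun x hx => absurd hx (by simp)⟩
    · intro Y Y' hY hY' hP hY''
      obtain ⟨ξ, hξ⟩ := hP hY
      exact ⟨dle hY' _ ≫ ξ, by rw [sg_dle, hξ, rs_rs]⟩
    · intro Y Z hle hp hY hZ _
      obtain ⟨y, hy⟩ := hY (le_sup_left.trans hle)
      obtain ⟨z, hz⟩ := hZ (le_sup_right.trans hle)
      obtain ⟨ξ, hξy, hξz⟩ := (mv Y Z (SX X)).glue y z
        (hinj _ hp.inter (by rw [sg_dle, sg_dle, hy, hz, rs_rs, rs_rs]))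
      refine ⟨ξ, sec_ext fun x hx => ?_⟩
      obtain hx | hx := (Opens.mem_sup).1 hx
      · exact ⟨Y, le_sup_left, hx, by rw [← sg_dle, hξy, hy, rs_rs]⟩
      · exact ⟨Z, le_sup_right, hx, by rw [← sg_dle, hξz, hz, rs_rs]⟩
    · intro x hx
      obtain ⟨V, hV, hxV, ξ, hξ⟩ := sg_lift s hx
      exact ⟨V, hV, hxV, fun Y hYV hYW => ⟨dle hYV _ ≫ ξ, by rw [sg_dle, hξ, rs_rs]⟩⟩
  obtain ⟨ξ, hξ⟩ := h1 le_rfl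
  exact ⟨ξ, by rw [hξ, rs_self]⟩

end AffineComparison

section Products

variable {C : Type u} [Category.{v} C] [Abelian C] {ι : Type} [HasProductsOfShape ι C]

/-- The degreewise product of complexes. -/
def prodCx (K : ι → CochainComplex C ℤ) : CochainComplex C ℤ where
  X i := ∏ᶜ fun n => (K n).X i
  d i j := Limits.Pi.map fun n => (K n).d i j
  shape i j h := by
    ext n
    simp [(K n).shape i j h]
  d_comp_d' i j k _ _ := by
    ext n
    simp

/-- The projections of the degreewise product. -/
def prodCxπ (K : ι → CochainComplex C ℤ) (n : ι) : prodCx K ⟶ K n where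
  f i := Limits.Pi.π (fun n => (K n).X i) n
  comm' i j _ := by simp [prodCx]

/-- Morphisms to the degreewise product. -/
def prodCxLift (K : ι → CochainComplex C ℤ) {A : CochainComplex C ℤ} (f : ∀ n, A ⟶ K n) :
    A ⟶ prodCx K where
  f i := Limits.Pi.lift fun n => (f n).f i
  comm' i j _ := by
    refine Pi.hom_ext _ _ fun n => ?_
    simp [prodCx]

lemma prodCxLift_π (K : ι → CochainComplex C ℤ) {A : CochainComplex C ℤ} (f : ∀ n, A ⟶ K n)
    (n : ι) : prodCxLift K f ≫ prodCxπ K n = f n := by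
  ext i
  exact Limits.Pi.lift_π _ _

lemma prodCx_hom_ext (K : ι → CochainComplex C ℤ) {T : C} {j : ℤ} {a b : T ⟶ (prodCx K).X j}
    (h : ∀ n, a ≫ (prodCxπ K n).f j = b ≫ (prodCxπ K n).f j) : a = b :=
  Limits.Pi.hom_ext _ _ h

lemma prodCx_homotopy (K : ι → CochainComplex C ℤ) {A : CochainComplex C ℤ} (f : A ⟶ prodCx K)
    (h : ∀ n, Nonempty (Homotopy (f ≫ prodCxπ K n) 0)) : Nonempty (Homotopy f 0) := by
  let h n := (h n).some
  let g (i j : ℤ) : A.X i ⟶ (prodCx K).X j := Limits.Pi.lift fun n => (h n).hom i j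
  have hg (n : ι) (i j : ℤ) : g i j ≫ (prodCxπ K n).f j = (h n).hom i j := Limits.Pi.lift_π _ _
  refine ⟨⟨g, fun i j hij => ?_, fun i => ?_⟩⟩
  · refine prodCx_hom_ext K fun n => ?_
    rw [hg, (h n).zero i j hij, zero_comp]
  · refine prodCx_hom_ext K fun n => ?_
    have := (h n).comm i
    rw [dNext_eq _ (show (ComplexShape.up ℤ).Rel i (i + 1) by simp),
      prevD_eq _ (show (ComplexShape.up ℤ).Rel (i - 1) i by simp)] at this ⊢
    simp only [HomologicalComplex.comp_f, HomologicalComplex.zero_f, add_zero] at this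
    rw [this, Preadditive.add_comp, Preadditive.add_comp, Category.assoc, Category.assoc, hg,
      ← (prodCxπ K n).comm, ← Category.assoc (g _ _), hg, HomologicalComplex.zero_f, zero_comp,
      add_zero]

instance (K : ι → CochainComplex C ℤ) [∀ n, (K n).IsKInjective] : (prodCx K).IsKInjective where
  nonempty_homotopy_zero f hA := prodCx_homotopy K f fun n =>
    CochainComplex.IsKInjective.nonempty_homotopy_zero _ hA

variable [HasDerivedCategory.{w} C]

lemma Q_map_surjective (A K : CochainComplex C ℤ) [K.IsKInjective] (f : Q.obj A ⟶ Q.obj K) :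
    ∃ g : A ⟶ K, Q.map g = f := by
  obtain ⟨g, rfl⟩ := (CochainComplex.IsKInjective.Qh_map_bijective
    ((HomotopyCategory.quotient _ _).obj A) K).2 f
  obtain ⟨g, rfl⟩ := (HomotopyCategory.quotient _ _).map_surjective g
  exact ⟨g, rfl⟩

lemma homotopy_of_Q_map_eq_zero (A K : CochainComplex C ℤ) [K.IsKInjective] (f : A ⟶ K)
    (h : Q.map f = 0) : Nonempty (Homotopy f 0) := by
  refine ⟨HomotopyCategory.homotopyOfEq _ _ ((CochainComplex.IsKInjective.Qh_map_bijective
    ((HomotopyCategory.quotient _ _).obj A) K).1 ?_)⟩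
  refine Eq.trans (show _ = Q.map f from rfl) (h.trans ?_)
  rw [Functor.map_zero, Functor.map_zero]
  rfl

/-- Products of objects represented by K-injective complexes. -/
lemma exists_product (E : ι → DerivedCategory C)
    (hE : ∀ n, ∃ K : CochainComplex C ℤ, K.IsKInjective ∧ Nonempty (Q.obj K ≅ E n)) :
    ∃ (P : DerivedCategory C) (π : ∀ n, P ⟶ E n),
      (∀ (A : DerivedCategory C) (f : ∀ n, A ⟶ E n), ∃ g : A ⟶ P, ∀ n, g ≫ π n = f n) ∧
      ∀ (A : DerivedCategory C) (g : A ⟶ P), (∀ n, g ≫ π n = 0) → g = 0 := by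
  choose K hK e using hE
  let e n := (e n).some
  refine ⟨Q.obj (prodCx K), fun n => Q.map (prodCxπ K n) ≫ (e n).hom, fun A f => ?_,
    fun A g hg => ?_⟩
  · obtain ⟨L, ⟨i⟩⟩ := exists_iso_Q A
    choose g hg using fun n => Q_map_surjective L (K n) (i.hom ≫ f n ≫ (e n).inv)
    refine ⟨i.inv ≫ Q.map (prodCxLift K g), fun n => ?_⟩
    rw [Category.assoc, ← Category.assoc (Q.map _), ← Q.map_comp, prodCxLift_π, hg]
    simp
  · obtain ⟨L, ⟨i⟩⟩ := exists_iso_Q A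
    obtain ⟨g', hg'⟩ := Q_map_surjective L (prodCx K) (i.hom ≫ g)
    have h1 : Nonempty (Homotopy g' 0) := prodCx_homotopy K g' fun n => by
      refine homotopy_of_Q_map_eq_zero _ _ _ ?_
      rw [Q.map_comp, hg', ← cancel_mono (e n).hom, zero_comp, Category.assoc, Category.assoc,
        hg n, comp_zero]
    have h2 : Q.map g' = 0 := (Q_map_eq_of_homotopy C h1.some).trans (Functor.map_zero _ _ _)
    rw [← cancel_epi i.hom, ← hg', h2, comp_zero]

lemma exists_injective_iso [EnoughInjectives C] (E : DerivedCategory C) (n : ℤ) [E.IsGE n] :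
    ∃ K : CochainComplex C ℤ, K.IsStrictlyGE n ∧ (∀ i, Injective (K.X i)) ∧
      Nonempty (Q.obj K ≅ E) := by
  obtain ⟨L, _, ⟨e⟩⟩ := DerivedCategory.exists_iso_Q_obj_of_isGE E n
  obtain ⟨M, hM, i, hi⟩ :=
    CochainComplex.Plus.exists_quasiIso_injective ⟨L, ⟨n, inferInstance⟩⟩ n
  have : QuasiIso i.hom := by assumption
  exact ⟨_, inferInstanceAs (CochainComplex.IsStrictlyGE
    (((InjectiveObject.ι C).mapHomologicalComplex _).obj M.obj) n),
    fun j => (M.obj.X j).property, ⟨(asIso (DerivedCategory.Q.map i.hom)).symm ≪≫ e.symm⟩⟩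

lemma exists_kinjective [EnoughInjectives C] (E : DerivedCategory C) (n : ℤ) [E.IsGE n] :
    ∃ K : CochainComplex C ℤ, K.IsKInjective ∧ Nonempty (Q.obj K ≅ E) := by
  obtain ⟨K, _, _, h⟩ := exists_injective_iso E n
  exact ⟨K, CochainComplex.isKInjective_of_injective K n, h⟩

end Products

section ShiftedHomology

variable {C : Type u} [Category.{v} C] [Abelian C] [HasDerivedCategory.{w} C]
  {E E' : DerivedCategory C}

/-- Homology of a shift. -/
def hshift (C : Type u) [Category.{v} C] [Abelian C] [HasDerivedCategory.{w} C] (k : ℤ) :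
    shiftFunctor (DerivedCategory C) k ⋙ homologyFunctor C 0 ≅ homologyFunctor C k :=
  (homologyFunctor C 0).shiftIso k 0 k (by simp)

lemma isIso_H0_shift_iff (f : E ⟶ E') (k : ℤ) :
    IsIso ((homologyFunctor C 0).map (f⟦k⟧')) ↔ IsIso ((homologyFunctor C k).map f) :=
  NatIso.isIso_map_iff (hshift C k) f

lemma isIso_of_H0 (f : E ⟶ E') (h : ∀ k : ℤ, IsIso ((homologyFunctor C 0).map (f⟦k⟧'))) :
    IsIso f :=
  by
  rw [DerivedCategory.isIso_iff]
  exact fun k => (isIso_H0_shift_iff f k).1 (h k)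

lemma isZero_H0_shift (E : DerivedCategory C) (n k : ℤ) [E.IsGE n] (h : k < n) :
    IsZero ((homologyFunctor C 0).obj (E⟦k⟧)) :=
  (E.isZero_of_isGE n k h).of_iso ((hshift C k).app E)

lemma exists_trunc_iso (E : DerivedCategory C) (n : ℤ) :
    ∃ (L G : DerivedCategory C) (i : L ⟶ E) (p : E ⟶ G) (d : G ⟶ L⟦(1 : ℤ)⟧),
      DT i p d ∧ L.IsLE (n - 1) ∧ G.IsGE n ∧
        ∀ k : ℤ, n ≤ k → IsIso ((homologyFunctor C 0).map (p⟦k⟧')) := by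
  obtain ⟨L, G, i, p, d, hT, hL, hG⟩ := exists_trunc E n
  refine ⟨L, G, i, p, d, hT, hL, hG, fun k hk => (isIso_H0_shift_iff p k).2 ?_⟩
  exact isIso_homology_mor₂ _ hT k (L.isZero_of_isLE (n - 1) _ (by lia))
    (L.isZero_of_isLE (n - 1) _ (by lia))

lemma exists_tower (E : DerivedCategory C) :
    ∃ (G : ℕ → DerivedCategory C) (p : ∀ n, E ⟶ G n) (t : ∀ n, G (n + 1) ⟶ G n),
      (∀ n, p (n + 1) ≫ t n = p n) ∧ (∀ n, (G n).IsGE (-(n : ℤ))) ∧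
      ∀ (n : ℕ) (k : ℤ), -(n : ℤ) ≤ k → IsIso ((homologyFunctor C 0).map ((p n)⟦k⟧')) := by
  choose L G i p d hT hL hG hp using fun n : ℕ => exists_trunc_iso E (-(n : ℤ))
  have h : ∀ n, ∃ t : G (n + 1) ⟶ G n, p n = p (n + 1) ≫ t := fun n =>
    (hT (n + 1)).desc₃ _ (TStructure.t.zero_of_isLE_of_isGE _ _ _ (by push_cast; lia)
      (hL (n + 1)) (hG n))
  choose t ht using h
  exact ⟨G, p, t, fun n => (ht n).symm, hG, hp⟩

lemma exists_unshift (A : DerivedCategory C) (k : ℤ) :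
    ∃ (A' : DerivedCategory C), Nonempty (A'⟦k⟧ ≅ A) :=
  ⟨_, ⟨(shiftFunctor (DerivedCategory C) k).objObjPreimageIso A⟩⟩

end ShiftedHomology

section Unbounded

variable {X : Scheme.{u}}

lemma isQuasicoherent_of_iso {F G : X.Modules} (e : F ≅ G) (h : F.IsQuasicoherent) :
    G.IsQuasicoherent := by
  rw [isQuasicoherent_iff_loc] at h ⊢
  intro W hW f
  have hi : ∀ W (s : Γ(G, W)), ap e.hom W (ap e.inv W s) = s := fun W s => by
    rw [← ap_comp, e.inv_hom_id, ap_id]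
  obtain ⟨h1, h2⟩ := (loc_iff _ _).1 (h W hW f)
  refine (loc_iff _ _).2 ⟨fun s hs => ?_, fun t => ?_⟩
  · obtain ⟨n, hn⟩ := h1 (ap e.inv W s) (by rw [← ap_rs, hs, map_zero])
    refine ⟨n, ?_⟩
    rw [← hi _ s, ← ap_smul, hn, map_zero]
  · obtain ⟨n, s, hs⟩ := h2 (ap e.inv _ t)
    exact ⟨n, ap e.hom _ s, by rw [← ap_rs, hs, ap_smul, hi]⟩

lemma isQuasicoherent_of_isZero {F : X.Modules} (h : IsZero F) : F.IsQuasicoherent := by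
  rw [isQuasicoherent_iff_loc]
  intro W hW f
  have h0 : ∀ W (s : Γ(F, W)), s = 0 := fun W s => by
    rw [← ap_id s, h.eq_of_src (𝟙 F) 0, ap_zero]
  exact (loc_iff _ _).2 ⟨fun s _ => ⟨0, by rw [h0 _ s, smul_zero]⟩,
    fun t => ⟨0, 0, by rw [h0 _ t, map_zero, smul_zero]⟩⟩

variable [HasDerivedCategory.{u + 1} X.Modules] {E E' : DerivedCategory X.Modules}

/-- Complexes with quasi-coherent cohomology. -/
def Dqc (E : DerivedCategory X.Modules) : Prop := ∀ k : ℤ, (H0 (E⟦k⟧)).IsQuasicoherent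

lemma dqc_iff : Dqc E ↔ ∀ k : ℤ, ((homologyFunctor X.Modules k).obj E).IsQuasicoherent :=
  forall_congr' fun k => ⟨isQuasicoherent_of_iso ((hshift X.Modules k).app E),
    isQuasicoherent_of_iso ((hshift X.Modules k).app E).symm⟩

lemma B0.of_iso (e : E ≅ E') (h : B0 E) : B0 E' := by
  have key : ∀ W (ξ : OD W ⟶ E'), sg W E' ξ =
      ap ((homologyFunctor X.Modules 0).map e.hom) W (sg W E (ξ ≫ e.inv)) := fun W ξ => by
    rw [← sg_comp, Category.assoc, e.inv_hom_id, Category.comp_id]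
  intro W hW
  have := (bij_of_isIso ((homologyFunctor X.Modules 0).map e.hom) W).comp ((h W hW).comp
    (show Function.Bijective (fun ξ : OD W ⟶ E' => ξ ≫ e.inv) from
      ⟨fun a b h => (cancel_mono _).1 h, fun b => ⟨b ≫ e.hom, by simp⟩⟩))
  convert this using 1
  ext1 ξ
  exact key W ξ

lemma B0_shift_of_isGE (hE : Dqc E) (n : ℤ) [E.IsGE n] (k : ℤ) : B0 (E⟦k⟧) := by
  obtain h | h := le_total k n
  · have : IsGE (E⟦k⟧) 0 :=
      have := TStructure.t.isGE_shift E n k (n - k) (by lia)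
      TStructure.t.isGE_of_ge (E⟦k⟧) 0 (n - k)
    exact fun W _ => sg_bij W _
  · induction k, h using Int.leInduction with
    | base =>
      have : IsGE (E⟦n⟧) 0 := TStructure.t.isGE_shift E n n 0 (by lia)
      exact fun W _ => sg_bij W _
    | succ k hk ih =>
      exact (B0_of_dec (dec_of_B0 ih (hE k))).of_iso
        ((shiftFunctorAdd' (DerivedCategory X.Modules) k 1 (k + 1) rfl).app E).symm

/-- Derived sections of a complex with quasi-coherent cohomology on affine opens. -/
lemma B0_shift (hE : Dqc E) (k : ℤ) : B0 (E⟦k⟧) := by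
  obtain ⟨G, p, t, hpt, hG, hp⟩ := exists_tower E
  have hGq : ∀ n, Dqc (G n) := by
    intro n k
    obtain h | h := lt_or_ge k (-(n : ℤ))
    · exact isQuasicoherent_of_isZero (isZero_H0_shift _ _ _ h)
    · have := hp n k h
      exact isQuasicoherent_of_iso (asIso ((homologyFunctor X.Modules 0).map ((p n)⟦k⟧'))) (hE k)
  have hB : ∀ (n : ℕ) (k : ℤ), B0 ((G n)⟦k⟧) := fun n k => B0_shift_of_isGE (hGq n) (-(n : ℤ)) k
  have htp : ∀ (n : ℕ) (k : ℤ), (p (n + 1))⟦k⟧' ≫ (t n)⟦k⟧' = (p n)⟦k⟧' := fun n k => by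
    rw [← Functor.map_comp, hpt]
  have ht : ∀ (n : ℕ) (k : ℤ), -(n : ℤ) ≤ k →
      IsIso ((homologyFunctor X.Modules 0).map ((t n)⟦k⟧')) := fun n k hk => by
    have hk' := hp n k hk
    have := hp (n + 1) k (by push_cast; lia)
    rw [← htp, Functor.map_comp] at hk'
    exact IsIso.of_isIso_comp_left ((homologyFunctor X.Modules 0).map ((p (n + 1))⟦k⟧')) _
  have hts : ∀ (n : ℕ) (k : ℤ) (W : X.Opens), Function.Surjective
      (ap ((homologyFunctor X.Modules 0).map ((t n)⟦k⟧')) W) := by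
    intro n k W
    obtain h | h := lt_or_ge k (-(n : ℤ))
    · intro s
      refine ⟨0, ?_⟩
      rw [map_zero, ← ap_id s, (isZero_H0_shift (G n) _ k h).eq_of_src (𝟙 _) 0, ap_zero]
    · have := ht n k h
      exact (bij_of_isIso _ W).2
  obtain ⟨P, π, hP, hP'⟩ := exists_product G fun n => exists_kinjective (G n) (-(n : ℤ))
  obtain ⟨s, hs⟩ := hP P fun n => π (n + 1) ≫ t n
  obtain ⟨R, r, δ, hT⟩ := exists_DT₂ (𝟙 P - s)
  obtain ⟨φ, hφ⟩ := hP E p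
  have hu : ∀ {A : DerivedCategory X.Modules} (x : A ⟶ P) (n : ℕ),
      (x ≫ (𝟙 P - s)) ≫ π n = x ≫ π n - (x ≫ π (n + 1)) ≫ t n := by
    intro A x n
    rw [Category.assoc, Preadditive.sub_comp, hs, Category.id_comp, Preadditive.comp_sub,
      Category.assoc]
  obtain ⟨φ', hφ'⟩ := hT.lift₁ φ (hP' _ _ fun n => by rw [hu, hφ, hφ, hpt, sub_self])
  have hφp : ∀ n, φ' ≫ r ≫ π n = p n := fun n => by rw [← Category.assoc, ← hφ', hφ]
  have hφk : ∀ n (k : ℤ), φ'⟦k⟧' ≫ (r ≫ π n)⟦k⟧' = (p n)⟦k⟧' := fun n k => by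
    rw [← Functor.map_comp, hφp]
  have hrt : ∀ n, (r ≫ π (n + 1)) ≫ t n = r ≫ π n := fun n => by
    have := hu r n
    rw [hT.comp₁₂, zero_comp] at this
    exact (sub_eq_zero.1 this.symm).symm
  have inj : ∀ (k : ℤ) (W : X.Opens) (hW : IsAffineOpen W) (ξ : OD W ⟶ R⟦k⟧),
      (∀ n, sg W _ (ξ ≫ (r ≫ π n)⟦k⟧') = 0) → ξ = 0 := by
    intro k W hW ξ hξ
    have hξ' n : ξ ≫ (r ≫ π n)⟦k⟧' = 0 := (hB n k W hW).1 ((hξ n).trans (map_zero _).symm)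
    obtain ⟨A, ⟨e⟩⟩ := exists_unshift (OD W) k
    obtain ⟨x, hx⟩ := (shiftFunctor (DerivedCategory X.Modules) k).map_surjective (e.hom ≫ ξ)
    have hxr : x ≫ r = 0 := hP' _ _ fun n =>
      (shiftFunctor (DerivedCategory X.Modules) k).map_injective (by
        rw [Functor.map_zero, Category.assoc, Functor.map_comp, hx, Category.assoc, hξ', comp_zero])
    obtain ⟨y, hy⟩ := hT.lift₃ (x⟦(1 : ℤ)⟧') (by rw [← Functor.map_comp, hxr, Functor.map_zero])
    let e' : A⟦(1 : ℤ)⟧⟦k - 1⟧ ≅ OD W :=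
      ((shiftFunctorAdd' (DerivedCategory X.Modules) 1 (k - 1) k (by lia)).app A).symm ≪≫ e
    have hlift : ∀ n (a : A⟦(1 : ℤ)⟧ ⟶ G n), ∃ b : A⟦(1 : ℤ)⟧ ⟶ G (n + 1), b ≫ t n = a := by
      intro n a
      obtain ⟨s, hs⟩ := hts n (k - 1) W (sg W _ (e'.inv ≫ a⟦k - 1⟧'))
      obtain ⟨b, hb⟩ := (hB (n + 1) (k - 1) W hW).2 s
      obtain ⟨c, hc⟩ := (shiftFunctor (DerivedCategory X.Modules) (k - 1)).map_surjective
        (e'.hom ≫ b)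
      refine ⟨c, (shiftFunctor (DerivedCategory X.Modules) (k - 1)).map_injective ?_⟩
      rw [Functor.map_comp, hc, Category.assoc, ← Iso.eq_inv_comp]
      exact (hB n (k - 1) W hW).1 (by rw [sg_comp, hb, hs])
    choose lft hlft using hlift
    let z : ∀ n, A⟦(1 : ℤ)⟧ ⟶ G n := fun n => Nat.rec 0 (fun n a => lft n (a - y ≫ π n)) n
    have hz : ∀ n, z (n + 1) ≫ t n = z n - y ≫ π n := fun n => hlft _ _
    obtain ⟨Z, hZ⟩ := hP _ z
    have hyZ : y = Z ≫ (𝟙 P - s) := sub_eq_zero.1 (hP' _ _ fun n => by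
      rw [Preadditive.sub_comp, hu, hZ, hZ, hz]
      abel)
    have hx0 : x = 0 := (shiftFunctor (DerivedCategory X.Modules) (1 : ℤ)).map_injective (by
      rw [hy, hyZ, Category.assoc, hT.comp₂₃, comp_zero, Functor.map_zero])
    rw [← cancel_epi e.hom, ← hx, hx0, Functor.map_zero, comp_zero]
  have surj : ∀ (k : ℤ) (W : X.Opens) (hW : IsAffineOpen W) (σ : Γ(H0 (E⟦k⟧), W)),
      ∃ ξ : OD W ⟶ R⟦k⟧, ∀ n, sg W _ (ξ ≫ (r ≫ π n)⟦k⟧') =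
        ap ((homologyFunctor X.Modules 0).map ((p n)⟦k⟧')) W σ := by
    intro k W hW σ
    choose g hg using fun n => (hB n k W hW).2
      (ap ((homologyFunctor X.Modules 0).map ((p n)⟦k⟧')) W σ)
    have hgt : ∀ n, g (n + 1) ≫ (t n)⟦k⟧' = g n := fun n => (hB n k W hW).1 (by
      rw [sg_comp, hg, hg, ← ap_comp, ← Functor.map_comp, htp])
    obtain ⟨A, ⟨e⟩⟩ := exists_unshift (OD W) k
    choose x hx using fun n => (shiftFunctor (DerivedCategory X.Modules) k).map_surjective
      (e.hom ≫ g n)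
    have hxt : ∀ n, x (n + 1) ≫ t n = x n := fun n =>
      (shiftFunctor (DerivedCategory X.Modules) k).map_injective (by
        rw [Functor.map_comp, hx, hx, Category.assoc, hgt])
    obtain ⟨Y, hY⟩ := hP A x
    obtain ⟨y, hy⟩ := hT.lift₁ Y (hP' _ _ fun n => by rw [hu, hY, hY, hxt, sub_self])
    refine ⟨e.inv ≫ y⟦k⟧', fun n => ?_⟩
    rw [← hg n, Category.assoc, ← Functor.map_comp, ← Category.assoc, ← hy, hY, hx,
      Iso.inv_hom_id_assoc]
  have iso : IsIso φ' := by
    refine isIso_of_H0 _ fun k => isIso_of_bij fun V => ?_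
    let N : ℕ := (-k).toNat
    have hN : -(N : ℤ) ≤ k := by lia
    have hpN := hp N k hN
    constructor
    · refine Function.Injective.of_comp (f := ap ((homologyFunctor X.Modules 0).map
        ((r ≫ π N)⟦k⟧')) V) ?_
      convert (bij_of_isIso ((homologyFunctor X.Modules 0).map ((p N)⟦k⟧')) V).1 using 1
      ext1 σ
      refine (ap_comp _ _ _).symm.trans ?_
      rw [← Functor.map_comp, hφk]
    · intro σ
      obtain ⟨ε, hε⟩ := (bij_of_isIso ((homologyFunctor X.Modules 0).map ((p N)⟦k⟧')) V).2
        (ap ((homologyFunctor X.Modules 0).map ((r ≫ π N)⟦k⟧')) V σ)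
      refine ⟨ε, sub_eq_zero.1 ?_⟩
      set τ := ap ((homologyFunctor X.Modules 0).map (φ'⟦k⟧')) V ε - σ with hτ
      let c n := ap ((homologyFunctor X.Modules 0).map ((r ≫ π n)⟦k⟧')) V τ
      have hct : ∀ n, ap ((homologyFunctor X.Modules 0).map ((t n)⟦k⟧')) V (c (n + 1)) = c n := by
        intro n
        rw [← ap_comp, ← Functor.map_comp, ← Functor.map_comp, hrt]
      have hcN : c N = 0 := by
        change ap _ V (_ - _) = 0
        rw [map_sub, ← ap_comp, ← Functor.map_comp, hφk, hε, sub_self]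
      have hc : ∀ n, c n = 0 := by
        intro n
        obtain h | h := le_total n N
        · induction h using Nat.decreasingInduction with
          | of_succ n hn ih => rw [← hct, ih, map_zero]
          | self => exact hcN
        · induction n, h using Nat.le_induction with
          | base => exact hcN
          | succ n hn ih =>
            have := ht n k (by lia)
            refine (bij_of_isIso ((homologyFunctor X.Modules 0).map ((t n)⟦k⟧')) V).1 ?_
            rw [hct, ih, map_zero]
      refine sec_ext fun x hx => ?_
      obtain ⟨V', hV', hxV', ξ, hξ⟩ := sg_lift τ hx
      obtain ⟨W, hW, hxW, hWV⟩ := (Opens.isBasis_iff_nbhd.1 X.isBasis_affineOpens) hxV'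
      refine ⟨W, hWV.trans hV', hxW, ?_⟩
      have h1 : dle hWV _ ≫ ξ = 0 := inj k W hW _ fun n => by
        rw [Category.assoc, sg_dle, sg_comp, hξ, ap_rs]
        change rs _ _ (rs _ _ (c n)) = 0
        rw [hc, map_zero, map_zero]
      rw [map_zero, ← rs_rs hWV hV', ← hξ, ← sg_dle, h1, map_zero]
  let N : ℕ := (-k).toNat
  have hpN := hp N k (by lia)
  have hinv : ∀ n, (inv φ')⟦k⟧' ≫ (p n)⟦k⟧' = (r ≫ π n)⟦k⟧' := fun n => by
    rw [← Functor.map_comp, (IsIso.inv_comp_eq φ').2 (hφp n).symm]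
  intro W hW
  constructor
  · refine (injective_iff_map_eq_zero _).2 fun ξ hξ => ?_
    have := inj k W hW (ξ ≫ φ'⟦k⟧') fun n => by
      rw [Category.assoc, hφk, sg_comp, hξ, map_zero]
    rwa [← cancel_mono (φ'⟦k⟧'), zero_comp]
  · intro σ
    obtain ⟨ξ, hξ⟩ := surj k W hW σ
    refine ⟨ξ ≫ (inv φ')⟦k⟧',
      (bij_of_isIso ((homologyFunctor X.Modules 0).map ((p N)⟦k⟧')) W).1 ?_⟩
    rw [← hξ, ← sg_comp, Category.assoc, hinv]

end Unbounded

section TriangulatedClasses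

variable {D : Type*} [Category* D] [HasZeroObject D] [HasShift D ℤ] [Preadditive D]
  [∀ n : ℤ, (shiftFunctor D n).Additive] [Pretriangulated D]

/-- A class of objects closed under isomorphisms, shifts and extensions. -/
structure TriClass (P : D → Prop) : Prop where
  zero : ∀ {A : D}, IsZero A → P A
  iso : ∀ {A B : D}, (A ≅ B) → P A → P B
  shift : ∀ {A : D}, P A → ∀ k : ℤ, P (A⟦k⟧)
  ext : ∀ {A B E : D} {f : A ⟶ B} {g : B ⟶ E} {h : E ⟶ A⟦(1 : ℤ)⟧}, DT f g h → P A → P E → P B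

variable {P : D → Prop} {A B E : D} {f : A ⟶ B} {g : B ⟶ E} {h : E ⟶ A⟦(1 : ℤ)⟧}

lemma TriClass.unshift (hP : TriClass P) (k : ℤ) (hA : P (A⟦k⟧)) : P A :=
  hP.iso ((shiftEquiv D k).unitIso.app A).symm (hP.shift hA (-k))

lemma TriClass.ext₃ (hP : TriClass P) (hT : DT f g h) (hA : P A) (hB : P B) : P E :=
  hP.ext hT.rot hB (hP.shift hA 1)

lemma TriClass.ext₁ (hP : TriClass P) (hT : DT f g h) (hB : P B) (hE : P E) : P A :=
  hP.unshift 1 (hP.ext₃ hT.rot hB hE)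

lemma TriClass.forall {ι : Sort*} {P : ι → D → Prop} (h : ∀ i, TriClass (P i)) :
    TriClass (fun A => ∀ i, P i A) where
  zero hA i := (h i).zero hA
  iso e hA i := (h i).iso e (hA i)
  shift hA k i := (h i).shift (hA i) k
  ext hT hA hE i := (h i).ext hT (hA i) (hE i)

/-- The triangulated class generated by a class of objects. -/
def Gen (G : D → Prop) (N : D) : Prop := ∀ P : D → Prop, TriClass P → (∀ A, G A → P A) → P N

lemma gen_tri (G : D → Prop) : TriClass (Gen G) where
  zero hA _ hP _ := hP.zero hA
  iso e hA P hP h := hP.iso e (hA P hP h)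
  shift hA k P hP h := hP.shift (hA P hP h) k
  ext hT hA hE P hP h := hP.ext hT (hA P hP h) (hE P hP h)

lemma Gen.of {G : D → Prop} {N : D} (h : G N) : Gen G N := fun _ _ H => H _ h

lemma Gen.mono {G G' : D → Prop} (h : ∀ A, G A → Gen G' A) {N : D} (hN : Gen G N) : Gen G' N :=
  hN _ (gen_tri G') h

lemma TriClass.of_shifts {Q : D → Prop} (hz : ∀ {A : D}, IsZero A → Q A)
    (hi : ∀ {A B : D}, (A ≅ B) → Q A → Q B)
    (h5 : ∀ {Z A B E A' : D} {e : Z ⟶ A} {f : A ⟶ B} {g : B ⟶ E} {h : E ⟶ A'},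
      (∃ x, DT e f x) → (∃ x, DT f g x) → (∃ x, DT g h x) → Q Z → Q A → Q E → Q A' → Q B) :
    TriClass (fun A : D => ∀ k : ℤ, Q (A⟦k⟧)) where
  zero hA k := hz (Functor.map_isZero _ hA)
  iso e hA k := hi ((shiftFunctor D k).mapIso e) (hA k)
  shift {A} hA l k := hi ((shiftFunctorAdd D l k).app A) (hA (l + k))
  ext {A B E f g h} hT hA hE k := by
    have hT' := Triangle.shift_distinguished _ hT k
    let T' := (Triangle.shiftFunctor D k).obj (Triangle.mk f g h)
    have h1 := inv_rot_of_distTriang _ hT'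
    have h3 := rot_of_distTriang _ hT'
    refine h5 (e := T'.invRotate.mor₁) (f := T'.mor₁) (g := T'.mor₂) (h := T'.mor₃)
      ⟨T'.invRotate.mor₃, h1⟩ ⟨_, hT'⟩ ⟨_, h3⟩ ?_ (hA k) (hE k) ?_
    · exact hi ((shiftFunctorAdd D k (-1)).app E) (hE _)
    · exact hi ((shiftFunctorAdd D k 1).app A) (hA _)

/-- Localization of the groups of morphisms from `A` to `E`. -/
def HLoc {A A' : D} (a : A ⟶ A) (a' : A' ⟶ A') (ρ : A' ⟶ A) (E : D) : Prop :=
  IsLocMap (Preadditive.leftComp E a) (Preadditive.leftComp E a') (Preadditive.leftComp E ρ)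

lemma IsLocMap.congr {A B A' B' : Type*} [AddCommGroup A] [AddCommGroup B] [AddCommGroup A']
    [AddCommGroup B'] {f : A →+ A} {g : B →+ B} {ρ : A →+ B} {f' : A' →+ A'} {g' : B' →+ B'}
    {ρ' : A' →+ B'} (p : A →+ A') (q : B →+ B') (hp : Function.Bijective p)
    (hq : Function.Bijective q) (hf : ∀ x, p (f x) = f' (p x)) (hg : ∀ x, q (g x) = g' (q x))
    (hr : ∀ x, q (ρ x) = ρ' (p x)) : IsLocMap f g ρ ↔ IsLocMap f' g' ρ' := by
  constructor
  · intro H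
    refine ⟨fun a => ?_, fun a ha => ?_, fun b => ?_⟩
    · obtain ⟨a, rfl⟩ := hp.2 a
      rw [← hr, ← hg, ← H.comm, hr, hf]
    · obtain ⟨a, rfl⟩ := hp.2 a
      obtain ⟨n, hn⟩ := H.inj a (hq.1 (by rw [hr, ha, map_zero]))
      exact ⟨n, by rw [← iterate_comm hf, hn, map_zero]⟩
    · obtain ⟨b, rfl⟩ := hq.2 b
      obtain ⟨n, a, ha⟩ := H.surj b
      exact ⟨n, p a, by rw [← hr, ha, iterate_comm hg]⟩
  · intro H
    refine ⟨fun a => hq.1 ?_, fun a ha => ?_, fun b => ?_⟩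
    · rw [hr, hg, hr, hf, H.comm]
    · obtain ⟨n, hn⟩ := H.inj (p a) (by rw [← hr, ha, map_zero])
      exact ⟨n, hp.1 (by rw [iterate_comm hf, hn, map_zero])⟩
    · obtain ⟨n, a, ha⟩ := H.surj (q b)
      obtain ⟨a, rfl⟩ := hp.2 a
      exact ⟨n, a, hq.1 (by rw [hr, ha, iterate_comm hg])⟩

lemma comp_bijective {A B E : D} (ρ : A ⟶ B) [IsIso ρ] :
    Function.Bijective (Preadditive.leftComp E ρ) :=
  ⟨fun x y h => (cancel_epi ρ).1 h, fun y => ⟨inv ρ ≫ y, IsIso.hom_inv_id_assoc ρ y⟩⟩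

lemma bijective_comp {A B E : D} (ρ : A ⟶ B) [IsIso ρ] :
    Function.Bijective (Preadditive.rightComp E ρ) :=
  ⟨fun x y h => (cancel_mono ρ).1 h, fun y => ⟨y ≫ inv ρ, (Category.assoc _ _ _).trans (by rw [IsIso.inv_hom_id, Category.comp_id])⟩⟩

lemma hLoc_iso {A A' : D} {a : A ⟶ A} {a' : A' ⟶ A'} {ρ : A' ⟶ A} {E E' : D} (e : E ≅ E') :
    HLoc a a' ρ E ↔ HLoc a a' ρ E' :=
  IsLocMap.congr (Preadditive.rightComp A e.hom) (Preadditive.rightComp A' e.hom)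
    (bijective_comp _) (bijective_comp _) (fun _ => Category.assoc _ _ _)
    (fun _ => Category.assoc _ _ _) (fun _ => Category.assoc _ _ _)

lemma hLoc_tri {A A' : D} {a : A ⟶ A} {a' : A' ⟶ A'} {ρ : A' ⟶ A} (hc : ρ ≫ a = a' ≫ ρ) :
    TriClass (fun E : D => ∀ k : ℤ, HLoc a a' ρ (E⟦k⟧)) := by
  refine TriClass.of_shifts ?_ (fun e => (hLoc_iso e).1) ?_
  · intro E hE
    refine ⟨fun _ => hE.eq_of_tgt _ _, fun _ _ => ⟨0, hE.eq_of_tgt _ _⟩, fun _ => ⟨0, 0, hE.eq_of_tgt _ _⟩⟩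
  · rintro Z A₁ B₁ E₁ A₁' e f g h ⟨x, hx⟩ ⟨y, hy⟩ ⟨z, hz⟩ q0 q1 q3 q4
    have comm : ∀ (E : D) (ξ : A ⟶ E), ρ ≫ a ≫ ξ = a' ≫ ρ ≫ ξ := fun E ξ => by
      rw [← Category.assoc, hc, Category.assoc]
    have ex : ∀ {W E₀ E₁ E₂ : D} {p : E₀ ⟶ E₁} {q : E₁ ⟶ E₂}, (∃ r, DT p q r) → ∀ s : W ⟶ E₁,
        s ≫ q = 0 ↔ ∃ t : W ⟶ E₀, t ≫ p = s := by
      rintro W E₀ E₁ E₂ p q ⟨r, hr⟩ s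
      refine ⟨fun hs => (hr.lift₁ s hs).imp fun t ht => ht.symm, ?_⟩
      rintro ⟨t, rfl⟩
      rw [Category.assoc, hr.comp₁₂, comp_zero]
    let O : Fin 5 → D := ![Z, A₁, B₁, E₁, A₁']
    exact IsLocMap.five (A := fun i => (A ⟶ O i)) (B := fun i => (A' ⟶ O i))
      (f := fun i => Preadditive.leftComp (O i) a) (g := fun i => Preadditive.leftComp (O i) a')
      (ρ := fun i => Preadditive.leftComp (O i) ρ) (fun i ξ => comm _ ξ)
      (Preadditive.rightComp A e) (Preadditive.rightComp A f) (Preadditive.rightComp A g)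
      (Preadditive.rightComp A h) (Preadditive.rightComp A' e) (Preadditive.rightComp A' f)
      (Preadditive.rightComp A' g) (Preadditive.rightComp A' h)
      (ex ⟨x, hx⟩) (ex ⟨y, hy⟩) (ex ⟨z, hz⟩) (ex ⟨x, hx⟩) (ex ⟨y, hy⟩) (ex ⟨z, hz⟩)
      (fun _ => Category.assoc _ _ _) (fun _ => Category.assoc _ _ _)
      (fun _ => Category.assoc _ _ _) (fun _ => Category.assoc _ _ _)
      (fun _ => Category.assoc _ _ _) (fun _ => Category.assoc _ _ _)
      (fun _ => Category.assoc _ _ _) (fun _ => Category.assoc _ _ _)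
      (fun _ => Category.assoc _ _ _) (fun _ => Category.assoc _ _ _)
      (fun _ => Category.assoc _ _ _) q0.surj q1 q3 q4.inj

end TriangulatedClasses

section QuasicoherentClass

variable {X : Scheme.{u}} [HasDerivedCategory.{u + 1} X.Modules]
variable {Y Z W V : X.Opens} {M N E E' : DerivedCategory X.Modules}

/-- Morphisms out of the restriction of `N` to a basic open are a localization. -/
def RLoc (f : Γ(X, W)) (N E : DerivedCategory X.Modules) : Prop :=
  HLoc (dmul f N) (dmul (ors (X.basicOpen_le f) f) N) (dle (X.basicOpen_le f) N) E

lemma dmul_iterate (f : Γ(X, W)) (n : ℕ) (ξ : (DJ W).obj N ⟶ E) :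
    (Preadditive.leftComp E (dmul f N))^[n] ξ = dmul (f ^ n) N ≫ ξ := by
  induction n with
  | zero => rw [pow_zero, dmul_one, Category.id_comp]; rfl
  | succ n ih =>
    rw [Function.iterate_succ_apply', ih, pow_succ', ← dmul_dmul, Category.assoc]; rfl

lemma rloc_iff (f : Γ(X, W)) : RLoc f N E ↔
    (∀ ξ : (DJ W).obj N ⟶ E, dle (X.basicOpen_le f) N ≫ ξ = 0 → ∃ n : ℕ, dmul (f ^ n) N ≫ ξ = 0) ∧
    ∀ η : (DJ (X.basicOpen f)).obj N ⟶ E, ∃ (n : ℕ) (ξ : (DJ W).obj N ⟶ E),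
      dle (X.basicOpen_le f) N ≫ ξ = dmul (ors (X.basicOpen_le f) f ^ n) N ≫ η := by
  constructor
  · intro H
    refine ⟨fun ξ hξ => ?_, fun η => ?_⟩
    · obtain ⟨n, hn⟩ := H.inj ξ hξ
      exact ⟨n, by rw [← dmul_iterate, hn]⟩
    · obtain ⟨n, ξ, h⟩ := H.surj η
      exact ⟨n, ξ, by rw [← dmul_iterate]; exact h⟩
  · rintro ⟨h1, h2⟩
    refine ⟨fun ξ => ?_, fun ξ hξ => ?_, fun η => ?_⟩
    · change dle _ _ ≫ dmul _ _ ≫ ξ = dmul _ _ ≫ dle _ _ ≫ ξ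
      rw [← Category.assoc, dle_dmul, Category.assoc]
    · obtain ⟨n, hn⟩ := h1 ξ hξ
      exact ⟨n, by rw [dmul_iterate, hn]⟩
    · obtain ⟨n, ξ, h⟩ := h2 η
      exact ⟨n, ξ, by rw [dmul_iterate]; exact h⟩

lemma rloc_congr (f : Γ(X, W)) (hW : Function.Bijective (sg W E))
    (hY : Function.Bijective (sg (X.basicOpen f) E)) :
    RLoc f (SX X) E ↔ Loc (H0 E) (X.basicOpen_le f) f :=
  IsLocMap.congr (sg W E) (sg (X.basicOpen f) E) hW hY (sg_dmul _) (sg_dmul _) (sg_dle _)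

lemma dec_of_rloc (h : ∀ (W : X.Opens) (_ : IsAffineOpen W) (f : Γ(X, W)), RLoc f (SX X) E) :
    Dec E := by
  intro Y Z hp s
  obtain ⟨f, g, hf, hg, hc⟩ := hp.exists_comb
  have key : ∀ {Y Z W : X.Opens} (hY : Y ≤ W) (hZ : Z ≤ W) (g : Γ(X, W)) (_ : X.basicOpen g = Z)
      (_ : IsAffineOpen Y) (s : OD (Y ⊓ Z) ⟶ E), ∃ (n : ℕ) (y : OD Y ⟶ E),
        dle inf_le_left _ ≫ y =
          dmul (ors ((inf_le_left : Y ⊓ Z ≤ Y).trans hY) g ^ n) _ ≫ s := by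
    intro Y Z W hY hZ g hg hYa s
    have e : Y ⊓ Z = X.basicOpen (ors hY g) := by rw [basicOpen_ors, hg]
    obtain ⟨n, y, hy⟩ := ((rloc_iff _).1 (h Y hYa (ors hY g))).2 (dle e.ge _ ≫ s)
    refine ⟨n, y, ?_⟩
    rw [← dle_dle e.le (X.basicOpen_le _), Category.assoc, hy, ← Category.assoc, dle_dmul,
      Category.assoc, ← Category.assoc (dle _ _) (dle _ _), dle_dle, dle_self, Category.id_comp,
      map_pow, ors_ors, ors_ors]
  obtain ⟨m, y, hy⟩ := key (le_sup_left : Y ≤ Y ⊔ Z) le_sup_right g hg hp.left s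
  obtain ⟨n, z, hz⟩ := key (le_sup_right : Z ≤ Y ⊔ Z) le_sup_left f hf hp.right
    (dle (inf_comm Y Z).ge _ ≫ s)
  obtain ⟨a, b, hab⟩ := hc n m
  refine ⟨dmul (ors le_sup_left b) _ ≫ y, dmul (ors le_sup_right a) _ ≫ z, ?_⟩
  have hz' := congrArg (dle (inf_comm Y Z).le _ ≫ ·) hz
  simp only [← Category.assoc, dle_dle, dle_dmul] at hz'
  rw [Category.assoc (dmul _ _), dle_dle, dle_self, Category.comp_id, map_pow, ors_ors] at hz'
  rw [← Category.assoc, ← Category.assoc, dle_dmul, dle_dmul, Category.assoc, Category.assoc, hy,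
    hz', ors_ors, ors_ors, ← Category.assoc, ← Category.assoc, dmul_dmul, dmul_dmul,
    ← Preadditive.add_comp, ← dmul_add, ← map_pow,
    ← map_pow, ← map_mul, ← map_mul, ← map_add, add_comm, hab, map_one, dmul_one, Category.id_comp]

lemma dqc_iff_rloc : Dqc E ↔
    ∀ (W : X.Opens) (_ : IsAffineOpen W) (f : Γ(X, W)) (k : ℤ), RLoc f (SX X) (E⟦k⟧) := by
  constructor
  · intro h W hW f k
    refine (rloc_congr f (B0_shift h k W hW) (B0_shift h k _ (hW.basicOpen f))).2 ?_
    exact loc_of_isQuasicoherent (h k) hW f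
  · intro h k
    have hB : B0 (E⟦k⟧) := (B0_of_dec (E := E⟦k - 1⟧)
      (dec_of_rloc fun W hW f => h W hW f _)).of_iso
        ((shiftFunctorAdd' (DerivedCategory X.Modules) (k - 1) 1 k (by lia)).app E).symm
    rw [isQuasicoherent_iff_loc]
    exact fun W hW f => (rloc_congr f (hB W hW) (hB _ (hW.basicOpen f))).1 (h W hW f k)

lemma dqc_tri : TriClass (Dqc (X := X)) := by
  have : Dqc (X := X) = fun E => ∀ i : Σ W : X.affineOpens, Γ(X, W.1), ∀ k : ℤ,
      RLoc i.2 (SX X) (E⟦k⟧) := by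
    ext E
    rw [dqc_iff_rloc]
    exact ⟨fun h i k => h i.1.1 i.1.2 i.2 k, fun h W hW f k => h ⟨⟨W, hW⟩, f⟩ k⟩
  rw [this]
  exact TriClass.forall fun i => hLoc_tri (dle_dmul _ _ _)

end QuasicoherentClass

section ShiftCompatibility

variable {C : Type u} [Category.{v} C] [Abelian C] [HasDerivedCategory.{w} C]
  {G G₁ G₂ : C ⥤ C}
  [G.Additive] [PreservesFiniteLimits G] [PreservesFiniteColimits G]
  [G₁.Additive] [PreservesFiniteLimits G₁] [PreservesFiniteColimits G₁]
  [G₂.Additive] [PreservesFiniteLimits G₂] [PreservesFiniteColimits G₂]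

/-- The commutation of the derived functor of an exact functor with shifts. -/
abbrev dsh (G : C ⥤ C) [G.Additive] [PreservesFiniteLimits G] [PreservesFiniteColimits G]
    (k : ℤ) (N : DerivedCategory C) : (DF G).obj (N⟦k⟧) ≅ ((DF G).obj N)⟦k⟧ :=
  ((DF G).commShiftIso k).app N

lemma dsh_nat {M N : DerivedCategory C} (k : ℤ) (φ : M ⟶ N) :
    (DF G).map (φ⟦k⟧') ≫ (dsh G k N).hom = (dsh G k M).hom ≫ ((DF G).map φ)⟦k⟧' :=
  ((DF G).commShiftIso k).hom.naturality φ

lemma dfac_shift (K : CochainComplex C ℤ) (k : ℤ) :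
    (DF G).map ((Q.commShiftIso k).hom.app K) ≫ (dsh G k (Q.obj K)).hom ≫ ((dfac G K).hom)⟦k⟧' =
      (dfac G (K⟦k⟧)).hom ≫ Q.map (((cx G).commShiftIso k).hom.app K) ≫
        (Q.commShiftIso k).hom.app ((cx G).obj K) := by
  have h := NatTrans.shift_app_comm G.mapDerivedCategoryFactors.hom k K
  rw [Functor.commShiftIso_comp_hom_app, Functor.commShiftIso_comp_hom_app] at h
  exact (Category.assoc _ _ _).symm.trans h

lemma cxn_shift (α : G₁ ⟶ G₂) (K : CochainComplex C ℤ) (k : ℤ) :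
    (cxn α).app (K⟦k⟧) ≫ ((cx G₂).commShiftIso k).hom.app K =
      ((cx G₁).commShiftIso k).hom.app K ≫ ((cxn α).app K)⟦k⟧' := by
  ext i
  exact (Category.comp_id _).trans (Category.id_comp _).symm

lemma dnat_shift (α : G₁ ⟶ G₂) (k : ℤ) (N : DerivedCategory C) :
    (dnat α).app (N⟦k⟧) ≫ (dsh G₂ k N).hom = (dsh G₁ k N).hom ≫ ((dnat α).app N)⟦k⟧' := by
  obtain ⟨K, ⟨e⟩⟩ := exists_iso_Q N
  have h1 : (dnat α).app ((Q.obj K)⟦k⟧) ≫ (dsh G₂ k (Q.obj K)).hom =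
      (dsh G₁ k (Q.obj K)).hom ≫ ((dnat α).app (Q.obj K))⟦k⟧' := by
    rw [← cancel_mono (((dfac G₂ K).hom)⟦k⟧'),
      ← cancel_epi ((DF G₁).map ((Q.commShiftIso k).hom.app K))]
    simp only [Category.assoc]
    have h5 : (DF G₁).map ((Q.commShiftIso k).hom.app K) ≫ (dnat α).app ((Q.obj K)⟦k⟧) =
        (dnat α).app (Q.obj (K⟦k⟧)) ≫ (DF G₂).map ((Q.commShiftIso k).hom.app K) :=
      (dnat α).naturality _
    rw [← Functor.map_comp, dnat_app, Functor.map_comp]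
    refine (Category.assoc _ _ _).symm.trans ((congrArg (· ≫ _) h5).trans ?_)
    rw [Category.assoc]
    rw [dfac_shift]
    have h2 := congrArg (· ≫ ((Q.map ((cxn α).app K))⟦k⟧')) (dfac_shift (G := G₁) K k)
    simp only [Category.assoc] at h2
    rw [h2, ← Category.assoc, dnat_app, Category.assoc]
    have h3 := (Q.commShiftIso k).hom.naturality ((cxn α).app K)
    refine congrArg _ ?_
    refine Eq.trans ?_ (congrArg (Q.map (((cx G₁).commShiftIso k).hom.app K) ≫ ·) h3)
    refine (Category.assoc _ _ _).symm.trans (Eq.trans ?_ (Category.assoc _ _ _))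
    refine congrArg (· ≫ _) ?_
    exact (Q.map_comp _ _).symm.trans ((congrArg Q.map (cxn_shift α K k)).trans (Q.map_comp _ _))
  rw [← cancel_epi ((DF G₁).map (e.hom⟦k⟧')), ← Category.assoc, (dnat α).naturality,
    Category.assoc, dsh_nat, ← Category.assoc, h1, ← Category.assoc, dsh_nat, Category.assoc,
    Category.assoc, ← Functor.map_comp, ← Functor.map_comp, (dnat α).naturality]

end ShiftCompatibility

section Contravariant

variable {C : Type u} [Category.{v} C] [Abelian C] [HasDerivedCategory.{w} C]
  {G G₁ G₂ : C ⥤ C}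
  [G.Additive] [PreservesFiniteLimits G] [PreservesFiniteColimits G]
  [G₁.Additive] [PreservesFiniteLimits G₁] [PreservesFiniteColimits G₁]
  [G₂.Additive] [PreservesFiniteLimits G₂] [PreservesFiniteColimits G₂]

lemma TriClass.DF {P : DerivedCategory C → Prop} (hP : TriClass P) (G : C ⥤ C) [G.Additive]
    [PreservesFiniteLimits G] [PreservesFiniteColimits G] : TriClass (fun N => P ((DF G).obj N)) where
  zero hA := hP.zero (Functor.map_isZero _ hA)
  iso e hA := hP.iso ((LN.DF G).mapIso e) hA
  shift {A} hA k := hP.iso (dsh G k A).symm (hP.shift hA k)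
  ext hT hA hE := by
    obtain ⟨h', hT'⟩ := DT.map G hT
    exact hP.ext hT' hA hE

lemma hLoc_comp_iso {A A' B B' : DerivedCategory C} {a : A ⟶ A} {a' : A' ⟶ A'} {ρ : A' ⟶ A}
    {b : B ⟶ B} {b' : B' ⟶ B'} {σ : B' ⟶ B} (φ : A ⟶ B) (φ' : A' ⟶ B') [IsIso φ] [IsIso φ']
    (ha : a ≫ φ = φ ≫ b) (ha' : a' ≫ φ' = φ' ≫ b') (hr : ρ ≫ φ = φ' ≫ σ)
    (E : DerivedCategory C) : HLoc b b' σ E ↔ HLoc a a' ρ E := by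
  have key : ∀ {A A' B B' : DerivedCategory C} {p : A ⟶ B} {q : A' ⟶ B'} {r : A ⟶ A'}
      {s : B ⟶ B'}, r ≫ q = p ≫ s → ∀ x : B' ⟶ E, p ≫ s ≫ x = r ≫ q ≫ x := by
    intro A A' B B' p q r s h x
    rw [← Category.assoc, ← h, Category.assoc]
  exact IsLocMap.congr (Preadditive.leftComp E φ) (Preadditive.leftComp E φ') (comp_bijective φ)
    (comp_bijective φ') (key ha) (key ha') (key hr)

lemma hLoc_shift {A A' : DerivedCategory C} {a : A ⟶ A} {a' : A' ⟶ A'} {ρ : A' ⟶ A}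
    (E : DerivedCategory C) (k : ℤ) : HLoc a a' ρ E ↔ HLoc (a⟦k⟧') (a'⟦k⟧') (ρ⟦k⟧') (E⟦k⟧) :=
  IsLocMap.congr ((shiftFunctor (DerivedCategory C) k).mapAddHom)
    ((shiftFunctor (DerivedCategory C) k).mapAddHom) ((Functor.FullyFaithful.ofFullyFaithful _).map_bijective _ _)
    ((Functor.FullyFaithful.ofFullyFaithful _).map_bijective _ _)
    (fun _ => Functor.map_comp _ _ _) (fun _ => Functor.map_comp _ _ _)
    (fun _ => Functor.map_comp _ _ _)

/-- Localization for morphisms out of the images of an object under two exact functors. -/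
abbrev NLoc (a : G₁ ⟶ G₁) (a' : G₂ ⟶ G₂) (ρ : G₂ ⟶ G₁) (N E : DerivedCategory C) : Prop :=
  HLoc ((dnat a).app N) ((dnat a').app N) ((dnat ρ).app N) E

lemma nLoc_shift (a : G₁ ⟶ G₁) (a' : G₂ ⟶ G₂) (ρ : G₂ ⟶ G₁) (N E : DerivedCategory C) (k : ℤ) :
    NLoc a a' ρ N E ↔ NLoc a a' ρ (N⟦k⟧) (E⟦k⟧) :=
  (hLoc_shift E k).trans (hLoc_comp_iso (dsh G₁ k N).hom (dsh G₂ k N).hom (dnat_shift a k N)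
    (dnat_shift a' k N) (dnat_shift ρ k N) _)

lemma nLoc_iso {a : G₁ ⟶ G₁} {a' : G₂ ⟶ G₂} {ρ : G₂ ⟶ G₁} {M N : DerivedCategory C} (φ : M ⟶ N)
    [IsIso ((DF G₁).map φ)] [IsIso ((DF G₂).map φ)] (E : DerivedCategory C) :
    NLoc a a' ρ M E ↔ NLoc a a' ρ N E :=
  (hLoc_comp_iso ((DF G₁).map φ) ((DF G₂).map φ) ((dnat a).naturality φ).symm
    ((dnat a').naturality φ).symm ((dnat ρ).naturality φ).symm E).symm

lemma nLoc_tri {a : G₁ ⟶ G₁} {a' : G₂ ⟶ G₂} {ρ : G₂ ⟶ G₁} (hc : ρ ≫ a = a' ≫ ρ)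
    (E : DerivedCategory C) : TriClass (fun N => ∀ k : ℤ, NLoc a a' ρ N (E⟦k⟧)) := by
  have h1 : TriClass (fun N : DerivedCategory C => ∀ k : ℤ, NLoc a a' ρ (N⟦k⟧) E) := by
    have comm : ∀ (N : DerivedCategory C) (ξ : (DF G₁).obj N ⟶ E),
        (dnat ρ).app N ≫ (dnat a).app N ≫ ξ = (dnat a').app N ≫ (dnat ρ).app N ≫ ξ := by
      intro N ξ
      rw [← Category.assoc, ← NatTrans.comp_app, ← dnat_comp, hc, dnat_comp, NatTrans.comp_app,
        Category.assoc]
    have nat : ∀ {G₁ G₂ : C ⥤ C} [G₁.Additive] [PreservesFiniteLimits G₁]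
        [PreservesFiniteColimits G₁] [G₂.Additive] [PreservesFiniteLimits G₂]
        [PreservesFiniteColimits G₂] (β : G₁ ⟶ G₂) {M N : DerivedCategory C} (φ : M ⟶ N)
        (ξ : (DF G₂).obj N ⟶ E), (DF G₁).map φ ≫ (dnat β).app N ≫ ξ =
        (dnat β).app M ≫ (DF G₂).map φ ≫ ξ := by
      intro G₁ G₂ _ _ _ _ _ _ β M N φ ξ
      rw [← Category.assoc, (dnat β).naturality, Category.assoc]
    refine TriClass.of_shifts (Q := fun N => NLoc a a' ρ N E) ?_
      (fun e h => (nLoc_iso e.hom E).1 h) ?_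
    · intro N hN
      have h1 := Functor.map_isZero (DF G₁) hN
      have h2 := Functor.map_isZero (DF G₂) hN
      exact ⟨fun _ => h2.eq_of_src _ _, fun _ _ => ⟨0, h1.eq_of_src _ _⟩,
        fun _ => ⟨0, 0, h2.eq_of_src _ _⟩⟩
    · rintro Z A₁ B₁ E₁ A₁' e f g h ⟨x, hx⟩ ⟨y, hy⟩ ⟨z, hz⟩ q0 q1 q3 q4
      have ex : ∀ (G : C ⥤ C) [G.Additive] [PreservesFiniteLimits G]
          [PreservesFiniteColimits G] {E₀ E₁ E₂ : DerivedCategory C} {p : E₀ ⟶ E₁} {q : E₁ ⟶ E₂},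
          (∃ r, DT p q r) → ∀ s : (DF G).obj E₁ ⟶ E,
          (DF G).map p ≫ s = 0 ↔ ∃ t : (DF G).obj E₂ ⟶ E, (DF G).map q ≫ t = s := by
        rintro G _ _ _ E₀ E₁ E₂ p q ⟨r, hr⟩ s
        obtain ⟨r', hr'⟩ := DT.map G hr
        refine ⟨fun hs => (hr'.desc₃ s hs).imp fun t ht => ht.symm, ?_⟩
        rintro ⟨t, rfl⟩
        rw [← Category.assoc, hr'.comp₁₂, zero_comp]
      let O : Fin 5 → DerivedCategory C := ![A₁', E₁, B₁, A₁, Z]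
      exact IsLocMap.five (A := fun i => ((DF G₁).obj (O i) ⟶ E))
        (B := fun i => ((DF G₂).obj (O i) ⟶ E))
        (f := fun i => Preadditive.leftComp E ((dnat a).app (O i)))
        (g := fun i => Preadditive.leftComp E ((dnat a').app (O i)))
        (ρ := fun i => Preadditive.leftComp E ((dnat ρ).app (O i))) (fun i ξ => comm _ ξ)
        (Preadditive.leftComp E ((DF G₁).map h)) (Preadditive.leftComp E ((DF G₁).map g))
        (Preadditive.leftComp E ((DF G₁).map f)) (Preadditive.leftComp E ((DF G₁).map e))
        (Preadditive.leftComp E ((DF G₂).map h)) (Preadditive.leftComp E ((DF G₂).map g))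
        (Preadditive.leftComp E ((DF G₂).map f)) (Preadditive.leftComp E ((DF G₂).map e))
        (ex G₁ ⟨z, hz⟩) (ex G₁ ⟨y, hy⟩) (ex G₁ ⟨x, hx⟩)
        (ex G₂ ⟨z, hz⟩) (ex G₂ ⟨y, hy⟩) (ex G₂ ⟨x, hx⟩)
        (nat a h) (nat a g) (nat a f) (nat a e) (nat a' h) (nat a' g) (nat a' f)
        (nat ρ h) (nat ρ g) (nat ρ f) (nat ρ e) q4.surj q3 q1 q0.inj
  have h2 : (fun N => ∀ k : ℤ, NLoc a a' ρ N (E⟦k⟧)) =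
      fun N : DerivedCategory C => ∀ k : ℤ, NLoc a a' ρ (N⟦k⟧) E := by
    ext N
    have e : ∀ k : ℤ, NLoc a a' ρ N (E⟦k⟧) ↔ NLoc a a' ρ (N⟦-k⟧) E := fun k =>
      (nLoc_shift a a' ρ N (E⟦k⟧) (-k)).trans
        (hLoc_iso ((shiftEquiv (DerivedCategory C) k).unitIso.app E).symm)
    refine ⟨fun h k => ?_, fun h k => (e k).2 (h _)⟩
    have := (e (-k)).1 (h _)
    rwa [neg_neg] at this
  rwa [h2]

end Contravariant

section LocalClasses

variable {X : Scheme.{u}} [HasDerivedCategory.{u + 1} X.Modules]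
variable {Y Z W V : X.Opens} {M N E E' : DerivedCategory X.Modules}

lemma TriClass.sup {P : DerivedCategory X.Modules → Prop} (hP : TriClass P) (Y Z : X.Opens)
    (N : DerivedCategory X.Modules) (hYZ : P ((DJ (Y ⊓ Z)).obj N)) (hY : P ((DJ Y).obj N))
    (hZ : P ((DJ Z).obj N)) : P ((DJ (Y ⊔ Z)).obj N) :=
  hP.ext (Φ_DT (le_sup_right : Z ≤ Y ⊔ Z) N) hZ
    (hP.iso (asIso (dΦm (inf_le_left : Y ⊓ Z ≤ Y) (le_sup_right : Z ≤ Y ⊔ Z) inf_le_right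
      le_sup_left N)) (hP.ext₃ (Φ_DT (inf_le_left : Y ⊓ Z ≤ Y) N) hYZ hY))

lemma isIso_dε_top (N : DerivedCategory X.Modules) : IsIso (dε ⊤ N) := by
  obtain ⟨K, ⟨e⟩⟩ := exists_iso_Q N
  have h1 : IsIso (dε ⊤ (Q.obj K)) :=
    isIso_dcounit_app_Q (jι ⊤) K fun i => inferInstanceAs (IsIso (jin ⊤ (K.X i)))
  have h2 := dε_naturality (V := ⊤) e.hom
  have : IsIso ((DJ ⊤).map e.hom ≫ dε ⊤ N) := by rw [h2]; infer_instance
  exact IsIso.of_isIso_comp_left ((DJ ⊤).map e.hom) _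

lemma isIso_dε_DJ (h : Y ≤ V) (N : DerivedCategory X.Modules) :
    IsIso (dε V ((DJ Y).obj N)) := by
  have key : ∀ Z : X.Opens, Z = Y → IsIso (dε Z ((DJ Y).obj N)) := by
    intro Z hZ
    obtain rfl : Z = ⊤ ⊓ Y := by rw [hZ, top_inf_eq]
    have := isIso_dle_DJ ⊤ Y N
    have := isIso_dε_top ((DJ Y).obj N)
    rw [top_inf_eq] at *
    rw [← dle_dε (le_top : Y ≤ ⊤)]
    rename_i h1 h2
    have h3 : ∀ (Z : X.Opens) (hZ : Z = Y) (h : Z ≤ ⊤), IsIso (dle h ((DJ Y).obj N)) := by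
      rintro Z rfl h
      have := isIso_dle_DJ ⊤ Z N
      have e : (⊤ : X.Opens) ⊓ Z = Z := top_inf_eq _
      have h4 : dle h ((DJ Z).obj N) = dle e.ge _ ≫ dle inf_le_left _ := by rw [dle_dle]
      have h5 : IsIso (dle e.ge ((DJ Z).obj N)) :=
        ⟨dle e.le _, by rw [dle_dle, dle_self], by rw [dle_dle, dle_self]⟩
      rw [h4]
      infer_instance
    have := h3 Y rfl le_top
    infer_instance
  have h1 : IsIso (dε (V ⊓ Y) ((DJ Y).obj N)) := key _ (inf_eq_right.2 h)
  rw [← dle_dε (inf_le_left : V ⊓ Y ≤ V)] at h1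
  have := isIso_dle_DJ V Y N
  exact IsIso.of_isIso_comp_left (dle (inf_le_left : V ⊓ Y ≤ V) ((DJ Y).obj N)) _

/-- Morphisms into an extension by zero from an object supported on the same open. -/
lemma coreflect {B : DerivedCategory X.Modules} (V : X.Opens) (hB : IsIso (dε V B))
    (N : DerivedCategory X.Modules) : Function.Bijective (Preadditive.rightComp B (dε V N)) := by
  constructor
  · refine (injective_iff_map_eq_zero _).2 fun γ hγ => ?_
    replace hγ : γ ≫ dε V N = 0 := hγ
    have := isIso_DJ_dε (le_refl V) N
    have h1 : (DJ V).map γ = 0 := by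
      rw [← cancel_mono ((DJ V).map (dε V N)), ← Functor.map_comp, hγ, Functor.map_zero, zero_comp]
    rw [← cancel_epi (dε V B), ← dε_naturality, h1, zero_comp, comp_zero]
  · intro β
    refine ⟨inv (dε V B) ≫ (DJ V).map β, ?_⟩
    change (inv (dε V B) ≫ (DJ V).map β) ≫ dε V N = β
    rw [Category.assoc, dε_naturality, IsIso.inv_hom_id_assoc]

lemma isIso_dle_eq (h : Y ≤ Z) (e : Y = Z) (N : DerivedCategory X.Modules) : IsIso (dle h N) :=
  ⟨dle e.ge _, by rw [dle_dle, dle_self], by rw [dle_dle, dle_self]⟩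

lemma isIso_dle_DJ' (hY : Y ≤ Z) (e : Z ⊓ W ≤ Y) (N : DerivedCategory X.Modules) :
    IsIso (dle hY ((DJ W).obj N)) := by
  have h1 := isIso_dle_DJ Y W N
  have h2 := isIso_dle_DJ Z W N
  have h3 : Y ⊓ W ≤ Z ⊓ W := inf_le_inf hY le_rfl
  have := isIso_dle_eq h3 (le_antisymm h3 (le_inf e inf_le_right)) ((DJ W).obj N)
  have h4 : IsIso (dle (inf_le_left : Y ⊓ W ≤ Y) ((DJ W).obj N) ≫ dle hY _) := by
    rw [dle_dle, ← dle_dle h3 inf_le_left]; infer_instance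
  exact IsIso.of_isIso_comp_left (dle (inf_le_left : Y ⊓ W ≤ Y) ((DJ W).obj N)) _

lemma isIso_DJ_dle {Y' : X.Opens} (h : Y' ≤ Y) (hZ : Y' ≤ Z) (e : Z ⊓ Y ≤ Y')
    (N : DerivedCategory X.Modules) : IsIso ((DJ Z).map (dle h N)) := by
  have h1 : IsIso (dle hZ ((DJ Y').obj N)) := isIso_dle_DJ' hZ inf_le_right N
  have h2 : IsIso (dle hZ ((DJ Y).obj N)) := isIso_dle_DJ' hZ e N
  have h3 := isIso_DJ_dε (le_refl Y') N
  have h4 := isIso_DJ_dε h N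
  have h5 : IsIso ((DJ Y').map (dle h N)) := by
    have : IsIso ((DJ Y').map (dle h N) ≫ (DJ Y').map (dε Y N)) := by
      rw [← Functor.map_comp, dle_dε]; exact h3
    exact IsIso.of_isIso_comp_right _ ((DJ Y').map (dε Y N))
  have h6 : IsIso (dle hZ ((DJ Y').obj N) ≫ (DJ Z).map (dle h N)) := by
    rw [← dle_naturality]; infer_instance
  exact IsIso.of_isIso_comp_left (dle hZ ((DJ Y').obj N)) _

lemma ap_mul' {F : X.Modules} (h : Y ≤ W) (f : Γ(X, W)) {U : X.Opens} (hU : U ≤ W)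
    (t : Γ((J Y).obj F, U)) : ap ((mul (ors h f)).app F) U t = ors hU f • t := by
  refine injective_of_mono ((jle h).app F) U ?_
  have := congr(ap (NatTrans.app $(jle_mul h f) F) U t)
  rw [NatTrans.comp_app, NatTrans.comp_app, ap_comp, ap_comp, ap_mul _ _ hU] at this
  rw [← this, ap_smul]

lemma mul_jι {F : X.Modules} (h : Y ≤ W) (f : Γ(X, W)) :
    (mul f).app ((J Y).obj F) ≫ jin W ((J Y).obj F) =
      jin W ((J Y).obj F) ≫ (mul (ors h f)).app F := by
  refine J_hom_ext fun U hU s => ?_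
  rw [ap_comp, ap_comp, ap_mul _ _ hU, ap_smul, ap_mul' h f hU]

lemma dmul_dε (h : Y ≤ W) (f : Γ(X, W)) (N : DerivedCategory X.Modules) :
    dmul f ((DJ Y).obj N) ≫ dε W ((DJ Y).obj N) =
      dε W ((DJ Y).obj N) ≫ dmul (ors h f) N := by
  obtain ⟨K, ⟨e⟩⟩ := exists_iso_Q N
  have h1 : dmul f (Q.obj ((cx (J Y)).obj K)) ≫ dε W (Q.obj ((cx (J Y)).obj K)) =
      dε W (Q.obj ((cx (J Y)).obj K)) ≫ Q.map ((cxn (mul (ors h f))).app K) := by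
    rw [dε, dcounit_app, ← Category.assoc, dmul, dnat_app, Category.assoc, Category.assoc,
      ← Q.map_comp, ← Q.map_comp]
    congr 2
    ext i : 1
    exact mul_jι h f
  have h2 : dmul (ors h f) (Q.obj K) ≫ (dfac (J Y) K).hom =
      (dfac (J Y) K).hom ≫ Q.map ((cxn (mul (ors h f))).app K) := dnat_app _ _
  have h3 : dmul f ((DJ Y).obj (Q.obj K)) ≫ dε W ((DJ Y).obj (Q.obj K)) =
      dε W ((DJ Y).obj (Q.obj K)) ≫ dmul (ors h f) (Q.obj K) := by
    rw [← cancel_mono (dfac (J Y) K).hom, Category.assoc, Category.assoc, h2, ← dε_naturality,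
      ← Category.assoc, ← dmul_naturality, Category.assoc, h1, ← Category.assoc, dε_naturality,
      Category.assoc]
  rw [← cancel_epi ((DJ W).map ((DJ Y).map e.hom)), ← Category.assoc, dmul_naturality,
    Category.assoc, dε_naturality, ← Category.assoc, h3, ← Category.assoc, dε_naturality,
    Category.assoc, Category.assoc, dmul_naturality]

lemma rloc_tri (f : Γ(X, W)) (E : DerivedCategory X.Modules) :
    TriClass (fun N => ∀ k : ℤ, RLoc f N (E⟦k⟧)) :=
  nLoc_tri (a := mul f) (a' := mul (ors (X.basicOpen_le f) f)) (ρ := jle (X.basicOpen_le f))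
    (jle_mul _ _) E

lemma rloc_of_iso (f : Γ(X, W)) (φ : M ⟶ N) [IsIso ((DJ W).map φ)] : RLoc f M E ↔ RLoc f N E := by
  have : IsIso ((DJ (X.basicOpen f)).map φ) := by
    have h := X.basicOpen_le f
    have h1 := isIso_DJ_dε h M
    have h2 := isIso_DJ_dε h N
    have : IsIso ((DJ (X.basicOpen f)).map (dε W M) ≫ (DJ (X.basicOpen f)).map φ) := by
      rw [← Functor.map_comp, ← dε_naturality, Functor.map_comp]; infer_instance
    exact IsIso.of_isIso_comp_left ((DJ (X.basicOpen f)).map (dε W M)) _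
  exact nLoc_iso φ E

lemma rloc_DJ (h : Y ≤ W) (f : Γ(X, W)) :
    RLoc f ((DJ Y).obj N) E ↔ RLoc (ors h f) N E := by
  have hb : X.basicOpen (ors h f) = Y ⊓ X.basicOpen f := basicOpen_ors h f
  have hZ : X.basicOpen (ors h f) ≤ X.basicOpen f := hb.le.trans inf_le_right
  have hY : X.basicOpen (ors h f) ≤ Y := X.basicOpen_le _
  have h1 := isIso_dε_DJ h N
  have h2 := isIso_dε_DJ hZ N
  have h3 : IsIso ((DJ (X.basicOpen f)).map (dle hY N)) :=
    isIso_DJ_dle hY hZ (by rw [hb, inf_comm]) N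
  refine (hLoc_comp_iso (dε W ((DJ Y).obj N)) (inv ((DJ (X.basicOpen f)).map (dle hY N)) ≫
    dε (X.basicOpen f) _) (dmul_dε h f N) ?_ ?_ E).symm
  · rw [← cancel_epi ((DJ (X.basicOpen f)).map (dle hY N)), ← Category.assoc, dmul_naturality]
    simp only [Category.assoc, IsIso.hom_inv_id_assoc]
    rw [dmul_dε hZ, ors_ors, ors_ors]
  · rw [dle_dε, Category.assoc, ← dε_naturality, IsIso.inv_hom_id_assoc]

lemma rloc_OD (hE : Dqc E) (hY : IsAffineOpen Y) (h : Y ≤ W) (f : Γ(X, W)) (k : ℤ) :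
    RLoc f (OD Y) (E⟦k⟧) :=
  (rloc_DJ h f).2 (dqc_iff_rloc.1 hE Y hY _ k)

/-- Localization for objects generated by the structure sheaves of small affine opens. -/
lemma rloc_gen (hE : Dqc E) (f : Γ(X, W))
    (hN : Gen (fun A => ∃ Y : X.Opens, IsAffineOpen Y ∧ Y ≤ W ∧ A = OD Y) N) (k : ℤ) :
    RLoc f N (E⟦k⟧) := by
  refine hN _ (rloc_tri f E) ?_ k
  rintro _ ⟨Y, hY, hYW, rfl⟩ k
  exact rloc_OD hE hY hYW f k

end LocalClasses

section Induction

variable {X : Scheme.{u}} {Y V W : X.Opens}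

/-- The union of a finite list of open subsets. -/
def lsup : List X.Opens → X.Opens
  | [] => ⊥
  | V :: l => V ⊔ lsup l

lemma mem_lsup {l : List X.Opens} {x : X} : x ∈ lsup l ↔ ∃ V ∈ l, x ∈ V := by
  induction l with
  | nil => simp [lsup]
  | cons V l ih => simp [lsup, ih]

lemma le_lsup {l : List X.Opens} (hV : V ∈ l) : V ≤ lsup l :=
  fun _ hx => mem_lsup.2 ⟨V, hV, hx⟩

lemma lsup_le {l : List X.Opens} (h : ∀ V ∈ l, V ≤ Y) : lsup l ≤ Y := by
  intro x hx
  obtain ⟨V, hV, hx⟩ := mem_lsup.1 hx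
  exact h V hV hx

lemma isCompact_lsup {l : List X.Opens} (h : ∀ V ∈ l, IsCompact (V : Set X)) :
    IsCompact (lsup l : Set X) := by
  induction l with
  | nil => simp [lsup]
  | cons V l ih =>
    exact (h V (by simp)).union (ih fun V' hV' => h V' (by simp [hV']))

lemma exists_lsup (hY : IsCompact (Y : Set X)) (s : X.Opens → Prop)
    (hs : ∀ x ∈ Y, ∃ V ≤ Y, s V ∧ x ∈ V) : ∃ l : List X.Opens, (∀ V ∈ l, s V) ∧ Y = lsup l := by
  choose! v hv hs hx using hs
  obtain ⟨t, ht, hc⟩ := hY.elim_nhds_subcover (fun x => (v x : Set X))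
    fun x hxY => (v x).isOpen.mem_nhds (hx x hxY)
  refine ⟨t.toList.map v, by simpa using fun x hx => hs x (ht x hx), le_antisymm ?_ ?_⟩
  · intro x hxY
    obtain ⟨i, hi, hxi⟩ := Set.mem_iUnion₂.1 (hc hxY)
    exact mem_lsup.2 ⟨v i, by simpa using ⟨i, hi, rfl⟩, hxi⟩
  · exact lsup_le (by simpa using fun x hx => hv x (ht x hx))

lemma exists_basicOpen_list (hV : IsAffineOpen V) (hY : IsCompact (Y : Set X)) (h : Y ≤ V) :
    ∃ l : List Γ(X, V), Y = lsup (l.map fun f => X.basicOpen f) := by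
  obtain ⟨l, hl, rfl⟩ := exists_lsup hY (fun V' => ∃ f : Γ(X, V), X.basicOpen f = V') (by
    intro x hx
    obtain ⟨f, hf, hxf⟩ := hV.exists_basicOpen_le ⟨x, hx⟩ (h hx)
    exact ⟨_, hf, ⟨f, rfl⟩, hxf⟩)
  choose! f hf using hl
  refine ⟨l.map f, ?_⟩
  congr 1
  rw [List.map_map]
  conv_lhs => rw [← List.map_id l]
  exact List.map_congr_left fun V' hV' => (hf V' hV').symm

lemma basicOpen_inf_lsup (f : Γ(X, V)) (l : List Γ(X, V)) :
    X.basicOpen f ⊓ lsup (l.map fun f => X.basicOpen f) =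
      lsup ((l.map (f * ·)).map fun f => X.basicOpen f) := by
  induction l with
  | nil => simp [lsup]
  | cons g l ih =>
    simp only [List.map_cons, lsup, inf_sup_left, X.basicOpen_mul, ih]

lemma basicOpen_induction (hV : IsAffineOpen V) (P : X.Opens → Prop) (hbot : P ⊥)
    (hbasic : ∀ f : Γ(X, V), P (X.basicOpen f))
    (hsup : ∀ Y Z : X.Opens, P (Y ⊓ Z) → P Y → P Z → P (Y ⊔ Z))
    (hY : IsCompact (Y : Set X)) (h : Y ≤ V) : P Y := by
  obtain ⟨l, rfl⟩ := exists_basicOpen_list hV hY h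
  clear hY h
  obtain ⟨n, hn⟩ : ∃ n, l.length = n := ⟨_, rfl⟩
  induction n generalizing l with
  | zero => rw [List.length_eq_zero_iff.1 hn]; exact hbot
  | succ n ih =>
    obtain ⟨f, l, rfl⟩ := List.exists_cons_of_length_eq_add_one hn
    have hl : l.length = n := by simpa using hn
    refine hsup _ _ ?_ (hbasic f) (ih l hl)
    rw [basicOpen_inf_lsup]
    exact ih _ (by simpa using hl)

lemma affineCover_exists {ι : Type*} {U : ι → X.Opens} (hU : iSup U = ⊤) (x : X) (hx : x ∈ Y) :
    ∃ V ≤ Y, (IsAffineOpen V ∧ ∃ α, V ≤ U α) ∧ x ∈ V := by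
  obtain ⟨α, hα⟩ := Opens.mem_iSup.1 (show x ∈ iSup U by rw [hU]; trivial)
  obtain ⟨V, hV, hxV, hle⟩ := Opens.isBasis_iff_nbhd.1 X.isBasis_affineOpens
    (show x ∈ Y ⊓ U α from ⟨hx, hα⟩)
  exact ⟨V, hle.trans inf_le_left, ⟨hV, α, hle.trans inf_le_right⟩, hxV⟩

lemma isCompact_inf [QuasiSeparatedSpace X] {Y Z : X.Opens} (hY : IsCompact (Y : Set X))
    (hZ : IsCompact (Z : Set X)) : IsCompact ((Y ⊓ Z : X.Opens) : Set X) :=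
  QuasiSeparatedSpace.inter_isCompact _ _ Y.isOpen hY Z.isOpen hZ

lemma compact_induction [QuasiSeparatedSpace X] {ι : Type*} {U : ι → X.Opens} (hU : iSup U = ⊤)
    (P : X.Opens → Prop) (hbot : P ⊥)
    (hsmall : ∀ V Y : X.Opens, IsAffineOpen V → (∃ α, V ≤ U α) → Y ≤ V →
      IsCompact (Y : Set X) → P Y)
    (hsup : ∀ Y Z : X.Opens, P (Y ⊓ Z) → P Y → P Z → P (Y ⊔ Z))
    (hY : IsCompact (Y : Set X)) : P Y := by
  obtain ⟨l, hl, rfl⟩ := exists_lsup hY _ (affineCover_exists hU)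
  clear hY
  induction l with
  | nil => exact hbot
  | cons V l ih =>
    have hV := hl V (by simp)
    have hl' : ∀ V' ∈ l, _ := fun V' hV' => hl V' (by simp [hV'])
    exact hsup _ _ (hsmall V _ hV.1 hV.2 inf_le_left (isCompact_inf hV.1.isCompact
      (isCompact_lsup fun V' hV' => (hl' V' hV').1.isCompact)))
      (hsmall V V hV.1 hV.2 le_rfl hV.1.isCompact) (ih hl')

end Induction

section Complexes

variable {C : Type u} [Category.{v} C] [Abelian C] [HasDerivedCategory.{w} C]
  {P : DerivedCategory C → Prop}

lemma TriClass.single (hP : TriClass P) {A : C} (h : P ((singleFunctor C 0).obj A)) (b : ℤ) :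
    P ((singleFunctor C b).obj A) := by
  refine hP.unshift b (hP.iso ?_ h)
  exact (((SingleFunctors.shiftIso (singleFunctors C) b 0 b (by simp)).app A)).symm

lemma TriClass.bounded (hP : TriClass P) (a : ℤ) (n : ℕ) (K : CochainComplex C ℤ)
    (hK : ∀ i : ℤ, (i < a ∨ a + n ≤ i) → IsZero (K.X i))
    (h : ∀ i, P ((singleFunctor C 0).obj (K.X i))) : P (Q.obj K) := by
  induction n generalizing K with
  | zero =>
    refine hP.zero (Functor.map_isZero _ ?_)
    rw [IsZero.iff_id_eq_zero]
    ext i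
    exact (hK i (by push_cast; omega)).eq_of_src _ _
  | succ n ih =>
    let b : ℤ := a + n
    let φ : (HomologicalComplex.single C (ComplexShape.up ℤ) b).obj (K.X b) ⟶ K :=
      HomologicalComplex.mkHomFromSingle (𝟙 _) (fun k hk => by
        obtain rfl : b + 1 = k := hk
        exact (hK (b + 1) (by right; push_cast; omega)).eq_of_tgt _ _)
    have hφ : IsIso (φ.f b) := by
      rw [HomologicalComplex.mkHomFromSingle_f]; infer_instance
    have hz : ∀ i, i ≠ b → IsZero
        (((HomologicalComplex.single C (ComplexShape.up ℤ) b).obj (K.X b)).X i) :=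
      fun i hi => HomologicalComplex.isZero_single_obj_X _ _ _ _ hi
    have hm : ∀ i, Mono (φ.f i) := by
      intro i
      by_cases hi : i = b
      · subst hi; infer_instance
      · exact ⟨fun _ _ _ => (hz i hi).eq_of_tgt _ _⟩
    have : Mono φ := HomologicalComplex.mono_of_mono_f _ hm
    let S : ShortComplex (CochainComplex C ℤ) := ShortComplex.mk φ (cokernel.π φ) (by simp)
    have hS : S.ShortExact :=
      { exact := ShortComplex.exact_cokernel φ
        mono_f := this
        epi_g := inferInstanceAs (Epi (cokernel.π φ)) }
    have hSi : ∀ i, (S.map (HomologicalComplex.eval C (ComplexShape.up ℤ) i)).ShortExact :=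
      fun i => hS.map_of_exact _
    have hg : ∀ i, i ≠ b → IsIso ((cokernel.π φ).f i) := fun i hi =>
      (hSi i).isIso_g_iff.2 (hz i hi)
    have hb : IsZero ((cokernel φ).X b) := (hSi b).isIso_f_iff.1 hφ
    refine hP.ext (triangleOfSES_distinguished hS) (hP.single (h b) b) (ih (cokernel φ) ?_ ?_)
    · intro i hi
      by_cases hi' : i = b
      · rw [hi']; exact hb
      · exact (hK i (by push_cast; omega)).of_iso (@asIso _ _ _ _ _ (hg i hi')).symm
    · intro i
      by_cases hi' : i = b
      · rw [hi']; exact hP.zero (Functor.map_isZero _ hb)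
      · exact hP.iso ((singleFunctor C 0).mapIso (@asIso _ _ _ _ _ (hg i hi'))) (h i)

end Complexes

section Coproducts

variable {D : Type*} [Category* D] [HasZeroObject D] [HasShift D ℤ] [Preadditive D]
  [∀ n : ℤ, (shiftFunctor D n).Additive] [Pretriangulated D] {P : D → Prop}

open scoped ZeroObject in
lemma TriClass.coproduct {B : Type*} [Category* B] [Abelian B] (hP : TriClass P) (L : B ⥤ D)
    [L.Additive] {ι : Type*} [Finite ι] (f : ι → B) [HasCoproduct f] (hf : ∀ i, P (L.obj (f i))) :
    P (L.obj (∐ f)) := by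
  let R : ObjectProperty B := fun M => P (L.obj M)
  have : R.IsClosedUnderIsomorphisms := ⟨fun e h => hP.iso (L.mapIso e) h⟩
  have : R.ContainsZero := ⟨⟨(0 : B), isZero_zero _, hP.zero (L.map_isZero (isZero_zero _))⟩⟩
  have : R.IsClosedUnderBinaryCoproducts := ⟨by
    rintro M ⟨p⟩
    have e : M ≅ p.diag.obj ⟨WalkingPair.left⟩ ⊞ p.diag.obj ⟨WalkingPair.right⟩ :=
      p.isColimit.coconePointUniqueUpToIso
        ((IsColimit.precomposeHomEquiv (diagramIsoPair p.diag) _).symm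
          (BinaryBiproduct.isColimit _ _))
    have := preservesBinaryBiproducts_of_preservesBiproducts L
    refine hP.iso (L.mapIso e ≪≫ L.mapBiprod _ _).symm ?_
    exact hP.ext (binaryBiproductTriangle_distinguished _ _)
      (p.prop_diag_obj ⟨WalkingPair.left⟩) (p.prop_diag_obj ⟨WalkingPair.right⟩)⟩
  have : R.IsClosedUnderFiniteCoproducts := ObjectProperty.IsClosedUnderFiniteCoproducts.mk'
  exact R.prop_coproduct hf

end Coproducts

section Extension

variable {X : Scheme.{u}} (U : X.Opens)

/-- Extension by zero of modules on an open subset. -/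
def JU : ModOver X U ⥤ X.Modules :=
  (Scheme.Modules.overEquiv U).functor ⋙ Scheme.Modules.pushforward U.ι ⋙ J U

/-- Extension by zero is left adjoint to restriction. -/
def extAdj : Scheme.Modules.pushforward U.ι ⋙ J U ⊣ Scheme.Modules.restrictFunctor U.ι :=
  Adjunction.restrictFullyFaithful (iD := 𝟭 X.Modules)
    (adjJT U) (Scheme.Modules.restrictAdjunction U.ι).fullyFaithfulROfIsIsoCounit (.id _)
    (Functor.rightUnitor _).symm (Functor.leftUnitor _)

instance : (JU U).IsLeftAdjoint :=
  ((Scheme.Modules.overEquiv U).toAdjunction.comp (extAdj U)).isLeftAdjoint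

instance : PreservesFiniteLimits (JU U) := by
  have : PreservesFiniteLimits (Scheme.Modules.pushforward U.ι) :=
    ⟨fun _ _ _ => (Scheme.Modules.restrictAdjunction U.ι).rightAdjoint_preservesLimits.1⟩
  unfold JU
  infer_instance

instance : PreservesFiniteColimits (JU U) := inferInstance

instance : (JU U).Additive := Functor.additive_of_preserves_binary_products _

/-- The extension by zero only depends on the restriction. -/
def isoTJ : J U ≅ T U ⋙ J U :=
  NatIso.ofComponents (fun F : X.Modules => asIso ((J U).map (tη U F))) (by
    intro F G φ
    have h := congrArg (J U).map (tη_naturality U φ)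
    rw [Functor.map_comp, Functor.map_comp] at h
    exact h)

/-- The extension by zero of the restriction of a sheaf of modules. -/
def resJU : restrictionFunctor X U ⋙ JU U ≅ J U :=
  Functor.isoWhiskerRight (Scheme.Modules.overFunctorEquiv U)
    (Scheme.Modules.pushforward U.ι ⋙ J U) ≪≫ (isoTJ U).symm

/-- The extension by zero of the structure sheaf. -/
def unitJU : (JU U).obj (SheafOfModules.unit (X.ringCatSheaf.over U)) ≅ O U :=
  (resJU U).app (OX X)

variable [HasDerivedCategory.{u + 1} X.Modules] [∀ U : X.Opens, HasDerivedCategory.{u + 1} (ModOver X U)]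

lemma gen_free (k : ℕ) : Gen (fun A => A = OD U)
    ((singleFunctor X.Modules 0).obj ((JU U).obj (SheafOfModules.free (ULift.{u} (Fin k))))) :=
  (gen_tri _).coproduct (JU U ⋙ singleFunctor X.Modules 0) _ fun _ =>
    (gen_tri _).iso ((dsingle (J U) (OX X)) ≪≫ (singleFunctor X.Modules 0).mapIso (unitJU U).symm)
      (Gen.of rfl)

lemma gen_strictlyPerfect {P : CochainComplex (ModOver X U) ℤ} (hP : StrictlyPerfect X U P) :
    Gen (fun A => A = OD U) (Q.obj (((JU U).mapHomologicalComplex (.up ℤ)).obj P)) := by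
  obtain ⟨⟨a, b, hab⟩, hf⟩ := hP
  refine (gen_tri _).bounded a (b + 1 - a).toNat _ (fun i hi => ?_) (fun i => ?_)
  · exact (JU U).map_isZero (hab i (by omega))
  · obtain ⟨k, ⟨e⟩⟩ := hf i
    exact (gen_tri _).iso ((singleFunctor X.Modules 0).mapIso ((JU U).mapIso e.symm))
      (gen_free U k)

lemma gen_DJ {S : CochainComplex X.Modules ℤ} {P : CochainComplex (ModOver X U) ℤ}
    (hP : StrictlyPerfect X U P)
    (h : Nonempty (Q.obj ((restrictComplex X U).obj S) ≅ Q.obj P)) :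
    Gen (fun A => A = OD U) ((DJ U).obj (Q.obj S)) := by
  obtain ⟨e⟩ := h
  refine (gen_tri _).iso ?_ (gen_strictlyPerfect U hP)
  refine ((JU U).mapDerivedCategoryFactors.app P).symm ≪≫
    (JU U).mapDerivedCategory.mapIso e.symm ≪≫
    (JU U).mapDerivedCategoryFactors.app ((restrictComplex X U).obj S) ≪≫
    Q.mapIso (?_ : _ ≅ (cx (J U)).obj S) ≪≫ (dfac (J U) S).symm
  exact (NatIso.mapHomologicalComplex (resJU U) (.up ℤ)).app S

variable {U}

end Extension

section Generation

variable {X : Scheme.{u}} [HasDerivedCategory.{u + 1} X.Modules]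
  {N : DerivedCategory X.Modules} {Y V W : X.Opens}

lemma isZero_DJ_bot (N : DerivedCategory X.Modules) : IsZero ((DJ ⊥).obj N) :=
  (IsZero.iff_id_eq_zero _).2 (DJ_bot N)

/-- Objects generated by the extension by zero of the structure sheaf of one open subset. -/
abbrev GenOD (V : X.Opens) : DerivedCategory X.Modules → Prop := Gen (fun A => A = OD V)

lemma GenOD.DJ (h : Y ≤ V) (hN : GenOD V N) : GenOD Y ((DJ Y).obj N) := by
  have h2 := isIso_DJ_dε h (SX X)
  refine hN _ ((gen_tri _).DF (J Y)) ?_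
  rintro _ rfl
  exact (gen_tri _).iso (asIso ((LN.DJ Y).map (dε V (SX X)))).symm (Gen.of rfl)

lemma GenOD.of_le (h : Y ≤ V) (hN : GenOD V ((LN.DJ V).obj N)) : GenOD Y ((LN.DJ Y).obj N) := by
  have h1 := isIso_DJ_dε h N
  exact (gen_tri _).iso (asIso ((LN.DJ Y).map (dε V N))) (hN.DJ h)

lemma gen_affine_qc (hV : IsAffineOpen V) (hN : GenOD V ((DJ V).obj N))
    (hY : IsCompact (Y : Set X)) (h : Y ≤ V) :
    Gen (fun A => ∃ W : X.Opens, IsAffineOpen W ∧ W ≤ V ∧ A = OD W) ((DJ Y).obj N) := by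
  refine basicOpen_induction hV (fun Y => Gen _ ((DJ Y).obj N))
    ((gen_tri _).zero (isZero_DJ_bot N)) (fun f => ?_)
    (fun Y Z h₁ h₂ h₃ => (gen_tri _).sup Y Z N h₁ h₂ h₃) hY h
  refine Gen.mono ?_ (hN.of_le (X.basicOpen_le f))
  rintro _ rfl
  exact Gen.of ⟨_, hV.basicOpen f, X.basicOpen_le f, rfl⟩

lemma genOD_SX (V : X.Opens) : GenOD V (OD V) := Gen.of rfl

variable {ι : Type*} (U : ι → X.Opens)

/-- The class generated by structure sheaves of small affine opens. -/
def GenSmall : DerivedCategory X.Modules → Prop :=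
  Gen (fun A => ∃ W : X.Opens, (IsAffineOpen W ∧ ∃ α, W ≤ U α) ∧ A = OD W)

variable {U}

lemma genSmall_compact [QuasiSeparatedSpace X] (hU : iSup U = ⊤)
    (hN : ∀ α, GenOD (U α) ((DJ (U α)).obj N)) (hY : IsCompact (Y : Set X)) :
    GenSmall U ((DJ Y).obj N) := by
  refine compact_induction hU (fun Y => GenSmall U ((DJ Y).obj N))
    ((gen_tri _).zero (isZero_DJ_bot N)) ?_
    (fun Y Z h₁ h₂ h₃ => (gen_tri _).sup Y Z N h₁ h₂ h₃) hY
  rintro V Y hV ⟨α, hα⟩ hYV hY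
  refine Gen.mono ?_ (gen_affine_qc hV ((hN α).of_le hα) hY hYV)
  rintro _ ⟨W, hW, hWV, rfl⟩
  exact Gen.of ⟨W, ⟨hW, α, hWV.trans hα⟩, rfl⟩

lemma genSmall_top [CompactSpace X] [QuasiSeparatedSpace X] (hU : iSup U = ⊤)
    (hN : ∀ α, GenOD (U α) ((DJ (U α)).obj N)) : GenSmall U N := by
  have h := isIso_dε_top N
  exact (gen_tri _).iso (asIso (dε ⊤ N)) (genSmall_compact hU hN isCompact_univ)

end Generation

section Off

open Classical in
/-- The endomorphism of a coproduct killing the components indexed by a finite set. -/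
def off {C : Type*} [Category C] [Preadditive C] {I : Type*} (K : I → C) [HasCoproduct K]
    (s : Finset I) : ∐ K ⟶ ∐ K :=
  Sigma.desc fun i => if i ∈ s then 0 else Sigma.ι K i

variable {C : Type*} [Category C] [Preadditive C] {I : Type*} (K : I → C) [HasCoproduct K]

lemma ι_off_mem {s : Finset I} {i : I} (h : i ∈ s) : Sigma.ι K i ≫ off K s = 0 := by
  simp [off, h]

lemma ι_off_notMem {s : Finset I} {i : I} (h : i ∉ s) :
    Sigma.ι K i ≫ off K s = Sigma.ι K i := by
  simp [off, h]

lemma off_off_of_le {s t : Finset I} (h : s ⊆ t) : off K s ≫ off K t = off K t := by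
  refine Sigma.hom_ext _ _ fun i => ?_
  by_cases hi : i ∈ s
  · rw [← Category.assoc, ι_off_mem K hi, zero_comp, ι_off_mem K (h hi)]
  · rw [← Category.assoc, ι_off_notMem K hi]

open Classical in
lemma one_sub_off (s : Finset I) :
    𝟙 (∐ K) - off K s = ∑ i ∈ s, Sigma.π K i ≫ Sigma.ι K i := by
  refine Sigma.hom_ext _ _ fun i => ?_
  have h1 : ∀ j ∈ s, j ≠ i → Sigma.ι K i ≫ Sigma.π K j ≫ Sigma.ι K j = 0 := fun j _ hj => by
    rw [← Category.assoc, Sigma.ι_π_of_ne K (Ne.symm hj), zero_comp]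
  rw [Preadditive.comp_sub, Preadditive.comp_sum, Category.comp_id]
  by_cases hi : i ∈ s
  · rw [ι_off_mem K hi, Finset.sum_eq_single i h1 (fun h => (h hi).elim), sub_zero,
      ← Category.assoc, Sigma.ι_π_eq_id, Category.id_comp]
  · rw [ι_off_notMem K hi, sub_self]
    exact (Finset.sum_eq_zero fun j hj => h1 j hj (fun h => hi (h ▸ hj))).symm

end Off

section LFin

variable {X : Scheme.{u}} {I : Type*} {F G : X.Modules}

/-- A system of endomorphisms such that every section is locally killed by one of its members. -/
def LFin (e : Finset I → (F ⟶ F)) : Prop :=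
  ∀ (W : X.Opens) (x : Γ(F, W)), ∀ p ∈ W, ∃ (W' : X.Opens) (h : W' ≤ W), p ∈ W' ∧
    ∃ s, ap (e s) W' (rs F h x) = 0

lemma LFin.of_iso {e : Finset I → (F ⟶ F)} {e' : Finset I → (G ⟶ G)} (φ : F ≅ G)
    (h : ∀ s, φ.hom ≫ e' s = e s ≫ φ.hom) (he : LFin e) : LFin e' := by
  intro W x p hp
  obtain ⟨W', hW, hp', s, hs⟩ := he W (ap φ.inv W x) p hp
  refine ⟨W', hW, hp', s, ?_⟩
  have h1 : rs G hW x = ap φ.hom W' (rs F hW (ap φ.inv W x)) := by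
    rw [← ap_rs, ← ap_comp, φ.inv_hom_id, ap_id]
  rw [h1, ← ap_comp, h, ap_comp, hs, map_zero]

lemma ap_eq_zero_of_le {e : Finset I → (F ⟶ F)} (hm : ∀ s t, s ⊆ t → e s ≫ e t = e t)
    {s t : Finset I} (h : s ⊆ t) {W : X.Opens} {x : Γ(F, W)} (hx : ap (e s) W x = 0) :
    ap (e t) W x = 0 := by
  rw [← hm s t h, ap_comp, hx, map_zero]

open Classical in
/-- The subsheaf of sections locally killed by the system. -/
def lfinSub (e : Finset I → (F ⟶ F)) (hm : ∀ s t, s ⊆ t → e s ≫ e t = e t) : Sub F where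
  mem W := {x | ∀ p ∈ W, ∃ (W' : X.Opens) (h : W' ≤ W), p ∈ W' ∧
    ∃ s, ap (e s) W' (rs F h x) = 0}
  zero W p hp := ⟨W, le_rfl, hp, ∅, by simp⟩
  add {W x y} hx hy p hp := by
    obtain ⟨W₁, h₁, hp₁, s, hs⟩ := hx p hp
    obtain ⟨W₂, h₂, hp₂, t, ht⟩ := hy p hp
    refine ⟨W₁ ⊓ W₂, inf_le_left.trans h₁, ⟨hp₁, hp₂⟩, s ∪ t, ?_⟩
    have a : ap (e (s ∪ t)) (W₁ ⊓ W₂) (rs F (inf_le_left.trans h₁) x) = 0 := by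
      rw [← rs_rs inf_le_left h₁, ap_rs,
        ap_eq_zero_of_le hm Finset.subset_union_left hs, map_zero]
    have b : ap (e (s ∪ t)) (W₁ ⊓ W₂) (rs F (inf_le_left.trans h₁) y) = 0 := by
      change ap (e (s ∪ t)) (W₁ ⊓ W₂) (rs F (inf_le_right.trans h₂) y) = 0
      rw [← rs_rs inf_le_right h₂, ap_rs,
        ap_eq_zero_of_le hm Finset.subset_union_right ht, map_zero]
    rw [map_add, map_add, a, b, add_zero]
  smul {W x} r hx p hp := by
    obtain ⟨W₁, h₁, hp₁, s, hs⟩ := hx p hp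
    exact ⟨W₁, h₁, hp₁, s, by rw [rs_smul, ap_smul, hs, smul_zero]⟩
  res {W' W} h {x} hx p hp := by
    obtain ⟨W₁, h₁, hp₁, s, hs⟩ := hx p (h hp)
    refine ⟨W₁ ⊓ W', inf_le_right, ⟨hp₁, hp⟩, s, ?_⟩
    rw [rs_rs, ← rs_rs (inf_le_left : W₁ ⊓ W' ≤ W₁) h₁, ap_rs, hs, map_zero]
  loc {W x} hx p hp := by
    obtain ⟨W₁, h₁, hp₁, hx₁⟩ := hx p hp
    obtain ⟨W₂, h₂, hp₂, s, hs⟩ := hx₁ p hp₁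
    exact ⟨W₂, h₂.trans h₁, hp₂, s, by rwa [rs_rs] at hs⟩

lemma lfin_of_jointly_epi (e : Finset I → (F ⟶ F)) (hm : ∀ s t, s ⊆ t → e s ≫ e t = e t)
    (A : I → X.Modules) (ι : ∀ i, A i ⟶ F)
    (hι : ∀ {Z : X.Modules} (φ : F ⟶ Z), (∀ i, ι i ≫ φ = 0) → φ = 0)
    (h : ∀ i, ι i ≫ e {i} = 0) : LFin e := by
  let N := lfinSub e hm
  have hmem : ∀ i W (x : Γ(A i, W)), ap (ι i) W x ∈ N.mem W := fun i W x p hp =>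
    ⟨W, le_rfl, hp, {i}, by rw [rs_self, ← ap_comp, h i, ap_zero]⟩
  have : Epi N.ι := Preadditive.epi_of_cancel_zero _ fun φ hφ => hι φ fun i => by
    rw [← N.lift_ι (ι i) (hmem i), Category.assoc, hφ, comp_zero]
  have : IsIso N.ι := isIso_of_mono_of_epi _
  intro W x
  have h2 : ap N.ι W (ap (inv N.ι) W x) = x := by
    rw [← ap_comp, IsIso.inv_hom_id, ap_id]
  have := N.ι_mem (ap (inv N.ι) W x)
  rwa [h2] at this

lemma LFin.exists_of_isCompact {e : Finset I → (F ⟶ F)}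
    (hm : ∀ s t, s ⊆ t → e s ≫ e t = e t) (he : LFin e) {W : X.Opens}
    (hW : IsCompact (W : Set X)) (x : Γ(F, W)) : ∃ s, ap (e s) W x = 0 := by
  classical
  choose! W' h hp s hs using he W x
  obtain ⟨t, ht⟩ := hW.elim_finite_subcover (fun p : W => (W' p : Set X))
    (fun p => (W' p).isOpen) (fun p hp' => Set.mem_iUnion.2 ⟨⟨p, hp'⟩, hp p hp'⟩)
  refine ⟨t.biUnion fun p => s p, sec_ext fun p hpW => ?_⟩
  obtain ⟨q, hq, hpq⟩ := Set.mem_iUnion₂.1 (ht hpW)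
  refine ⟨W' q, h q q.2, hpq, ?_⟩
  rw [← ap_rs, ap_eq_zero_of_le hm (Finset.subset_biUnion_of_mem (fun p : W => s p) hq)
    (hs q q.2), map_zero]

lemma LFin.homology {K : CochainComplex X.Modules ℤ} (e : Finset I → (K ⟶ K)) (l : ℤ)
    (he : LFin fun s => (e s).f l) :
    LFin fun s => HomologicalComplex.homologyMap (e s) l := by
  intro W x p hp
  obtain ⟨W₁, h₁, hp₁, z, hz⟩ := locIm_of_epi (K.homologyπ l) x p hp
  obtain ⟨W₂, h₂, hp₂, s, hs⟩ := he W₁ (ap (K.iCycles l) W₁ z) p hp₁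
  refine ⟨W₂, h₂.trans h₁, hp₂, s, ?_⟩
  rw [← rs_rs h₂ h₁, ← hz, ← ap_rs, ← ap_comp,
    HomologicalComplex.homologyπ_naturality, ap_comp]
  have : ap (HomologicalComplex.cyclesMap (e s) l) W₂ (rs _ h₂ z) = 0 := by
    refine inj_of_mono (K.iCycles l) ?_
    rw [← ap_comp, HomologicalComplex.cyclesMap_i, ap_comp, ap_rs]
    exact hs
  rw [this, map_zero]

end LFin

section Coproduct

variable {X : Scheme.{u}} [HasDerivedCategory.{u + 1} X.Modules] {I : Type*}
  [HasColimitsOfShape (Discrete I) X.Modules] (K : I → CochainComplex X.Modules ℤ)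

/-- The inclusion of a component of a coproduct in the derived category. -/
abbrev ci (i : I) : Q.obj (K i) ⟶ Q.obj (∐ K) := Q.map (Sigma.ι K i)

/-- The endomorphism killing finitely many components. -/
abbrev co (s : Finset I) : Q.obj (∐ K) ⟶ Q.obj (∐ K) := Q.map (off K s)

open Classical in
/-- The projection to a component. -/
abbrev cq (i : I) : Q.obj (∐ K) ⟶ Q.obj (K i) := Q.map (Sigma.π K i)

lemma ci_cq (i : I) : ci K i ≫ cq K i = 𝟙 _ := by
  classical
  rw [← Functor.map_comp, Sigma.ι_π_eq_id, CategoryTheory.Functor.map_id]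

lemma ci_cq_ne {i j : I} (h : i ≠ j) : ci K i ≫ cq K j = 0 := by
  classical
  rw [← Functor.map_comp, Sigma.ι_π_of_ne K h, Functor.map_zero]

lemma co_co_of_le {s t : Finset I} (h : s ⊆ t) : co K s ≫ co K t = co K t := by
  rw [← Functor.map_comp, off_off_of_le K h]

lemma one_sub_co (s : Finset I) : 𝟙 (Q.obj (∐ K)) - co K s = ∑ i ∈ s, cq K i ≫ ci K i := by
  rw [← CategoryTheory.Functor.map_id, ← Functor.map_sub, one_sub_off, Functor.map_sum]
  simp only [Functor.map_comp]

lemma coproduct_f_ext (l : ℤ) {Z : X.Modules} (φ : (∐ K).X l ⟶ Z)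
    (h : ∀ i, (Sigma.ι K i).f l ≫ φ = 0) : φ = 0 := by
  have hc := isColimitOfPreserves (HomologicalComplex.eval X.Modules (ComplexShape.up ℤ) l)
    (coproductIsCoproduct K)
  exact hc.hom_ext fun i => (h i.as).trans comp_zero.symm

lemma lfin_off (l : ℤ) : LFin fun s => (off K s).f l := by
  refine lfin_of_jointly_epi _ (fun s t h => ?_) (fun i => (K i).X l)
    (fun i => (Sigma.ι K i).f l) (fun φ h => coproduct_f_ext K l φ h) fun i => ?_
  · rw [← HomologicalComplex.comp_f, off_off_of_le K h]
  · rw [← HomologicalComplex.comp_f, ι_off_mem K (Finset.mem_singleton_self i)]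
    rfl

/-- Homology of a complex as the zeroth homology of a shift. -/
def hsQ (X : Scheme.{u}) [HasDerivedCategory.{u + 1} X.Modules] (k : ℤ) :
    Q ⋙ shiftFunctor (DerivedCategory X.Modules) k ⋙ homologyFunctor X.Modules 0 ≅
      HomologicalComplex.homologyFunctor X.Modules (ComplexShape.up ℤ) k :=
  Functor.isoWhiskerLeft Q (hshift X.Modules k) ≪≫ homologyFunctorFactors X.Modules k

lemma lfin_co (k : ℤ) :
    LFin fun s => (homologyFunctor X.Modules 0).map ((co K s)⟦k⟧') := by
  refine (LFin.homology (off K) k (lfin_off K k)).of_iso ((hsQ X k).app (∐ K)).symm fun s => ?_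
  exact ((hsQ X k).inv.naturality (off K s)).symm

lemma H_co_of_le (k : ℤ) (s t : Finset I) (h : s ⊆ t) :
    (homologyFunctor X.Modules 0).map ((co K s)⟦k⟧') ≫
      (homologyFunctor X.Modules 0).map ((co K t)⟦k⟧') =
    (homologyFunctor X.Modules 0).map ((co K t)⟦k⟧') := by
  rw [← Functor.map_comp, ← Functor.map_comp, co_co_of_le K h]

lemma exists_co_eq_zero (k : ℤ) {W : X.Opens} (hW : IsCompact (W : Set X))
    (x : Γ(H0 ((Q.obj (∐ K))⟦k⟧), W)) :
    ∃ s, ap ((homologyFunctor X.Modules 0).map ((co K s)⟦k⟧')) W x = 0 :=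
  (lfin_co K k).exists_of_isCompact (H_co_of_le K k) hW x

/-- Zeroth homology of a shift of a morphism. -/
abbrev hk {A B : DerivedCategory X.Modules} (k : ℤ) (f : A ⟶ B) : H0 (A⟦k⟧) ⟶ H0 (B⟦k⟧) :=
  (homologyFunctor X.Modules 0).map (f⟦k⟧')

lemma hk_comp {A B C : DerivedCategory X.Modules} (k : ℤ) (f : A ⟶ B) (g : B ⟶ C) :
    hk k (f ≫ g) = hk k f ≫ hk k g := by
  rw [hk, Functor.map_comp, Functor.map_comp]

lemma ap_sum {F G : X.Modules} {J : Type*} (s : Finset J) (f : J → (F ⟶ G)) (W : X.Opens)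
    (x : Γ(F, W)) : ap (∑ j ∈ s, f j) W x = ∑ j ∈ s, ap (f j) W x := by
  classical
  induction s using Finset.induction_on with
  | empty => simp [ap_zero]
  | insert a s ha ih => rw [Finset.sum_insert ha, Finset.sum_insert ha, ap_add, ih]

lemma eq_sum_of_co (k : ℤ) {W : X.Opens} {x : Γ(H0 ((Q.obj (∐ K))⟦k⟧), W)} {s : Finset I}
    (h : ap (hk k (co K s)) W x = 0) :
    x = ∑ i ∈ s, ap (hk k (ci K i)) W (ap (hk k (cq K i)) W x) := by
  have h1 : hk k (𝟙 _ - co K s) = ∑ i ∈ s, hk k (cq K i) ≫ hk k (ci K i) := by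
    rw [one_sub_co, hk, Functor.map_sum, Functor.map_sum]
    exact Finset.sum_congr rfl fun i _ => hk_comp k _ _
  have h2 : hk k (𝟙 _ - co K s) = 𝟙 _ - hk k (co K s) := by
    rw [hk, Functor.map_sub, Functor.map_sub, CategoryTheory.Functor.map_id, CategoryTheory.Functor.map_id]
  have h3 := congr(ap $(h2.symm.trans h1) W x)
  rw [ap_sub, ap_id, h, sub_zero, ap_sum] at h3
  exact h3.trans (Finset.sum_congr rfl fun i _ => ap_comp _ _ _)

lemma dqc_coproduct (h : ∀ i, Dqc (Q.obj (K i))) : Dqc (Q.obj (∐ K)) := by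
  intro k
  rw [isQuasicoherent_iff_loc]
  intro W hW f
  have hl : ∀ i, Loc (H0 ((Q.obj (K i))⟦k⟧)) (X.basicOpen_le f) f := fun i =>
    isQuasicoherent_iff_loc.1 (h i k) W hW f
  refine (loc_iff _ _).2 ⟨fun x hx => ?_, fun t => ?_⟩
  · obtain ⟨s, hs⟩ := exists_co_eq_zero K k hW.isCompact x
    have h1 : ∀ i, ∃ n : ℕ, f ^ n • ap (hk k (cq K i)) W x = 0 := fun i =>
      ((loc_iff _ _).1 (hl i)).1 _ (by rw [← ap_rs, hx, map_zero])
    choose n hn using h1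
    refine ⟨s.sup n, ?_⟩
    rw [eq_sum_of_co K k hs, Finset.smul_sum]
    refine Finset.sum_eq_zero fun i hi => ?_
    obtain ⟨m, hm⟩ := Nat.exists_eq_add_of_le (Finset.le_sup (f := n) hi)
    rw [← ap_smul, hm, add_comm, pow_add, mul_smul, hn, smul_zero, map_zero]
  · obtain ⟨s, hs⟩ := exists_co_eq_zero K k (hW.basicOpen f).isCompact t
    have h1 : ∀ i, ∃ (n : ℕ) (y : Γ(H0 ((Q.obj (K i))⟦k⟧), W)), rs _ (X.basicOpen_le f) y =
        ors (X.basicOpen_le f) f ^ n • ap (hk k (cq K i)) _ t := fun i =>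
      ((loc_iff _ _).1 (hl i)).2 _
    choose n y hy using h1
    refine ⟨s.sup n, ∑ i ∈ s, f ^ (s.sup n - n i) • ap (hk k (ci K i)) W (y i), ?_⟩
    rw [map_sum]
    conv_rhs => rw [eq_sum_of_co K k hs, Finset.smul_sum]
    refine Finset.sum_congr rfl fun i hi => ?_
    rw [rs_smul, ← ap_rs, hy, ap_smul, smul_smul, map_pow, ← pow_add,
      Nat.sub_add_cancel (Finset.le_sup (f := n) hi)]

open Classical in
lemma isIso_Q_coproduct_map {K' : I → CochainComplex X.Modules ℤ} (t : ∀ i, K' i ⟶ K i)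
    (ht : ∀ i, IsIso (Q.map (t i))) : IsIso (Q.map (Limits.Sigma.map t)) := by
  have h1 : ∀ i, ci K' i ≫ Q.map (Limits.Sigma.map t) = Q.map (t i) ≫ ci K i := fun i => by
    rw [← Functor.map_comp, ← Functor.map_comp, Sigma.ι_map]
  have h2 : ∀ i, Q.map (Limits.Sigma.map t) ≫ cq K i = cq K' i ≫ Q.map (t i) := fun i => by
    rw [← Functor.map_comp, ← Functor.map_comp]
    congr 1
    refine Sigma.hom_ext _ _ fun j => ?_
    rw [Sigma.ι_map_assoc]
    by_cases h : j = i
    · subst h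
      rw [Sigma.ι_π_eq_id, ← Category.assoc, Sigma.ι_π_eq_id, Category.comp_id, Category.id_comp]
    · rw [Sigma.ι_π_of_ne K h, ← Category.assoc, Sigma.ι_π_of_ne K' h, comp_zero, zero_comp]
  refine isIso_of_H0 _ fun k => ?_
  have hb : ∀ i W, Function.Bijective (ap (hk k (Q.map (t i))) W) := fun i W =>
    bij_of_isIso _ W
  have : Mono (hk k (Q.map (Limits.Sigma.map t))) := mono_of_inj fun W x hx => by
    refine sec_ext fun p hp => ?_
    obtain ⟨W', hW, hp', s, hs⟩ := lfin_co K' k W x p hp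
    refine ⟨W', hW, hp', ?_⟩
    rw [eq_sum_of_co K' k hs, map_zero]
    refine Finset.sum_eq_zero fun i _ => ?_
    have h3 : ap (hk k (cq K' i)) W' (rs _ hW x) = 0 := by
      refine (hb i W').1 ?_
      rw [← ap_comp, ← hk_comp, ← h2, hk_comp, ap_comp, ap_rs, hx, map_zero, map_zero, map_zero]
    rw [h3, map_zero]
  have : Epi (hk k (Q.map (Limits.Sigma.map t))) := epi_of_locIm fun W y p hp => by
    obtain ⟨W', hW, hp', s, hs⟩ := lfin_co K k W y p hp
    choose x hx using fun i => (hb i W').2 (ap (hk k (cq K i)) W' (rs _ hW y))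
    refine ⟨W', hW, hp', ∑ i ∈ s, ap (hk k (ci K' i)) W' (x i), ?_⟩
    rw [map_sum, eq_sum_of_co K k hs]
    refine Finset.sum_congr rfl fun i _ => ?_
    rw [← ap_comp, ← hk_comp, h1, hk_comp, ap_comp, hx]
  exact isIso_of_mono_of_epi (hk k (Q.map (Limits.Sigma.map t)))

end Coproduct

section Factor

variable {C : Type u} [Category.{v} C] [Abelian C] [HasDerivedCategory.{w} C]

lemma exists_homotopy_of_Q_map_eq_zero {K L : CochainComplex C ℤ} (g : K ⟶ L)
    (h : Q.map g = 0) : ∃ (K' : CochainComplex C ℤ) (t : K' ⟶ K), IsIso (Q.map t) ∧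
      Nonempty (Homotopy (t ≫ g) 0) := by
  have h1 : Qh.map ((HomotopyCategory.quotient C (ComplexShape.up ℤ)).map g) =
      Qh.map ((HomotopyCategory.quotient C (ComplexShape.up ℤ)).map 0) := by
    refine Eq.trans (show _ = Q.map g from rfl) (h.trans ?_)
    rw [Functor.map_zero, Functor.map_zero]
    rfl
  obtain ⟨K', t, ht, e⟩ := (MorphismProperty.map_eq_iff_precomp Qh
    (HomotopyCategory.quasiIso C (ComplexShape.up ℤ)) _ _).1 h1
  obtain ⟨K', rfl⟩ := HomotopyCategory.quotient_obj_surjective K'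
  obtain ⟨t, rfl⟩ := (HomotopyCategory.quotient _ _).map_surjective t
  rw [← isIso_Qh_map_iff] at ht
  refine ⟨K', t, ht, ⟨HomotopyCategory.homotopyOfEq _ _ ?_⟩⟩
  rw [Functor.map_comp, e, ← Functor.map_comp, comp_zero]

open CochainComplex HomComplex in
lemma exists_factor_acyclic {K L : CochainComplex C ℤ} (g : K ⟶ L) (h : Q.map g = 0) :
    ∃ (K' : CochainComplex C ℤ) (t : K' ⟶ K) (Z : CochainComplex C ℤ) (i : K' ⟶ Z)
      (j : Z ⟶ L), IsIso (Q.map t) ∧ IsZero (Q.obj Z) ∧ t ≫ g = i ≫ j := by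
  obtain ⟨K', t, ht, ⟨H⟩⟩ := exists_homotopy_of_Q_map_eq_zero g h
  have hz := (Cochain.equivHomotopy _ _ H).2
  refine ⟨K', t, mappingCone (𝟙 K'), mappingCone.inr (𝟙 K'),
    mappingCone.desc (𝟙 K') (Cochain.equivHomotopy _ _ H).1 (t ≫ g) ?_, ht, ?_, ?_⟩
  · rw [Category.id_comp]
    refine Eq.symm (hz.trans ?_)
    exact (congrArg (_ + ·) (Cochain.ofHom_zero _ _)).trans (add_zero _)
  · rw [IsZero.iff_id_eq_zero, ← CategoryTheory.Functor.map_id]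
    exact (Q_map_eq_of_homotopy C (mappingCone.homotopyToZeroOfId K')).trans
      (Functor.map_zero _ _ _)
  · rw [mappingCone.inr_desc]

end Factor

section HomOut

variable {X : Scheme.{u}} [HasDerivedCategory.{u + 1} X.Modules] {I : Type*}
  [HasColimitsOfShape (Discrete I) X.Modules] (K : I → CochainComplex X.Modules ℤ)

lemma isZero_Q_coproduct (h : ∀ i, IsZero (Q.obj (K i))) : IsZero (Q.obj (∐ K)) := by
  have := isIso_Q_coproduct_map K (K' := K) (fun _ => 0) fun i => by
    rw [Functor.map_zero]
    exact isIso_of_source_target_iso_zero _ (h i).isoZero (h i).isoZero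
  have h0 : Limits.Sigma.map (fun i => (0 : K i ⟶ K i)) = 0 :=
    Sigma.hom_ext _ _ fun i => by rw [Sigma.ι_map, zero_comp, comp_zero]
  rw [h0, Functor.map_zero] at this
  rw [IsZero.iff_id_eq_zero]
  rw [← cancel_epi (0 : Q.obj (∐ K) ⟶ Q.obj (∐ K)), zero_comp, zero_comp]

lemma coproduct_map_eq_zero {L : CochainComplex X.Modules ℤ} (g : ∐ K ⟶ L)
    (h : ∀ i, Q.map (Sigma.ι K i ≫ g) = 0) : Q.map g = 0 := by
  choose K' t Z a b ht hZ e using fun i => exists_factor_acyclic _ (h i)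
  have h1 := isIso_Q_coproduct_map K t ht
  have h2 : Limits.Sigma.map t ≫ g = Limits.Sigma.map a ≫ Sigma.desc b :=
    Sigma.hom_ext _ _ fun i => by
      rw [Sigma.ι_map_assoc, e, Sigma.ι_map_assoc, Sigma.ι_desc]
  rw [← cancel_epi (Q.map (Limits.Sigma.map t)), ← Functor.map_comp, h2, Functor.map_comp,
    (isZero_Q_coproduct Z hZ).eq_of_tgt (Q.map _) 0, zero_comp, comp_zero]

lemma coproduct_hom_ext {E : DerivedCategory X.Modules} (ζ : Q.obj (∐ K) ⟶ E)
    (h : ∀ i, ci K i ≫ ζ = 0) : ζ = 0 := by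
  obtain ⟨L, ⟨e⟩⟩ := exists_iso_Q E
  obtain ⟨L', g, s, hs, hg⟩ := left_fac (ζ ≫ e.inv)
  have h1 : Q.map g = 0 := coproduct_map_eq_zero K g fun i => by
    rw [← cancel_mono (inv (Q.map s)), Functor.map_comp, Category.assoc, ← hg,
      ← Category.assoc, h, zero_comp, zero_comp]
  rw [← cancel_mono e.inv, hg, h1, zero_comp, zero_comp]

lemma DF_coproduct_hom_ext (G : X.Modules ⥤ X.Modules) [G.Additive]
    [PreservesFiniteLimits G] [PreservesFiniteColimits G] [G.IsLeftAdjoint]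
    {E : DerivedCategory X.Modules} (ζ : (DF G).obj (Q.obj (∐ K)) ⟶ E)
    (h : ∀ i, (DF G).map (ci K i) ≫ ζ = 0) : ζ = 0 := by
  have : PreservesColimitsOfShape (Discrete I) (cx G) :=
    HomologicalComplex.preservesColimitsOfShape_of_eval _ fun i => by
      change PreservesColimitsOfShape (Discrete I)
        (HomologicalComplex.eval X.Modules (ComplexShape.up ℤ) i ⋙ G)
      have : PreservesColimitsOfSize.{0, 0} G := (Adjunction.ofIsLeftAdjoint G).leftAdjoint_preservesColimits
      infer_instance
  have h1 : IsIso (sigmaComparison (cx G) K) := inferInstance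
  rw [← cancel_epi (dfac G (∐ K)).inv, comp_zero,
    ← cancel_epi (Q.map (sigmaComparison (cx G) K)), comp_zero]
  refine coproduct_hom_ext _ _ fun i => ?_
  rw [← Category.assoc, ← Functor.map_comp, ι_comp_sigmaComparison, ← Category.assoc]
  have h2 : Q.map ((cx G).map (Sigma.ι K i)) ≫ (dfac G (∐ K)).inv =
      (dfac G (K i)).inv ≫ (DF G).map (ci K i) := by
    rw [Iso.comp_inv_eq, Category.assoc, dfac_naturality, Iso.inv_hom_id_assoc]
  rw [h2, Category.assoc, h, comp_zero]

end HomOut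

section ShiftHom

variable {D : Type*} [Category D] [Preadditive D] [HasShift D ℤ]
  [∀ n : ℤ, (shiftFunctor D n).Additive]

/-- The unit isomorphism of the shift equivalence. -/
def ush (k : ℤ) (A : D) : A ≅ (A⟦k⟧)⟦-k⟧ := (shiftEquiv D k).unitIso.app A

/-- Transport of a morphism out of a shift. -/
def unsh {A B : D} (k : ℤ) (ζ : A⟦k⟧ ⟶ B) : A ⟶ B⟦-k⟧ := (ush k A).hom ≫ ζ⟦-k⟧'

lemma unsh_comp {A B B' : D} (k : ℤ) (ζ : A⟦k⟧ ⟶ B) (φ : B ⟶ B') :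
    unsh k (ζ ≫ φ) = unsh k ζ ≫ φ⟦-k⟧' := by
  rw [unsh, unsh, Functor.map_comp, Category.assoc]

lemma unsh_injective {A B : D} (k : ℤ) : Function.Injective (unsh (A := A) (B := B) k) :=
  fun _ _ h => (shiftFunctor D (-k)).map_injective ((cancel_epi _).1 h)

lemma unsh_zero {A B : D} (k : ℤ) : unsh k (0 : A⟦k⟧ ⟶ B) = 0 := by
  rw [unsh, Functor.map_zero, comp_zero]

lemma unsh_surjective {A B : D} (k : ℤ) : Function.Surjective (unsh (A := A) (B := B) k) := by
  intro ξ
  obtain ⟨ζ, hζ⟩ := (shiftFunctor D (-k)).map_surjective ((ush k A).inv ≫ ξ)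
  exact ⟨ζ, (congrArg (_ ≫ ·) hζ).trans (Iso.hom_inv_id_assoc _ _)⟩

lemma eq_zero_of_unsh {A B : D} (k : ℤ) {ζ : A⟦k⟧ ⟶ B} (h : unsh k ζ = 0) : ζ = 0 :=
  unsh_injective k (h.trans (unsh_zero k).symm)

end ShiftHom

section Smallness

variable {D : Type v} [Category.{w} D] [Preadditive D] [HasZeroObject D] [HasShift D ℤ]
  [∀ n : ℤ, (shiftFunctor D n).Additive] [Pretriangulated D]

lemma small_hom_tri (L : D) : TriClass (fun N : D => ∀ n : ℤ, Small.{u} (N⟦n⟧ ⟶ L)) := by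
  refine TriClass.of_shifts (Q := fun N => Small.{u} (N ⟶ L)) ?_ ?_ ?_
  · intro A hA
    have : Subsingleton (A ⟶ L) := ⟨fun f g => hA.eq_of_src f g⟩
    infer_instance
  · intro A B e h
    exact small_of_injective (f := fun ζ : B ⟶ L => e.hom ≫ ζ) fun _ _ h => (cancel_epi e.hom).1 h
  · rintro Z A B E A' e f g h - ⟨x, hT⟩ - - hA hE -
    classical
    let F : (A ⟶ L) × (E ⟶ L) → (B ⟶ L) := fun p =>
      (if h : ∃ b, f ≫ b = p.1 then h.choose else 0) + g ≫ p.2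
    refine small_of_surjective (f := F) fun b => ?_
    have hb : ∃ b', f ≫ b' = f ≫ b := ⟨b, rfl⟩
    obtain ⟨c, hc⟩ := hT.desc₃ (b - hb.choose) (by
      rw [Preadditive.comp_sub, hb.choose_spec, sub_self])
    refine ⟨(f ≫ b, c), ?_⟩
    change (if h : ∃ b', f ≫ b' = f ≫ b then h.choose else 0) + g ≫ c = b
    rw [dif_pos hb, ← hc, add_sub_cancel]

end Smallness

section Compactness

variable {X : Scheme.{u}} [HasDerivedCategory.{u + 1} X.Modules]

/-- Objects generated by extensions by zero from affine open subsets. -/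
abbrev GenAff : DerivedCategory X.Modules → Prop :=
  Gen (fun A => ∃ V : X.Opens, IsAffineOpen V ∧ A = OD V)

lemma GenAff.small {N L : DerivedCategory X.Modules} (hN : GenAff N) (hL : Dqc L) (n : ℤ) :
    Small.{u} (N⟦n⟧ ⟶ L) := by
  revert n
  refine hN _ (small_hom_tri L) ?_
  rintro _ ⟨V, hV, rfl⟩ n
  have h1 : Function.Injective (fun ζ : (OD V)⟦n⟧ ⟶ L => sg V (L⟦-n⟧) (unsh n ζ)) :=
    (B0_shift hL (-n) V hV).1.comp (unsh_injective n)
  exact small_of_injective h1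

variable {I : Type*} [HasColimitsOfShape (Discrete I) X.Modules]
  (K : I → CochainComplex X.Modules ℤ)

lemma co_tri : TriClass (fun N : DerivedCategory X.Modules =>
    ∀ (n : ℤ) (ζ : N⟦n⟧ ⟶ Q.obj (∐ K)), ∃ s, ζ ≫ co K s = 0) := by
  classical
  refine TriClass.of_shifts (Q := fun N => ∀ ζ : N ⟶ Q.obj (∐ K), ∃ s, ζ ≫ co K s = 0) ?_ ?_ ?_
  · intro A hA ζ
    exact ⟨∅, hA.eq_of_src _ _⟩
  · intro A B e h ζ
    obtain ⟨s, hs⟩ := h (e.hom ≫ ζ)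
    exact ⟨s, by rwa [Category.assoc, Preadditive.IsIso.comp_left_eq_zero] at hs⟩
  · rintro Z A B E A' e f g h - ⟨x, hT⟩ - - hA hE - ζ
    obtain ⟨s, hs⟩ := hA (f ≫ ζ)
    obtain ⟨ζ', hζ'⟩ := hT.desc₃ (ζ ≫ co K s) (by rwa [Category.assoc] at hs)
    obtain ⟨t, ht⟩ := hE ζ'
    refine ⟨s ∪ t, ?_⟩
    rw [← co_co_of_le K (Finset.subset_union_left : s ⊆ s ∪ t), ← Category.assoc, hζ',
      ← co_co_of_le K (Finset.subset_union_right : t ⊆ s ∪ t), Category.assoc, ← Category.assoc ζ',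
      ht, zero_comp, comp_zero]

lemma GenAff.exists_co {N : DerivedCategory X.Modules} (hN : GenAff N)
    (hK : ∀ i, Dqc (Q.obj (K i))) (n : ℤ) (ζ : N⟦n⟧ ⟶ Q.obj (∐ K)) :
    ∃ s, ζ ≫ co K s = 0 := by
  revert n
  refine hN _ (co_tri K) ?_
  rintro _ ⟨V, hV, rfl⟩ n ζ
  obtain ⟨s, hs⟩ := exists_co_eq_zero K (-n) hV.isCompact (sg V _ (unsh n ζ))
  refine ⟨s, eq_zero_of_unsh n ((B0_shift (dqc_coproduct K hK) (-n) V hV).1 ?_)⟩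
  rw [unsh_comp, sg_comp, hs, map_zero]

end Compactness

section Attaching

variable {X : Scheme.{u}} [HasDerivedCategory.{u + 1} X.Modules]

lemma exists_roof {N : DerivedCategory X.Modules} {L : CochainComplex X.Modules ℤ}
    (f : N ⟶ Q.obj L) :
    ∃ (A : CochainComplex X.Modules ℤ) (g : A ⟶ L) (θ : Q.obj A ≅ N), θ.hom ≫ f = Q.map g := by
  obtain ⟨K, ⟨e⟩⟩ := exists_iso_Q N
  obtain ⟨A, s, hs, g, hg⟩ := right_fac (e.hom ≫ f)
  refine ⟨A, g, asIso (Q.map s) ≪≫ e, ?_⟩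
  rw [Iso.trans_hom, asIso_hom, Category.assoc, hg, IsIso.hom_inv_id_assoc]

/-- Every complex with quasi-coherent cohomology maps to another one so that all morphisms from
given shifts of an object become zero. -/
lemma exists_attach {N : DerivedCategory X.Modules} (hN : Dqc N) (hN' : GenAff N)
    (L : CochainComplex X.Modules ℤ) (hL : Dqc (Q.obj L)) (m : ℤ) :
    ∃ (L' : CochainComplex X.Modules ℤ) (t : L ⟶ L') (P : DerivedCategory X.Modules)
      (p : P ⟶ Q.obj L) (x : Q.obj L' ⟶ P⟦(1 : ℤ)⟧), Dqc (Q.obj L') ∧ DT p (Q.map t) x ∧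
      (∀ n ≤ m, ∀ f : N⟦n⟧ ⟶ Q.obj L, f ≫ Q.map t = 0) ∧
      ∀ (U : X.Opens) (E : DerivedCategory X.Modules),
        (∀ n ≤ m, ∀ f : (DJ U).obj (N⟦n⟧) ⟶ E, f = 0) → ∀ f : (DJ U).obj P ⟶ E, f = 0 := by
  have (n : ℤ) : Small.{u} (N⟦n⟧ ⟶ Q.obj L) := hN'.small hL n
  let I : Type u := Σ n : {n : ℤ // n ≤ m}, Shrink.{u} (N⟦n.1⟧ ⟶ Q.obj L)
  choose A g θ hg using fun i : I => exists_roof ((equivShrink (N⟦i.1.1⟧ ⟶ Q.obj L)).symm i.2)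
  let φ : ∐ A ⟶ L := Limits.Sigma.desc g
  have hT : ∃ x, DT (Q.map φ) (Q.map (CochainComplex.mappingCone.inr φ)) x :=
    ⟨_, DerivedCategory.mappingCone_triangle_distinguished φ⟩
  obtain ⟨x, hT⟩ := hT
  have hA : Dqc (Q.obj (∐ A)) := dqc_coproduct A fun i =>
    dqc_tri.iso (θ i).symm (dqc_tri.shift hN i.1.1)
  have hci (i : I) : ci A i ≫ Q.map φ = Q.map (g i) := by
    rw [← Functor.map_comp]
    exact congrArg Q.map (Limits.Sigma.ι_desc g i)
  refine ⟨_, CochainComplex.mappingCone.inr φ, _, Q.map φ, x, dqc_tri.ext₃ hT hA hL, hT, ?_, ?_⟩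
  · intro n hn f
    let i : I := ⟨⟨n, hn⟩, equivShrink _ f⟩
    have hf : (θ i).hom ≫ f = ci A i ≫ Q.map φ := by
      rw [hci, ← hg]
      exact congrArg _ (Equiv.symm_apply_apply _ _).symm
    rw [← cancel_epi (θ i).hom, ← Category.assoc, hf, Category.assoc, hT.comp₁₂, comp_zero,
      comp_zero]
  · intro U E h f
    refine DF_coproduct_hom_ext A (J U) f fun i => ?_
    have := h i.1.1 i.1.2 ((DJ U).map (θ i).inv ≫ (DJ U).map (ci A i) ≫ f)
    rwa [Preadditive.IsIso.comp_left_eq_zero] at this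

end Attaching

section Telescope

variable {D : Type*} [Category* D] [HasZeroObject D] [HasShift D ℤ] [Preadditive D]
  [∀ n : ℤ, (shiftFunctor D n).Additive] [Pretriangulated D]

/-- The structure of a coproduct of a sequence, with its shift endomorphism. -/
structure Tele (A : ℕ → D) (t : ∀ i, A i ⟶ A (i + 1)) (P : D) where
  c : ∀ i, A i ⟶ P
  q : ∀ i, P ⟶ A i
  e : Finset ℕ → (P ⟶ P)
  s : P ⟶ P
  c_q : ∀ i, c i ≫ q i = 𝟙 _
  c_q_ne : ∀ {i j}, i ≠ j → c i ≫ q j = 0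
  one_sub : ∀ F : Finset ℕ, 𝟙 P - e F = ∑ i ∈ F, q i ≫ c i
  c_s : ∀ i, c i ≫ s = t i ≫ c (i + 1)
  s_q : ∀ j, s ≫ q (j + 1) = q j ≫ t j
  s_q_zero : s ≫ q 0 = 0

variable {A : ℕ → D} {t : ∀ i, A i ⟶ A (i + 1)} {P : D} (H : Tele A t P)

/-- The composite transition morphisms of a sequence. -/
def tcomp {A : ℕ → D} (t : ∀ i, A i ⟶ A (i + 1)) : ∀ n, A 0 ⟶ A n
  | 0 => 𝟙 _
  | n + 1 => tcomp t n ≫ t n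

namespace Tele

lemma eq_sum {C : D} {ζ : C ⟶ P} {F : Finset ℕ} (h : ζ ≫ H.e F = 0) :
    ζ = ∑ i ∈ F, (ζ ≫ H.q i) ≫ H.c i := by
  calc ζ = ζ ≫ (𝟙 P - H.e F) := by rw [Preadditive.comp_sub, h, sub_zero, Category.comp_id]
    _ = _ := by simp only [H.one_sub, Preadditive.comp_sum, Category.assoc]

lemma eq_zero_of_q {C : D} {ζ : C ⟶ P} (hC : ∃ F, ζ ≫ H.e F = 0) (h : ∀ j, ζ ≫ H.q j = 0) :
    ζ = 0 := by
  obtain ⟨F, hF⟩ := hC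
  rw [H.eq_sum hF]
  exact Finset.sum_eq_zero fun i _ => by rw [h, zero_comp]

lemma eq_zero_of_comp {C : D} {ξ : C ⟶ P} (hC : ∃ F, ξ ≫ H.e F = 0)
    (h : ξ ≫ (𝟙 P - H.s) = 0) : ξ = 0 := by
  rw [Preadditive.comp_sub, Category.comp_id, sub_eq_zero] at h
  refine H.eq_zero_of_q hC fun j => ?_
  induction j with
  | zero => rw [h, Category.assoc, H.s_q_zero, comp_zero]
  | succ j ih => rw [h, Category.assoc, H.s_q, ← Category.assoc, ih, zero_comp]

variable {T : D} {p : P ⟶ T} {d : T ⟶ P⟦(1 : ℤ)⟧}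

lemma c_p (hT : DT (𝟙 P - H.s) p d) (i : ℕ) : H.c i ≫ p = t i ≫ H.c (i + 1) ≫ p := by
  have := congrArg (H.c i ≫ ·) hT.comp₁₂
  simp only [comp_zero, Preadditive.sub_comp, Category.id_comp, Preadditive.comp_sub] at this
  rw [sub_eq_zero] at this
  rw [this, ← Category.assoc, H.c_s, Category.assoc]

lemma comp_eq_zero (hT : DT (𝟙 P - H.s) p d) {S : D}
    (ht : ∀ (i : ℕ) (n : ℤ), n ≤ i → ∀ x : S⟦n⟧ ⟶ A i, x ≫ t i = 0) (r : ℕ) (n : ℤ) (i : ℕ)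
    (h : n ≤ i + r) (x : S⟦n⟧ ⟶ A i) : x ≫ H.c i ≫ p = 0 := by
  induction r generalizing i with
  | zero => rw [H.c_p hT, ← Category.assoc, ht i n (by simpa using h), zero_comp]
  | succ r ih =>
    rw [H.c_p hT, ← Category.assoc]
    exact ih (i + 1) (by push_cast at h ⊢; linarith) _

lemma hom_eq_zero (hT : DT (𝟙 P - H.s) p d) {S : D}
    (hS : ∀ (n : ℤ) (ζ : S⟦n⟧ ⟶ P), ∃ F, ζ ≫ H.e F = 0)
    (ht : ∀ (i : ℕ) (n : ℤ), n ≤ i → ∀ x : S⟦n⟧ ⟶ A i, x ≫ t i = 0) (n : ℤ) (f : S⟦n⟧ ⟶ T) :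
    f = 0 := by
  have hd : f ≫ d = 0 := by
    let e : (S⟦n - 1⟧)⟦(1 : ℤ)⟧ ≅ S⟦n⟧ := (shiftFunctorAdd' D (n - 1) 1 n (by ring)).symm.app S
    obtain ⟨ξ, hξ⟩ := (shiftFunctor D (1 : ℤ)).map_surjective (e.hom ≫ f ≫ d)
    have : ξ = 0 := by
      refine H.eq_zero_of_comp (hS _ ξ) ((shiftFunctor D (1 : ℤ)).map_injective ?_)
      rw [Functor.map_comp, hξ, Functor.map_zero, Category.assoc, Category.assoc, hT.comp₃₁,
        comp_zero, comp_zero]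
    rw [this, Functor.map_zero] at hξ
    exact (Preadditive.IsIso.comp_left_eq_zero e.hom _).1 hξ.symm
  obtain ⟨g, rfl⟩ := hT.lift₂ f hd
  obtain ⟨F, hF⟩ := hS n g
  rw [H.eq_sum hF, Preadditive.sum_comp]
  refine Finset.sum_eq_zero fun i _ => ?_
  rw [Category.assoc]
  exact H.comp_eq_zero hT ht n.toNat n i (by have := Int.self_le_toNat n; linarith) _

lemma exists_tcomp_eq_zero (hT : DT (𝟙 P - H.s) p d) (hz : p = 0) {C : D}
    (hC : ∀ ζ : C ⟶ P, ∃ F, ζ ≫ H.e F = 0) (k : C ⟶ A 0) : ∃ n, k ≫ tcomp t n = 0 := by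
  obtain ⟨ζ, hζ⟩ := hT.lift₁ (k ≫ H.c 0) (by rw [hz, comp_zero])
  rw [Preadditive.comp_sub, Category.comp_id] at hζ
  have key (n : ℕ) : ζ ≫ H.q n = k ≫ tcomp t n := by
    induction n with
    | zero =>
      have := congrArg (· ≫ H.q 0) hζ
      simp only [Preadditive.sub_comp, Category.assoc, H.c_q, H.s_q_zero, comp_zero,
        sub_zero] at this
      exact this.symm
    | succ n ih =>
      have := congrArg (· ≫ H.q (n + 1)) hζ
      simp only [Preadditive.sub_comp, Category.assoc, H.c_q_ne (Nat.succ_ne_zero n).symm, H.s_q,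
        comp_zero] at this
      rw [sub_eq_zero.1 this.symm, ← Category.assoc, ih, Category.assoc]
      rfl
  obtain ⟨F, hF⟩ := hC ζ
  obtain ⟨j, hj⟩ := Infinite.exists_notMem_finset F
  refine ⟨j, ?_⟩
  rw [← key, H.eq_sum hF, Preadditive.sum_comp]
  refine Finset.sum_eq_zero fun i hi => ?_
  rw [Category.assoc, H.c_q_ne (ne_of_mem_of_not_mem hi hj), comp_zero]

end Tele

end Telescope

section Bounded

variable {D : Type*} [Category* D] [HasZeroObject D] [HasShift D ℤ] [Preadditive D]
  [∀ n : ℤ, (shiftFunctor D n).Additive]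

/-- Vanishing of the morphisms from `N` to a shift of `E`. -/
def Van (N E : D) (n : ℤ) : Prop := ∀ f : N ⟶ E⟦n⟧, f = 0

lemma Van.iso_left {N N' E : D} {n : ℤ} (e : N ≅ N') (h : Van N E n) : Van N' E n := fun f =>
  (Preadditive.IsIso.comp_left_eq_zero e.hom _).1 (h (e.hom ≫ f))

lemma van_shift (N E : D) (k n : ℤ) : Van (N⟦k⟧) E n ↔ Van N E (n - k) := by
  let e : (E⟦n⟧)⟦-k⟧ ≅ E⟦n - k⟧ := (shiftFunctorAdd' D n (-k) (n - k) (by ring)).symm.app E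
  constructor
  · intro h f
    obtain ⟨ζ, hζ⟩ := unsh_surjective k (f ≫ e.inv)
    rw [h ζ, unsh_zero] at hζ
    exact (Preadditive.IsIso.comp_right_eq_zero f e.inv).1 hζ.symm
  · intro h f
    refine eq_zero_of_unsh k ?_
    exact (Preadditive.IsIso.comp_right_eq_zero _ e.hom).1 (h (unsh k f ≫ e.hom))

/-- Objects without morphisms to large shifts of the objects of a given class. -/
def Bdd (S : D → Prop) (N : D) : Prop := ∃ a : ℤ, ∀ E, S E → ∀ n ≥ a, Van N E n

variable [Pretriangulated D]

lemma bdd_tri (S : D → Prop) : TriClass (Bdd S) where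
  zero hA := ⟨0, fun _ _ _ _ f => hA.eq_of_src f 0⟩
  iso e h := by
    obtain ⟨a, h⟩ := h
    exact ⟨a, fun E hE n hn => (h E hE n hn).iso_left e⟩
  shift h k := by
    obtain ⟨a, h⟩ := h
    exact ⟨a + k, fun E hE n hn => (van_shift _ _ _ _).2 (h E hE _ (by linarith))⟩
  ext hT hA hB := by
    obtain ⟨a, ha⟩ := hA
    obtain ⟨b, hb⟩ := hB
    refine ⟨max a b, fun E hE n hn f => ?_⟩
    obtain ⟨ζ, rfl⟩ := hT.desc₃ f (ha E hE n ((le_max_left a b).trans hn) _)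
    rw [hb E hE n ((le_max_right a b).trans hn) ζ, comp_zero]

end Bounded

section Tower

variable {X : Scheme.{u}} [HasDerivedCategory.{u + 1} X.Modules]

instance : HasColimitsOfShape (Discrete ℕ) X.Modules :=
  haveI := hasColimitsOfSizeShrink.{0, 0, u, u} X.Modules
  inferInstance

section Projections

variable {I : Type*} [HasColimitsOfShape (Discrete I) X.Modules]
  (K : I → CochainComplex X.Modules ℤ)

open Classical in
/-- The projection to a component of a coproduct of complexes. -/
def cπ (i : I) : ∐ K ⟶ K i := Limits.Sigma.π K i

lemma ι_cπ (i : I) : Limits.Sigma.ι K i ≫ cπ K i = 𝟙 _ := by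
  classical
  exact Limits.Sigma.ι_π_eq_id K i

lemma ι_cπ_ne {i j : I} (h : i ≠ j) : Limits.Sigma.ι K i ≫ cπ K j = 0 := by
  classical
  exact Limits.Sigma.ι_π_of_ne K h

end Projections

/-- The telescope of a sequence of complexes. -/
def tele (L : ℕ → CochainComplex X.Modules ℤ) (t : ∀ i, L i ⟶ L (i + 1)) :
    Tele (fun i => Q.obj (L i)) (fun i => Q.map (t i)) (Q.obj (∐ L)) where
  c i := ci L i
  q i := cq L i
  e F := co L F
  s := Q.map (Limits.Sigma.desc fun i => t i ≫ Limits.Sigma.ι L (i + 1))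
  c_q := ci_cq L
  c_q_ne := ci_cq_ne L
  one_sub := one_sub_co L
  c_s i := by
    rw [← Functor.map_comp, ← Functor.map_comp]
    exact congrArg Q.map (Limits.Sigma.ι_desc _ _)
  s_q j := by
    refine (Q.map_comp _ (cπ L (j + 1))).symm.trans (.trans ?_ (Q.map_comp (cπ L j) (t j)))
    refine congrArg Q.map (Limits.Sigma.hom_ext _ _ fun i => ?_)
    rw [Limits.Sigma.ι_desc_assoc, Category.assoc]
    by_cases h : i = j
    · subst h
      rw [ι_cπ, ← Category.assoc (Limits.Sigma.ι L i), ι_cπ, Category.comp_id, Category.id_comp]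
    · rw [ι_cπ_ne L (by simpa using h), ← Category.assoc (Limits.Sigma.ι L i), ι_cπ_ne L h,
        comp_zero, zero_comp]
  s_q_zero := by
    refine (Q.map_comp _ (cπ L 0)).symm.trans (.trans ?_ (Q.map_zero _ _))
    refine congrArg Q.map (Limits.Sigma.hom_ext _ _ fun i => ?_)
    rw [Limits.Sigma.ι_desc_assoc, Category.assoc, ι_cπ_ne L (Nat.succ_ne_zero i), comp_zero,
      comp_zero]

variable {N : DerivedCategory X.Modules}

lemma exists_kill (hN : Dqc N) (hN' : GenAff N)
    (hgen : ∀ T, Dqc T → (∀ (n : ℤ) (f : N⟦n⟧ ⟶ T), f = 0) → IsZero T)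
    (L : CochainComplex X.Modules ℤ) (hL : Dqc (Q.obj L)) {C : DerivedCategory X.Modules}
    (hC : GenAff C) (k : C ⟶ Q.obj L) :
    ∃ (B : DerivedCategory X.Modules) (τ : Q.obj L ⟶ B) (m : ℕ), k ≫ τ = 0 ∧
      ∀ (U : X.Opens) (E : DerivedCategory X.Modules),
        (∀ n ≤ (m : ℤ), ∀ f : (DJ U).obj (N⟦n⟧) ⟶ E, f = 0) → ∀ f : (DJ U).obj (Q.obj L) ⟶ E,
        ∃ f', f = (DJ U).map τ ≫ f' := by
  choose F t P p x h1 h2 h3 h4 using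
    fun (L : {L : CochainComplex X.Modules ℤ // Dqc (Q.obj L)}) (m : ℕ) =>
      exists_attach hN hN' L.1 L.2 m
  let s (i : ℕ) : {L : CochainComplex X.Modules ℤ // Dqc (Q.obj L)} :=
    Nat.rec ⟨L, hL⟩ (fun i L => ⟨F L i, h1 L i⟩) i
  let A (i : ℕ) : CochainComplex X.Modules ℤ := (s i).1
  let tr (i : ℕ) : A i ⟶ A (i + 1) := t (s i) i
  have hA (i : ℕ) : Dqc (Q.obj (A i)) := (s i).2
  let H := tele A tr
  obtain ⟨T, pT, d, hT⟩ := exists_DT (𝟙 (Q.obj (∐ A)) - H.s)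
  have hfin {M : DerivedCategory X.Modules} (hM : GenAff M) (ζ : M ⟶ Q.obj (∐ A)) :
      ∃ F, ζ ≫ H.e F = 0 := by
    obtain ⟨F, hF⟩ := GenAff.exists_co A hM hA 0 (((shiftFunctorZero _ ℤ).app M).hom ≫ ζ)
    exact ⟨F, by rwa [Category.assoc, Preadditive.IsIso.comp_left_eq_zero] at hF⟩
  have hTz : IsZero T := by
    have hc := dqc_coproduct A hA
    refine hgen T (dqc_tri.ext₃ hT hc hc) (H.hom_eq_zero hT (fun n ζ => hfin ?_ ζ) ?_)
    · exact (gen_tri _).shift hN' n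
    · exact fun i n hn f => h3 (s i) i n hn f
  obtain ⟨m, hm⟩ := H.exists_tcomp_eq_zero hT (hTz.eq_of_tgt _ _) (hfin hC) k
  refine ⟨_, _, m, hm, fun U E hE f => ?_⟩
  clear hm
  induction m with
  | zero =>
    refine ⟨f, ?_⟩
    exact ((congrArg (· ≫ f) ((DJ U).map_id _)).trans (Category.id_comp f)).symm
  | succ m ih =>
    obtain ⟨f', hf'⟩ := ih fun n hn => hE n (by push_cast; linarith)
    obtain ⟨y, hy⟩ := (h2 (s m) m).map (J U)
    obtain ⟨f'', hf''⟩ := hy.desc₃ f' (h4 (s m) m U E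
      (fun n hn => hE n (by push_cast; linarith)) _)
    refine ⟨f'', ?_⟩
    rw [hf', hf'', ← Category.assoc]
    exact congrArg (· ≫ f'') ((DJ U).map_comp _ _).symm

/-- A uniform vanishing range for an object implies one for every complex with quasi-coherent
cohomology which is generated by affine open subsets. -/
lemma bdd_tower (hN : Dqc N) (hN' : GenAff N)
    (hgen : ∀ T, Dqc T → (∀ (n : ℤ) (f : N⟦n⟧ ⟶ T), f = 0) → IsZero T)
    (S : DerivedCategory X.Modules → Prop) (U : X.Opens) (hU : Bdd S ((DJ U).obj N))
    {K : DerivedCategory X.Modules} (hK : Dqc K) (hKU : GenAff ((DJ U).obj K)) :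
    Bdd S ((DJ U).obj K) := by
  obtain ⟨L, ⟨e⟩⟩ := exists_iso_Q K
  refine (bdd_tri S).iso ((DJ U).mapIso e) ?_
  have hL : GenAff ((DJ U).obj (Q.obj L)) := (gen_tri _).iso ((DJ U).mapIso e).symm hKU
  obtain ⟨B, τ, m, hτ, h⟩ := exists_kill hN hN' hgen L (dqc_tri.iso e.symm hK) hL
    (dε U (Q.obj L))
  have hτ' : (DJ U).map τ = 0 := by
    refine (coreflect U (isIso_dε_DJ le_rfl (Q.obj L)) B).1 ?_
    change (DJ U).map τ ≫ dε U B = 0 ≫ dε U B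
    rw [dε_naturality, hτ, zero_comp]
  obtain ⟨a, ha⟩ := hU
  refine ⟨a + m, fun E hE l hl f => ?_⟩
  have h0 (n : ℤ) (hn : n ≤ m) : Van ((DJ U).obj (N⟦n⟧)) E l :=
    Van.iso_left (dsh (J U) n N).symm ((van_shift _ _ _ _).2 (ha E hE _ (by linarith)))
  obtain ⟨f', rfl⟩ := h U (E⟦l⟧) h0 f
  rw [hτ', zero_comp]

end Tower

section Pushforward

variable {X : Scheme.{u}} [HasDerivedCategory.{u + 1} X.Modules] (V : X.Opens)
  (I : CochainComplex X.Modules ℤ)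

/-- The degreewise pushforward from an open subset. -/
abbrev cT : CochainComplex X.Modules ℤ := ((T V).mapHomologicalComplex (.up ℤ)).obj I

/-- The unit of restriction and pushforward, on complexes. -/
def cTη : I ⟶ cT V I where
  f i := tη V (I.X i)
  comm' i j _ := (tη_naturality V (I.d i j)).symm

/-- The unit of extension by zero and pushforward, on complexes. -/
def cTu : I ⟶ cT V ((cx (J V)).obj I) where
  f i := tu V (I.X i)
  comm' i j _ := (tu_naturality V (I.d i j)).symm

/-- The counit of extension by zero and pushforward, on complexes. -/
def cJκ : (cx (J V)).obj (cT V I) ⟶ I where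
  f i := jκ V (I.X i)
  comm' i j _ := (jκ_naturality V (I.d i j)).symm

lemma isIso_DJ_cTη : IsIso ((DJ V).map (Q.map (cTη V I))) :=
  isIso_DF_map_Q (G := J V) (cTη V I) fun i => inferInstanceAs (IsIso ((J V).map (tη V (I.X i))))

lemma tu_jκ {F G : X.Modules} (φ : F ⟶ (T V).obj G) :
    tu V F ≫ (T V).map ((J V).map φ ≫ jκ V G) = φ := by
  rw [Functor.map_comp, ← Category.assoc, ← tu_naturality, Category.assoc, right_tri,
    Category.comp_id]

lemma nullHomotopic_of_J {A : CochainComplex X.Modules ℤ} (g : A ⟶ cT V I)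
    (h : Homotopy ((cx (J V)).map g ≫ cJκ V I) 0) : Nonempty (Homotopy g 0) := by
  have h1 := ((T V).mapHomotopy h).compLeft (cTu V A)
  refine ⟨(Homotopy.ofEq ?_).trans (h1.trans (Homotopy.ofEq ?_))⟩
  · refine HomologicalComplex.hom_ext _ _ fun i => ?_
    exact (tu_jκ V (g.f i)).symm
  · rw [Functor.map_zero, comp_zero]

lemma hom_cT_eq_zero [I.IsKInjective] [(cT V I).IsKInjective] {M : DerivedCategory X.Modules}
    (hM : IsZero ((DJ V).obj M)) (f : M ⟶ Q.obj (cT V I)) : f = 0 := by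
  obtain ⟨A, ⟨e⟩⟩ := exists_iso_Q M
  obtain ⟨g, hg⟩ := Q_map_surjective A _ (e.hom ≫ f)
  have hA : IsZero (Q.obj ((cx (J V)).obj A)) :=
    hM.of_iso ((dfac (J V) A).symm ≪≫ (DJ V).mapIso e)
  obtain ⟨h⟩ := homotopy_of_Q_map_eq_zero _ _ ((cx (J V)).map g ≫ cJκ V I) (hA.eq_of_src _ _)
  obtain ⟨h'⟩ := nullHomotopic_of_J V I g h
  rw [← Preadditive.IsIso.comp_left_eq_zero e.hom, ← hg, Q_map_eq_of_homotopy _ h']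
  exact Q.map_zero _ _

end Pushforward

section Colocal

variable {X : Scheme.{u}} [HasDerivedCategory.{u + 1} X.Modules] {V W : X.Opens}
  {E A B : DerivedCategory X.Modules}

/-- Complexes which are determined by their restriction to `V`. -/
def Colocal (V : X.Opens) (E : DerivedCategory X.Modules) : Prop :=
  ∀ M : DerivedCategory X.Modules, IsZero ((DJ V).obj M) → ∀ k : ℤ, Van M E k

lemma colocal_cT (V : X.Opens) (I : CochainComplex X.Modules ℤ) [I.IsKInjective]
    [(cT V I).IsKInjective] : Colocal V (Q.obj (cT V I)) := by
  intro M hM k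
  have h0 : Van (M⟦-k⟧) (Q.obj (cT V I)) 0 := by
    intro f
    rw [← Preadditive.IsIso.comp_right_eq_zero f ((shiftFunctorZero _ ℤ).app _).hom]
    exact hom_cT_eq_zero V I (((shiftFunctor _ (-k)).map_isZero hM).of_iso (dsh (J V) (-k) M)) _
  have := (van_shift _ _ _ _).1 h0
  rwa [zero_sub, neg_neg] at this

lemma isZero_cone {D : Type*} [Category* D] [HasZeroObject D] [HasShift D ℤ] [Preadditive D]
    [∀ n : ℤ, (shiftFunctor D n).Additive] [Pretriangulated D] {A B E : D} {f : A ⟶ B} {g : B ⟶ E}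
    {h : E ⟶ A⟦(1 : ℤ)⟧} (hT : DT f g h) [hf : IsIso f] : IsZero E :=
  (Triangle.isZero₃_iff_isIso₁ _ hT).2 hf

lemma isIso_of_cone {D : Type*} [Category* D] [HasZeroObject D] [HasShift D ℤ] [Preadditive D]
    [∀ n : ℤ, (shiftFunctor D n).Additive] [Pretriangulated D] {A B E : D} {f : A ⟶ B} {g : B ⟶ E}
    {h : E ⟶ A⟦(1 : ℤ)⟧} (hT : DT f g h) (hE : IsZero E) : IsIso f :=
  (Triangle.isZero₃_iff_isIso₁ _ hT).1 hE

lemma Colocal.bijective (hE : Colocal V E) (ψ : A ⟶ B) [IsIso ((DJ V).map ψ)] (k : ℤ) :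
    Function.Bijective (Preadditive.leftComp (E⟦k⟧) ψ) := by
  obtain ⟨M, g, h, hT⟩ := exists_DT ψ
  obtain ⟨h', hT'⟩ := hT.map (J V)
  have hM : IsZero ((DJ V).obj M) := isZero_cone hT'
  constructor
  · refine (injective_iff_map_eq_zero _).2 fun ξ hξ => ?_
    obtain ⟨ζ, rfl⟩ := hT.desc₃ ξ hξ
    rw [hE M hM k ζ, comp_zero]
  · intro ξ
    let e : (E⟦k⟧)⟦(1 : ℤ)⟧ ≅ E⟦k + 1⟧ := ((shiftFunctorAdd _ k 1).app E).symm
    obtain ⟨ζ, hζ⟩ := hT.desc₂ (ξ⟦(1 : ℤ)⟧') (by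
      rw [← Preadditive.IsIso.comp_right_eq_zero _ e.hom]
      exact hE M hM _ _)
    obtain ⟨ζ', rfl⟩ := (shiftFunctor _ (1 : ℤ)).map_surjective ζ
    exact ⟨ζ', (shiftFunctor _ (1 : ℤ)).map_injective ((Functor.map_comp _ _ _).trans hζ.symm)⟩

lemma isIso_DJ_DJ (W : X.Opens) (ψ : A ⟶ B) [IsIso ((DJ V).map ψ)] :
    IsIso ((DJ V).map ((DJ W).map ψ)) := by
  obtain ⟨M, g, h, hT⟩ := exists_DT ψ
  obtain ⟨h', hT'⟩ := hT.map (J V)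
  have hM : IsZero ((DJ V).obj M) := isZero_cone hT'
  obtain ⟨h₁, hT₁⟩ := hT.map (J W)
  obtain ⟨h₂, hT₂⟩ := hT₁.map (J V)
  refine isIso_of_cone hT₂ (IsZero.of_iso ?_ (dJJ V W M).symm)
  have h3 : IsZero ((DJ W).obj ((DJ V).obj M)) := Functor.map_isZero _ hM
  have := h3.of_iso (dJJ W V M)
  rwa [inf_comm] at this

lemma bijective_rightComp (hA : IsIso (dε V A)) {M N : DerivedCategory X.Modules} (η : M ⟶ N)
    [IsIso ((DJ V).map η)] : Function.Bijective (Preadditive.rightComp A η) := by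
  have h1 := coreflect V hA M
  have h2 := coreflect V hA N
  have h3 : Function.Bijective (Preadditive.rightComp A η ∘ Preadditive.rightComp A (dε V M)) := by
    have : Preadditive.rightComp A η ∘ Preadditive.rightComp A (dε V M) =
        Preadditive.rightComp A (dε V N) ∘ Preadditive.rightComp A ((DJ V).map η) := by
      ext ξ
      change (ξ ≫ dε V M) ≫ η = (ξ ≫ (DJ V).map η) ≫ dε V N
      rw [Category.assoc, Category.assoc, dε_naturality]
    rw [this]
    exact h2.comp (bijective_comp _)
  exact (Function.Bijective.of_comp_iff _ h1).1 h3

end Colocal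

section StructureSheaf

variable {X : Scheme.{u}} [HasDerivedCategory.{u + 1} X.Modules]

lemma isQuasicoherent_OX : (OX X).IsQuasicoherent := by
  rw [isQuasicoherent_iff_loc]
  intro W hW f
  refine (loc_iff _ _).2 ⟨fun s hs => ?_, fun t => ?_⟩
  · obtain ⟨n, hn⟩ := exists_pow_mul_eq_zero_of_res_basicOpen_eq_zero_of_isCompact X hW.isCompact
      (osec W s) f hs
    exact ⟨n, hn⟩
  · obtain ⟨n, y, hy⟩ := exists_eq_pow_mul_of_isAffineOpen X W hW f (osec _ t)
    exact ⟨n, (osec W).symm y, hy⟩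

lemma dqc_SX : Dqc (SX X) := by
  rw [dqc_iff]
  intro k
  rcases lt_trichotomy k 0 with h | rfl | h
  · exact isQuasicoherent_of_isZero (isZero_of_isGE _ 0 k h)
  · exact isQuasicoherent_of_iso ((singleFunctorCompHomologyFunctorIso X.Modules 0).app _).symm
      isQuasicoherent_OX
  · exact isQuasicoherent_of_isZero (isZero_of_isLE _ 0 k h)

lemma isGE_tri : TriClass (fun N : DerivedCategory X.Modules => ∃ n : ℤ, N.IsGE n) where
  zero hA := ⟨0, (isGE_iff _ _).2 fun i _ => Functor.map_isZero _ hA⟩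
  iso e h := ⟨h.choose, haveI := h.choose_spec; TStructure.t.isGE_of_iso e _⟩
  shift {A} h k := by
    obtain ⟨n, h⟩ := h
    exact ⟨n - k, TStructure.t.isGE_shift A n k (n - k)⟩
  ext {A B E f g h} hT hA hE := by
    obtain ⟨a, ha⟩ := hA
    obtain ⟨b, hb⟩ := hE
    exact ⟨min a b, TStructure.t.isGE₂ _ hT _ (TStructure.t.isGE_of_ge A (min a b) a (min_le_left _ _))
      (TStructure.t.isGE_of_ge E (min a b) b (min_le_right _ _))⟩

variable {V W : X.Opens} {N : DerivedCategory X.Modules}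

lemma GenOD.exists_isGE (hN : GenOD V N) : ∃ n : ℤ, N.IsGE n := by
  refine hN _ isGE_tri ?_
  rintro _ rfl
  exact ⟨0, TStructure.t.isGE_of_iso (dsingle (J V) (OX X)).symm 0⟩

lemma isIso_dε_iff : IsIso (dε V N) ↔
    ∀ E : DerivedCategory X.Modules, IsZero ((DJ V).obj E) → ∀ k : ℤ, Van N E k := by
  constructor
  · intro h E hE k f
    have hz : IsZero ((DJ V).obj (E⟦k⟧)) :=
      ((shiftFunctor _ k).map_isZero hE).of_iso (dsh (J V) k E)
    rw [← Preadditive.IsIso.comp_left_eq_zero (dε V N), ← dε_naturality, hz.eq_of_tgt ((DJ V).map f) 0,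
      zero_comp]
  · intro h
    obtain ⟨M, g, w, hT⟩ := exists_DT (dε V N)
    obtain ⟨h', hT'⟩ := hT.map (J V)
    have := isIso_DJ_dε (le_refl V) N
    have hM : IsZero ((DJ V).obj M) := isZero_cone hT'
    have hg : g = 0 := by
      rw [← Preadditive.IsIso.comp_right_eq_zero g ((shiftFunctorZero _ ℤ).app M).inv]
      exact h M hM 0 _
    obtain ⟨s, hs⟩ := hT.lift₁ (𝟙 N) (by rw [hg, comp_zero])
    refine ⟨s, (coreflect V (isIso_dε_DJ le_rfl N) N).1 ?_, hs.symm⟩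
    change (dε V N ≫ s) ≫ dε V N = 𝟙 _ ≫ dε V N
    rw [Category.assoc, ← hs, Category.comp_id, Category.id_comp]

lemma isIso_dε_tri : TriClass (fun N : DerivedCategory X.Modules => IsIso (dε V N)) := by
  have : (fun N : DerivedCategory X.Modules => IsIso (dε V N)) = fun N =>
      ∀ i : {E : DerivedCategory X.Modules // IsZero ((DJ V).obj E)}, ∀ k : ℤ, Van N i.1 k := by
    ext N
    rw [isIso_dε_iff]
    exact ⟨fun h i => h i.1 i.2, fun h E hE => h ⟨E, hE⟩⟩
  rw [this]
  exact TriClass.forall fun i => {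
    zero := fun hA _ f => hA.eq_of_src f 0
    iso := fun e h k => (h k).iso_left e
    shift := fun h _ _ => (van_shift _ _ _ _).2 (h _)
    ext := fun hT hA hE k f => by
      obtain ⟨ζ, rfl⟩ := hT.desc₃ f (hA k _)
      rw [hE k ζ, comp_zero] }

lemma GenOD.isIso_dε (hN : GenOD V N) : IsIso (dε V N) := by
  refine hN _ isIso_dε_tri ?_
  rintro _ rfl
  exact isIso_dε_DJ le_rfl _

lemma isIso_DJ_shift {M : DerivedCategory X.Modules} (φ : N ⟶ M) [IsIso ((DJ V).map φ)] (k : ℤ) :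
    IsIso ((DJ V).map (φ⟦k⟧')) := by
  have : IsIso ((DJ V).map (φ⟦k⟧') ≫ (dsh (J V) k M).hom) := by
    rw [dsh_nat]; infer_instance
  exact IsIso.of_isIso_comp_right _ (dsh (J V) k M).hom

lemma isIso_dε_DJ_DJ (W V : X.Opens) (N : DerivedCategory X.Modules) :
    IsIso (dε V ((DJ W).obj ((DJ V).obj N))) :=
  isIso_dε_tri.iso (dJJ W V N) (isIso_dε_DJ inf_le_right N)

lemma rloc_OD_congr (f : Γ(X, W)) {E E' : DerivedCategory X.Modules} (η : E ⟶ E')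
    [IsIso ((DJ V).map η)] : RLoc f (OD V) E ↔ RLoc f (OD V) E' :=
  IsLocMap.congr (Preadditive.rightComp _ η) (Preadditive.rightComp _ η)
    (bijective_rightComp (isIso_dε_DJ_DJ W V _) η) (bijective_rightComp (isIso_dε_DJ_DJ _ V _) η)
    (fun _ => Category.assoc _ _ _) (fun _ => Category.assoc _ _ _) (fun _ => Category.assoc _ _ _)

variable [QuasiSeparatedSpace X]

lemma rloc_OD_of_gen (hV : IsAffineOpen V) (hN : GenOD V N) (hW : IsAffineOpen W) (f : Γ(X, W))
    (k : ℤ) : RLoc f (OD V) (N⟦k⟧) := by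
  refine hN (fun N => ∀ k : ℤ, RLoc f (OD V) (N⟦k⟧)) (hLoc_tri (dle_dmul _ _ _)) ?_ k
  rintro _ rfl k
  have h1 := isIso_DJ_dε (le_refl V) (SX X)
  have h2 := isIso_DJ_shift (V := V) (dε V (SX X)) k
  refine (rloc_OD_congr f ((dε V (SX X))⟦k⟧')).2 ?_
  have h3 : IsIso ((DJ W).map (dle (inf_le_right : W ⊓ V ≤ V) (SX X))) :=
    isIso_DJ_dle inf_le_right inf_le_left le_rfl _
  refine (rloc_of_iso f (dle (inf_le_right : W ⊓ V ≤ V) (SX X))).1 (rloc_gen dqc_SX f ?_ k)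
  exact gen_affine_qc hW (genOD_SX W) (isCompact_inf hW.isCompact hV.isCompact) inf_le_left

lemma exists_pushforward (hV : IsAffineOpen V) (hN : GenOD V N) :
    ∃ (K : DerivedCategory X.Modules) (η : N ⟶ K), Dqc K ∧ Colocal V K ∧
      IsIso ((DJ V).map η) := by
  obtain ⟨n, hn⟩ := hN.exists_isGE
  obtain ⟨I, hIn, hI, ⟨e⟩⟩ := exists_injective_iso N n
  have h1 : I.IsKInjective := CochainComplex.isKInjective_of_injective I n
  have h2 : (cT V I).IsStrictlyGE n := by
    rw [CochainComplex.isStrictlyGE_iff]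
    exact fun i hi => Functor.map_isZero (T V) (I.isZero_of_isStrictlyGE n i hi)
  have h3 : ∀ i, Injective ((cT V I).X i) := fun i =>
    inferInstanceAs (Injective ((T V).obj (I.X i)))
  have h4 : (cT V I).IsKInjective := CochainComplex.isKInjective_of_injective _ n
  have h5 := isIso_DJ_cTη V I
  have h6 : IsIso ((DJ V).map (e.inv ≫ Q.map (cTη V I))) := by
    rw [Functor.map_comp]; infer_instance
  have hc := colocal_cT V I
  refine ⟨Q.obj (cT V I), e.inv ≫ Q.map (cTη V I), dqc_iff_rloc.2 fun W hW f k => ?_, hc, h6⟩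
  have h7 := isIso_DJ_shift (V := V) (e.inv ≫ Q.map (cTη V I)) k
  have h8 := (rloc_OD_congr f ((e.inv ≫ Q.map (cTη V I))⟦k⟧')).1 (rloc_OD_of_gen hV hN hW f k)
  have h9 := isIso_DJ_dε (le_refl V) (SX X)
  have h10 := isIso_DJ_DJ (V := V) W (dε V (SX X))
  have h11 := isIso_DJ_DJ (V := V) (X.basicOpen f) (dε V (SX X))
  refine (IsLocMap.congr (Preadditive.leftComp _ ((DJ W).map (dε V (SX X))))
    (Preadditive.leftComp _ ((DJ (X.basicOpen f)).map (dε V (SX X)))) (hc.bijective _ k)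
    (hc.bijective _ k) (fun ξ => ?_) (fun ξ => ?_) (fun ξ => ?_)).2 h8
  · exact (reassoc_of% dmul_naturality f (dε V (SX X))) ξ
  · exact (reassoc_of% dmul_naturality (ors (X.basicOpen_le f) f) (dε V (SX X))) ξ
  · exact (reassoc_of% dle_naturality (X.basicOpen_le f) (dε V (SX X))) ξ

end StructureSheaf

section Whiskering

variable {C : Type u} [Category.{v} C] [Abelian C] [HasDerivedCategory.{w} C]
  {G₁ G₂ : C ⥤ C}
  [G₁.Additive] [PreservesFiniteLimits G₁] [PreservesFiniteColimits G₁]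
  [G₂.Additive] [PreservesFiniteLimits G₂] [PreservesFiniteColimits G₂]

lemma map_dnat (α : G₁ ⟶ G₁) (β : G₂ ⟶ G₂)
    (h : ∀ F, G₂.map (α.app F) = β.app (G₁.obj F)) (N : DerivedCategory C) :
    (DF G₂).map ((dnat α).app N) = (dnat β).app ((DF G₁).obj N) := by
  refine NatTrans.congr_app (natTrans_ext (α := Functor.whiskerRight (dnat α) (DF G₂))
    (β := Functor.whiskerLeft (DF G₁) (dnat β)) fun K => ?_) N
  change (DF G₂).map ((dnat α).app (Q.obj K)) = (dnat β).app ((DF G₁).obj (Q.obj K))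
  rw [← cancel_mono ((DF G₂).map (dfac G₁ K).hom), ← Functor.map_comp, dnat_app, Functor.map_comp]
  have h1 := (dnat β).naturality (dfac G₁ K).hom
  refine Eq.trans ?_ h1
  congr 1
  rw [← cancel_mono (dfac G₂ _).hom, dnat_app, dfac_naturality]
  congr 2
  exact HomologicalComplex.hom_ext _ _ fun i => h (K.X i)

end Whiskering

section Step

variable {X : Scheme.{u}} [HasDerivedCategory.{u + 1} X.Modules]
  {V W Y Z : X.Opens} {N : DerivedCategory X.Modules}

lemma J_map_mul (h : W ≤ V) (f : Γ(X, V)) (F : X.Modules) :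
    (J W).map ((mul f).app F) = (mul (ors h f)).app ((J V).obj F) := by
  rw [← cancel_mono (jin W ((J V).obj F))]
  refine ((jι W).naturality ((mul f).app F)).trans (J_hom_ext fun U hU s => ?_)
  rw [ap_comp, ap_comp, ap_mul _ _ hU, ap_smul, ors_ors]
  exact ap_mul f F (hU.trans h) _

lemma J_map_mul_self (f : Γ(X, V)) (F : X.Modules) :
    (J V).map ((mul f).app F) = (mul f).app ((J V).obj F) := by
  rw [J_map_mul le_rfl, ors_self]

lemma Φ_map_mul (h : Y ≤ V) (f : Γ(X, V)) (F : X.Modules) :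
    (Φ h).map ((mul f).app F) = (Φmul h f).app ((J V).obj F) := by
  rw [← cancel_epi ((Φπ h).app ((J V).obj F))]
  have h1 := NatTrans.congr_app (Φπ_Φmul h f) ((J V).obj F)
  refine (((Φπ h).naturality _).symm.trans ?_).trans h1.symm
  rw [J_map_mul_self, NatTrans.comp_app]

lemma J_map_Φmul (h : Y ≤ V) (f : Γ(X, V)) (F : X.Modules) :
    (J V).map ((Φmul h f).app F) = (mul f).app ((Φ h).obj F) := by
  rw [← cancel_epi ((J V).map ((Φπ h).app F)), ← Functor.map_comp]
  have h1 := NatTrans.congr_app (Φπ_Φmul h f) F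
  rw [NatTrans.comp_app, NatTrans.comp_app] at h1
  rw [h1, Functor.map_comp, J_map_mul_self]
  exact ((mul f).naturality _).symm

lemma dmul_dε_DΦ (h : Y ≤ V) (f : Γ(X, V)) (N : DerivedCategory X.Modules) :
    dmul f ((DΦ h).obj ((DJ V).obj N)) ≫ dε V _ = dε V _ ≫ (DΦ h).map (dmul f N) := by
  have h1 : (DΦ h).map (dmul f N) = dΦmul h f ((DJ V).obj N) := map_dnat _ _ (Φ_map_mul h f) N
  have h2 : (DJ V).map (dΦmul h f ((DJ V).obj N)) = dmul f ((DΦ h).obj ((DJ V).obj N)) :=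
    map_dnat _ _ (J_map_Φmul h f) _
  rw [h1, ← h2, dε_naturality]

lemma isIso_dε_DΦ (h : Y ≤ V) (N : DerivedCategory X.Modules) : IsIso (dε V ((DΦ h).obj N)) :=
  isIso_dε_tri.ext₃ (Φ_DT h N) (isIso_dε_DJ h N) (isIso_dε_DJ le_rfl N)

lemma isZero_tri : TriClass (fun N : DerivedCategory X.Modules => IsZero N) where
  zero h := h
  iso e h := h.of_iso e.symm
  shift h _ := Functor.map_isZero _ h
  ext hT hA hE := (Triangle.isZero₂_iff _ hT).2 ⟨hA.eq_of_src _ _, hE.eq_of_tgt _ _⟩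

lemma isZero_DJ_of_le (h : Y ≤ V) (hN : IsZero ((DJ V).obj N)) : IsZero ((DJ Y).obj N) := by
  have := isIso_DJ_dε h N
  exact ((DJ Y).map_isZero hN).of_iso (asIso ((DJ Y).map (dε V N))).symm

lemma isIso_DΦ_map (h : Y ≤ V) {M : DerivedCategory X.Modules} (ψ : M ⟶ N) [IsIso ((DJ V).map ψ)] :
    IsIso ((DΦ h).map ψ) := by
  obtain ⟨E, g, w, hT⟩ := exists_DT ψ
  obtain ⟨h', hT'⟩ := hT.map (J V)
  have h1 : IsZero ((DJ V).obj E) := isZero_cone hT'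
  obtain ⟨w', hT''⟩ := hT.map (Φ h)
  exact isIso_of_cone hT'' (isZero_tri.ext₃ (Φ_DT h E) (isZero_DJ_of_le h h1) h1)

lemma isIso_DJ_dmul (f : Γ(X, V)) (N : DerivedCategory X.Modules) :
    IsIso ((DJ (X.basicOpen f)).map (dmul f N)) := by
  have h1 : (DJ (X.basicOpen f)).map (dmul f N) =
      dmul (ors (X.basicOpen_le f) f) ((DJ V).obj N) := map_dnat _ _ (J_map_mul _ f) N
  have hu : IsUnit (ors (X.basicOpen_le f) f) := X.toRingedSpace.isUnit_res_basicOpen f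
  obtain ⟨u, hu⟩ := hu
  rw [h1, ← hu]
  exact ⟨dmul (↑u⁻¹ : Γ(X, X.basicOpen f)) _, by rw [dmul_dmul, Units.mul_inv, dmul_one],
    by rw [dmul_dmul, Units.inv_mul, dmul_one]⟩

lemma isZero_DJ_DΦ (h : Y ≤ V) (hW : W ≤ Y) (N : DerivedCategory X.Modules) :
    IsZero ((DJ W).obj ((DΦ h).obj N)) := by
  obtain ⟨h', hT⟩ := (Φ_DT h N).map (J Y)
  have h1 : IsIso ((DJ Y).map (dle h N)) := isIso_DJ_dle h le_rfl inf_le_left N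
  exact isZero_DJ_of_le hW (isZero_cone hT)

lemma isZero_DJ_lsup (l : List X.Opens) (h : ∀ V ∈ l, IsZero ((DJ V).obj N)) :
    IsZero ((DJ (lsup l)).obj N) := by
  induction l with
  | nil => exact isZero_DJ_bot N
  | cons V l ih =>
    have hV := h V List.mem_cons_self
    exact isZero_tri.sup V (lsup l) N (isZero_DJ_of_le inf_le_left hV) hV
      (ih fun W hW => h W (List.mem_cons_of_mem _ hW))

lemma TriClass.of_sup {P : DerivedCategory X.Modules → Prop} (hP : TriClass P)
    (h : P ((DJ (Y ⊔ Z)).obj N)) (h' : P ((DΦ (inf_le_left : Y ⊓ Z ≤ Y)).obj N)) :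
    P ((DJ Z).obj N) :=
  hP.ext₁ (Φ_DT (le_sup_right : Z ≤ Y ⊔ Z) N) h
    (hP.iso (asIso (dΦm (inf_le_left : Y ⊓ Z ≤ Y) (le_sup_right : Z ≤ Y ⊔ Z) inf_le_right
      le_sup_left N)) h')

variable [QuasiSeparatedSpace X]

lemma dΦ_torsion (hV : IsAffineOpen V) (hY : IsCompact (Y : Set X)) (h : Y ≤ V)
    (hN : GenOD V ((DJ V).obj N)) {E : DerivedCategory X.Modules} (hE : Dqc E) (f : Γ(X, V))
    (hf : X.basicOpen f ≤ Y) (k : ℤ) (ξ : (DΦ h).obj ((DJ V).obj N) ⟶ E⟦k⟧) :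
    ∃ n : ℕ, (Preadditive.leftComp (E⟦k⟧) ((DΦ h).map (dmul f N)))^[n] ξ = 0 := by
  have hN' : GenOD V ((DJ V).obj ((DJ V).obj N)) := hN.DJ le_rfl
  have h1 : RLoc f ((DΦ h).obj ((DJ V).obj N)) (E⟦k⟧) :=
    (rloc_tri f E).ext₃ (Φ_DT h ((DJ V).obj N)) (rloc_gen hE f (gen_affine_qc hV hN' hY h))
      (rloc_gen hE f (gen_affine_qc hV hN' hV.isCompact le_rfl)) k
  have h2 := isIso_dε_DΦ h ((DJ V).obj N)
  obtain ⟨n, hn⟩ := ((rloc_iff f).1 h1).1 (dε V _ ≫ ξ)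
    ((isZero_DJ_DΦ h hf ((DJ V).obj N)).eq_of_src _ _)
  refine ⟨n, (Preadditive.IsIso.comp_left_eq_zero (dε V ((DΦ h).obj ((DJ V).obj N))) _).1 ?_⟩
  rw [← dmul_iterate] at hn
  refine Eq.trans ?_ hn
  have h3 : Function.Semiconj (Preadditive.leftComp (E⟦k⟧) (dε V ((DΦ h).obj ((DJ V).obj N))))
      (Preadditive.leftComp (E⟦k⟧) ((DΦ h).map (dmul f N)))
      (Preadditive.leftComp (E⟦k⟧) (dmul f ((DΦ h).obj ((DJ V).obj N)))) := fun η =>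
    ((reassoc_of% dmul_dε_DΦ h f N) η).symm
  exact (h3.iterate_right n) ξ

lemma bdd_of_isZero (hV : IsAffineOpen V) (hN : GenOD V N) (hZ : IsZero ((DJ (Z ⊓ V)).obj N))
    {B : DerivedCategory X.Modules} (hB : Dqc B) (hB' : GenAff B)
    (hgen : ∀ T, Dqc T → (∀ (n : ℤ) (f : B⟦n⟧ ⟶ T), f = 0) → IsZero T)
    (S : DerivedCategory X.Modules → Prop) (hU : Bdd S ((DJ (Z ⊔ V)).obj B)) : Bdd S N := by
  obtain ⟨K, η, hK, hc, hη⟩ := exists_pushforward hV hN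
  have hε := hN.isIso_dε
  have e : (DJ V).obj K ≅ N := (asIso ((DJ V).map η)).symm ≪≫ asIso (dε V N)
  have h1 : IsZero ((DJ (Z ⊓ V)).obj K) :=
    hZ.of_iso (dJJ Z V K ≪≫ (DJ Z).mapIso ((asIso ((DJ V).map η)).symm) ≪≫ (dJJ Z V N).symm)
  have h2 : IsZero ((DJ V).obj ((DJ Z).obj K)) := by
    have h := dJJ V Z K
    rw [inf_comm] at h
    exact h1.of_iso h.symm
  have h3 : dε Z K = 0 := by
    rw [← Preadditive.IsIso.comp_right_eq_zero _ ((shiftFunctorZero _ ℤ).app K).inv]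
    exact hc _ h2 0 _
  have h4 : IsZero ((DJ Z).obj K) := by
    rw [IsZero.iff_id_eq_zero]
    refine (coreflect Z (isIso_dε_DJ le_rfl K) K).1 ?_
    change 𝟙 _ ≫ dε Z K = 0 ≫ dε Z K
    rw [h3, comp_zero, comp_zero]
  have h5 : GenAff ((DJ (Z ⊔ V)).obj K) := by
    refine (gen_tri _).sup Z V K ((gen_tri _).zero h1) ((gen_tri _).zero h4)
      ((gen_tri _).iso e.symm (hN.mono ?_))
    rintro _ rfl
    exact Gen.of ⟨V, hV, rfl⟩
  have h6 := bdd_tower hB hB' hgen S (Z ⊔ V) hU hK h5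
  exact (bdd_tri S).iso e ((bdd_tri S).of_sup h6
    ((bdd_tri S).zero (isZero_tri.ext₃ (Φ_DT (inf_le_left : Z ⊓ V ≤ Z) K) h1 h4)))

lemma bdd_dΦ (hV : IsAffineOpen V) (hY : IsCompact (Y : Set X)) (h : Y ≤ V)
    (S : DerivedCategory X.Modules → Prop) (hS : ∀ E, S E → Dqc E) (f : Γ(X, V))
    (hf : X.basicOpen f ≤ Y) (hN : GenOD V ((DJ V).obj N)) {M : DerivedCategory X.Modules}
    {g : (DJ V).obj N ⟶ M} {w : M ⟶ ((DJ V).obj N)⟦(1 : ℤ)⟧} (hT : DT (dmul f N) g w)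
    (hM : Bdd S ((DΦ h).obj M)) : Bdd S ((DΦ h).obj N) := by
  have := isIso_DJ_dε (le_refl V) N
  have hε := isIso_DΦ_map h (dε V N)
  refine (bdd_tri S).iso (asIso ((DΦ h).map (dε V N))) ?_
  obtain ⟨w', hT'⟩ := hT.map (Φ h)
  obtain ⟨a, ha⟩ := hM
  refine ⟨a, fun E hE n hn ξ => ?_⟩
  obtain ⟨m, hm⟩ := dΦ_torsion hV hY h hN (hS E hE) f hf n ξ
  induction m with
  | zero => exact hm
  | succ m ih =>
    rw [Function.iterate_succ_apply'] at hm
    obtain ⟨ζ, hζ⟩ := hT'.desc₃ _ hm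
    exact ih (hζ.trans (by rw [ha E hE n hn ζ, comp_zero]))

lemma bdd_koszul (hV : IsAffineOpen V) (l : List Γ(X, V))
    (h : lsup (l.map fun f => X.basicOpen f) ≤ V)
    (S : DerivedCategory X.Modules → Prop) (hS : ∀ E, S E → Dqc E)
    (h0 : ∀ N, GenOD V N → IsZero ((DJ (lsup (l.map fun f => X.basicOpen f))).obj N) → Bdd S N)
    (l' : List Γ(X, V)) (hl : l' ⊆ l) (hN : GenOD V N)
    (hz : ∀ f ∈ l, f ∈ l' ∨ IsZero ((DJ (X.basicOpen f)).obj N)) : Bdd S ((DΦ h).obj N) := by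
  induction l' generalizing N with
  | nil =>
    have h1 : IsZero ((DJ (lsup (l.map fun f => X.basicOpen f))).obj N) := by
      refine isZero_DJ_lsup _ fun W hW => ?_
      obtain ⟨f, hf, rfl⟩ := List.mem_map.1 hW
      exact (hz f hf).resolve_left List.not_mem_nil
    have := hN.isIso_dε
    exact (bdd_tri S).ext₃ (Φ_DT h N) ((bdd_tri S).zero h1)
      ((bdd_tri S).iso (asIso (dε V N)).symm (h0 N hN h1))
  | cons f l' ih =>
    have := hN.isIso_dε
    have hN' : GenOD V ((DJ V).obj N) := (gen_tri _).iso (asIso (dε V N)).symm hN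
    obtain ⟨M, g, w, hT⟩ := exists_DT (dmul f N)
    have hf : f ∈ l := hl List.mem_cons_self
    refine bdd_dΦ hV (isCompact_lsup ?_) h S hS f (le_lsup (List.mem_map.2 ⟨f, hf, rfl⟩)) hN' hT
      (ih (fun x hx => hl (List.mem_cons_of_mem _ hx)) ((gen_tri _).ext₃ hT hN' hN') ?_)
    · intro W hW
      obtain ⟨f, _, rfl⟩ := List.mem_map.1 hW
      exact (hV.basicOpen f).isCompact
    · intro f' hf'
      have key : IsZero ((DJ (X.basicOpen f')).obj N) → IsZero ((DJ (X.basicOpen f')).obj M) := by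
        intro h1
        have h2 : IsZero ((DJ (X.basicOpen f')).obj ((DJ V).obj N)) :=
          h1.of_iso ((DJ (X.basicOpen f')).mapIso (asIso (dε V N)))
        obtain ⟨w', hT'⟩ := hT.map (J (X.basicOpen f'))
        exact isZero_tri.ext₃ hT' h2 h2
      rcases hz f' hf' with h1 | h1
      · rcases List.mem_cons.1 h1 with rfl | h1
        · right
          obtain ⟨w', hT'⟩ := hT.map (J (X.basicOpen f'))
          have := isIso_DJ_dmul f' N
          exact isZero_cone hT'
        · exact Or.inl h1
      · exact Or.inr (key h1)

/-- Boundedness of the restriction to an open subset is inherited from a union with an affine open. -/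
lemma bdd_remove (hV : IsAffineOpen V) (hZ : IsCompact (Z : Set X))
    {B : DerivedCategory X.Modules} (hB : Dqc B) (hB' : GenAff B) (hBV : GenOD V ((DJ V).obj B))
    (hgen : ∀ T, Dqc T → (∀ (n : ℤ) (f : B⟦n⟧ ⟶ T), f = 0) → IsZero T)
    (S : DerivedCategory X.Modules → Prop) (hS : ∀ E, S E → Dqc E)
    (hU : Bdd S ((DJ (V ⊔ Z)).obj B)) : Bdd S ((DJ Z).obj B) := by
  refine (bdd_tri S).of_sup hU ?_
  obtain ⟨l, hl⟩ := exists_basicOpen_list hV (isCompact_inf hV.isCompact hZ) inf_le_left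
  have key : ∀ (Y : X.Opens) (_ : Y = V ⊓ Z) (h : Y ≤ V), Bdd S ((DΦ h).obj B) := by
    rintro Y hY h
    rw [← hY] at hl
    subst hl
    have := isIso_DJ_dε (le_refl V) B
    have := isIso_DΦ_map h (dε V B)
    refine (bdd_tri S).iso (asIso ((DΦ h).map (dε V B))) ?_
    refine bdd_koszul hV l h S hS (fun N hN hN0 => ?_) l (fun _ h => h) hBV fun f hf => Or.inl hf
    rw [hY, inf_comm] at hN0
    rw [sup_comm] at hU
    exact bdd_of_isZero hV hN hN0 hB hB' hgen S hU
  exact key _ rfl _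

end Step

section Conclusion

variable {X : Scheme.{u}}

lemma isZero_of_sections {F : X.Modules} (hF : F.IsQuasicoherent) {l : List X.Opens}
    (hl : ∀ V ∈ l, IsAffineOpen V) (hX : ⊤ = lsup l) (h : ∀ V ∈ l, ∀ s : Γ(F, V), s = 0) :
    IsZero F := by
  rw [IsZero.iff_id_eq_zero]
  refine hom_ext_ap fun W s => ?_
  rw [ap_id, ap_zero]
  refine sec_ext fun x hx => ?_
  obtain ⟨V, hV, hxV⟩ := mem_lsup.1 (show x ∈ lsup l by rw [← hX]; trivial)
  obtain ⟨f, hf, hxf⟩ := (hl V hV).exists_basicOpen_le ⟨x, hx⟩ hxV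
  refine ⟨X.basicOpen f, hf, hxf, ?_⟩
  obtain ⟨n, t, ht⟩ := ((loc_iff _ f).1 (loc_of_isQuasicoherent hF (hl V hV) f)).2 (rs F hf s)
  have hu : IsUnit (ors (X.basicOpen_le f) f) := X.toRingedSpace.isUnit_res_basicOpen f
  rw [h V hV t, map_zero] at ht
  rw [map_zero]
  exact ((hu.pow n).smul_eq_zero).1 ht.symm

variable [HasDerivedCategory.{u + 1} X.Modules]

lemma van_shift_right (N E : DerivedCategory X.Modules) (m k n : ℤ) (h : m + k = n) :
    Van N (E⟦m⟧) k ↔ Van N E n := by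
  let e : (E⟦m⟧)⟦k⟧ ≅ E⟦n⟧ := (shiftFunctorAdd' _ m k n h).symm.app E
  exact ⟨fun H f => (Preadditive.IsIso.comp_right_eq_zero f e.inv).1 (H _),
    fun H f => (Preadditive.IsIso.comp_right_eq_zero f e.hom).1 (H _)⟩

lemma van_of_shift (N E : DerivedCategory X.Modules) (n : ℤ)
    (h : ∀ f : N⟦-n⟧ ⟶ E, f = 0) : Van N E n := by
  have h1 := (van_shift N E (-n) 0).1 fun f =>
    (Preadditive.IsIso.comp_right_eq_zero f ((shiftFunctorZero _ ℤ).hom.app E)).1 (h _)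
  rwa [zero_sub, neg_neg] at h1

lemma dqc_Q {S : CochainComplex X.Modules ℤ} (h : MemDqc X S) : Dqc (Q.obj S) :=
  dqc_iff.2 fun k => isQuasicoherent_of_iso
    ((homologyFunctorFactors X.Modules k).app S).symm (h k)

lemma exists_bound_list (S : DerivedCategory X.Modules → Prop) (l : List X.Opens)
    (h : ∀ V ∈ l, Bdd S (OD V)) : ∃ a : ℤ, ∀ V ∈ l, ∀ E, S E → Van (OD V) E a := by
  have key : ∃ a : ℤ, ∀ V ∈ l, ∀ E, S E → ∀ n ≥ a, Van (OD V) E n := by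
    induction l with
    | nil => exact ⟨0, by simp⟩
    | cons V l ih =>
      obtain ⟨a, ha⟩ := ih fun W hW => h W (List.mem_cons_of_mem _ hW)
      obtain ⟨b, hb⟩ := h V List.mem_cons_self
      refine ⟨max a b, fun W hW E hE n hn => ?_⟩
      obtain rfl | hW := List.mem_cons.1 hW
      · exact hb E hE n ((le_max_right _ _).trans hn)
      · exact ha W hW E hE n ((le_max_left _ _).trans hn)
  obtain ⟨a, ha⟩ := key
  exact ⟨a, fun V hV E hE => ha V hV E hE a le_rfl⟩

variable [QuasiSeparatedSpace X]

lemma bdd_remove_lsup {B : DerivedCategory X.Modules} (hB : Dqc B) (hB' : GenAff B)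
    (hgen : ∀ T, Dqc T → (∀ (n : ℤ) (f : B⟦n⟧ ⟶ T), f = 0) → IsZero T)
    (S : DerivedCategory X.Modules → Prop) (hS : ∀ E, S E → Dqc E) (l : List X.Opens)
    (hl : ∀ V ∈ l, IsAffineOpen V ∧ GenOD V ((DJ V).obj B))
    {Z : X.Opens} (hZ : IsCompact (Z : Set X)) (hU : Bdd S ((DJ (lsup l ⊔ Z)).obj B)) :
    Bdd S ((DJ Z).obj B) := by
  induction l with
  | nil => rwa [show lsup [] ⊔ Z = Z from bot_sup_eq Z] at hU
  | cons V l ih =>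
    have h1 := hl V List.mem_cons_self
    have h2 : ∀ W ∈ l, IsAffineOpen W ∧ GenOD W ((DJ W).obj B) :=
      fun W hW => hl W (List.mem_cons_of_mem _ hW)
    rw [show lsup (V :: l) ⊔ Z = V ⊔ (lsup l ⊔ Z) from sup_assoc _ _ _] at hU
    exact ih h2 (bdd_remove h1.1 ((isCompact_lsup fun W hW => (h2 W hW).1.isCompact).union hZ)
      hB hB' h1.2 hgen S hS hU)

lemma bdd_OD {B : DerivedCategory X.Modules} (hB : Dqc B) (hB' : GenAff B)
    (hgen : ∀ T, Dqc T → (∀ (n : ℤ) (f : B⟦n⟧ ⟶ T), f = 0) → IsZero T)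
    (S : DerivedCategory X.Modules → Prop) (hS : ∀ E, S E → Dqc E) {l : List X.Opens}
    (hl : ∀ V ∈ l, IsAffineOpen V ∧ GenOD V ((DJ V).obj B)) (hX : ⊤ = lsup l) (hU : Bdd S B)
    {V : X.Opens} (hV : V ∈ l) : Bdd S (OD V) := by
  refine bdd_tower hB hB' hgen S V ?_ dqc_SX (Gen.of ⟨V, (hl V hV).1, rfl⟩)
  refine bdd_remove_lsup hB hB' hgen S hS l hl (hl V hV).1.isCompact ?_
  rw [← hX, top_sup_eq]
  have := isIso_dε_top B
  exact (bdd_tri S).iso (asIso (dε ⊤ B)).symm hU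

lemma exists_bound [CompactSpace X] {B : DerivedCategory X.Modules} (hB : Dqc B)
    {ι : Type*} {U : ι → X.Opens} (hU : iSup U = ⊤)
    (hBU : ∀ α, GenOD (U α) ((DJ (U α)).obj B))
    (hgen : ∀ T, Dqc T → (∀ (n : ℤ) (f : B⟦n⟧ ⟶ T), f = 0) → IsZero T) :
    ∃ a : ℤ, ∀ E, Dqc E → (∀ n ≥ (0 : ℤ), Van B E n) → IsZero (H0 (E⟦a⟧)) := by
  have hB' : GenAff B := by
    refine Gen.mono ?_ (genSmall_top hU hBU)
    rintro _ ⟨W, ⟨hW, -⟩, rfl⟩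
    exact Gen.of ⟨W, hW, rfl⟩
  obtain ⟨l, hl, hX⟩ := exists_lsup (Y := (⊤ : X.Opens)) isCompact_univ
    (fun V => IsAffineOpen V ∧ ∃ α, V ≤ U α) fun x hx => affineCover_exists hU x hx
  have hl' : ∀ V ∈ l, IsAffineOpen V ∧ GenOD V ((DJ V).obj B) := fun V hV =>
    ⟨(hl V hV).1, (hl V hV).2.elim fun α hα => (hBU α).of_le hα⟩
  let S : DerivedCategory X.Modules → Prop := fun E => Dqc E ∧ ∀ n ≥ (0 : ℤ), Van B E n
  obtain ⟨a, ha⟩ := exists_bound_list S l fun V hV =>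
    bdd_OD hB hB' hgen S (fun E hE => hE.1) hl' hX ⟨0, fun E hE => hE.2⟩ hV
  refine ⟨a, fun E hE hE' => isZero_of_sections (hE a) (fun V hV => (hl V hV).1) hX
    fun V hV s => ?_⟩
  obtain ⟨ξ, rfl⟩ := (B0_shift hE a V (hl V hV).1).2 s
  rw [ha V hV E ⟨hE, hE'⟩ ξ, map_zero]

end Conclusion

end LN

open LN DerivedCategory in
/-- **Theorem 4.2 (second part) of Lipman–Neeman.** Let `X` be a quasi-compact
quasi-separated scheme and `S` a perfect generator of `D_qc(X)`.  Then there is an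
integer `A = A(S)` such that for every `E ∈ D_qc(X)` and every `j ∈ ℤ` with
`H^j(E) ≠ 0`, one has `Hom(S[n], E) ≠ 0` for some `n ≤ A − j`. -/
theorem statement_2 (X : Scheme.{u}) [CompactSpace X] [QuasiSeparatedSpace X]
    [HasDerivedCategory.{u + 1} X.Modules]
    [∀ U : X.Opens, HasDerivedCategory.{u + 1} (ModOver X U)]
    (S : CochainComplex X.Modules ℤ) (hSqc : MemDqc X S) (hSperf : IsPerfect X S)
    (hSgen : ∀ E : DerivedCategory X.Modules,
      (∀ n : ℤ, ((homologyFunctor X.Modules n).obj E).IsQuasicoherent) →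
      ¬ IsZero E → ∃ (n : ℤ) (f : (Q.obj S)⟦n⟧ ⟶ E), f ≠ 0) :
    ∃ A : ℤ, ∀ E : DerivedCategory X.Modules,
      (∀ n : ℤ, ((homologyFunctor X.Modules n).obj E).IsQuasicoherent) →
      ∀ j : ℤ, ¬ IsZero ((homologyFunctor X.Modules j).obj E) →
        ∃ n : ℤ, n ≤ A - j ∧ ∃ f : (Q.obj S)⟦n⟧ ⟶ E, f ≠ 0 := by
  obtain ⟨ι, U, hU, hP⟩ := hSperf
  have hBU : ∀ α, GenOD (U α) ((DJ (U α)).obj (Q.obj S)) := fun α =>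
    (hP α).elim fun P hP => gen_DJ (U α) hP.1 hP.2
  obtain ⟨a, ha⟩ := exists_bound (dqc_Q hSqc) hU hBU fun T hT h => by
    by_contra hT'
    obtain ⟨n, f, hf⟩ := hSgen T (dqc_iff.1 hT) hT'
    exact hf (h n f)
  refine ⟨a, fun E hE j hj => ?_⟩
  by_contra! hf
  have h1 := ha (E⟦j - a⟧) (dqc_tri.shift (dqc_iff.2 hE) _) fun n hn =>
    (van_shift_right (Q.obj S) E (j - a) n _ rfl).2
      (van_of_shift _ _ _ (hf _ (by lia)))
  exact hj (h1.of_iso (((hshift X.Modules j).app E).symm ≪≫ (homologyFunctor X.Modules 0).mapIso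
    ((shiftFunctorAdd' _ (j - a) a j (by ring)).app E)))
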